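/- arXiv:0801.2259 — 6 statements merged into one kernel-verified Lean document; each statement's English description precedes it below -/
import Mathlib

section
/- Let A be a unital C*-algebra and let p, q be relatively prime positive integers. Let C_p⁻ = {f ∈ C([0,1], M_p) : f(1) = 0} and C_q⁺ = {g ∈ C([0,1], M_q) : g(0) = 0}, which are C*-algebras under pointwise operations. Suppose σ : C_p⁻ → A and ρ : C_q⁺ → A are *-homomorphisms such that σ(f) ρ(g) = ρ(g) σ(f) for all f ∈ C_p⁻, g ∈ C_q⁺, and such that σ(t ↦ (1−t)·1_p) + ρ(t ↦ t·1_q) = 1_A. Then there exists a unique unital *-homomorphism φ : Z_{p,q} → A such that φ(f ⊗ 1_q) = σ(f) for all f ∈ C_p⁻ and φ(1_p ⊗ g) = ρ(g) for all g ∈ C_q⁺, where f ⊗ 1_q and 1_p ⊗ g are regarded as elements of Z_{p,q} via the Kronecker identification. -/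
open scoped Kronecker

noncomputable section

lemma star_kronecker {p q : ℕ} (x : Matrix (Fin p) (Fin p) ℂ) (y : Matrix (Fin q) (Fin q) ℂ) :
    star (x ⊗ₖ y) = (star x) ⊗ₖ (star y) := by
  ext ⟨i, k⟩ ⟨j, l⟩
  simp [Matrix.star_apply, Matrix.kroneckerMap_apply, star_mul', mul_comm]

/-- The dimension-drop algebra `Z_{p,q}`: continuous functions from `[0,1]` to
`M_p ⊗ M_q = M_{pq}` whose value at `0` lies in `M_p ⊗ ℂ1` and whose value at `1` lies in
`ℂ1 ⊗ M_q`. -/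
def DimDrop (p q : ℕ) :
    StarSubalgebra ℂ C(unitInterval, Matrix (Fin p × Fin q) (Fin p × Fin q) ℂ) where
  carrier := {f | (∃ x : Matrix (Fin p) (Fin p) ℂ, f 0 = x ⊗ₖ (1 : Matrix (Fin q) (Fin q) ℂ)) ∧
      (∃ y : Matrix (Fin q) (Fin q) ℂ, f 1 = (1 : Matrix (Fin p) (Fin p) ℂ) ⊗ₖ y)}
  mul_mem' := by
    rintro f g ⟨⟨x, hx⟩, ⟨y, hy⟩⟩ ⟨⟨x', hx'⟩, ⟨y', hy'⟩⟩
    refine ⟨⟨x * x', ?_⟩, ⟨y * y', ?_⟩⟩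
    · rw [ContinuousMap.mul_apply, hx, hx', ← Matrix.mul_kronecker_mul, one_mul]
    · rw [ContinuousMap.mul_apply, hy, hy', ← Matrix.mul_kronecker_mul, one_mul]
  add_mem' := by
    rintro f g ⟨⟨x, hx⟩, ⟨y, hy⟩⟩ ⟨⟨x', hx'⟩, ⟨y', hy'⟩⟩
    refine ⟨⟨x + x', ?_⟩, ⟨y + y', ?_⟩⟩
    · rw [ContinuousMap.add_apply, hx, hx', Matrix.add_kronecker]
    · rw [ContinuousMap.add_apply, hy, hy', Matrix.kronecker_add]
  algebraMap_mem' := fun c =>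
    ⟨⟨c • 1, by rw [Algebra.algebraMap_eq_smul_one, ContinuousMap.smul_apply,
        ContinuousMap.one_apply, Matrix.smul_kronecker, Matrix.one_kronecker_one]⟩,
     ⟨c • 1, by rw [Algebra.algebraMap_eq_smul_one, ContinuousMap.smul_apply,
        ContinuousMap.one_apply, Matrix.kronecker_smul, Matrix.one_kronecker_one]⟩⟩
  star_mem' := by
    rintro f ⟨⟨x, hx⟩, ⟨y, hy⟩⟩
    refine ⟨⟨star x, ?_⟩, ⟨star y, ?_⟩⟩
    · rw [ContinuousMap.star_apply, hx, star_kronecker, star_one]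
    · rw [ContinuousMap.star_apply, hy, star_kronecker, star_one]

/-- The cone `C_p⁻ = {f ∈ C([0,1], M_p) : f(1) = 0}`. -/
def ConeAtOne (p : ℕ) : NonUnitalStarSubalgebra ℂ C(unitInterval, Matrix (Fin p) (Fin p) ℂ) where
  carrier := {f | f 1 = 0}
  add_mem' := by
    intro f g hf hg
    simp only [Set.mem_setOf_eq] at *
    simp [hf, hg]
  zero_mem' := by simp
  mul_mem' := by
    intro f g hf hg
    simp only [Set.mem_setOf_eq] at *
    simp [hf, hg]
  smul_mem' := by
    intro c f hf
    simp only [Set.mem_setOf_eq] at *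
    simp [hf]
  star_mem' := by
    intro f hf
    simp only [Set.mem_setOf_eq] at *
    simp [hf]

/-- The cone `C_q⁺ = {g ∈ C([0,1], M_q) : g(0) = 0}`. -/
def ConeAtZero (q : ℕ) : NonUnitalStarSubalgebra ℂ C(unitInterval, Matrix (Fin q) (Fin q) ℂ) where
  carrier := {g | g 0 = 0}
  add_mem' := by
    intro f g hf hg
    simp only [Set.mem_setOf_eq] at *
    simp [hf, hg]
  zero_mem' := by simp
  mul_mem' := by
    intro f g hf hg
    simp only [Set.mem_setOf_eq] at *
    simp [hf, hg]
  smul_mem' := by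
    intro c f hf
    simp only [Set.mem_setOf_eq] at *
    simp [hf]
  star_mem' := by
    intro f hf
    simp only [Set.mem_setOf_eq] at *
    simp [hf]

/-- The function `t ↦ (1 - t)·1_p`, as an element of `C_p⁻`. -/
def oneMinusT (p : ℕ) : ConeAtOne p :=
  ⟨⟨fun t => ((1 : ℝ) - (t : ℝ)) • (1 : Matrix (Fin p) (Fin p) ℂ),
      (continuous_const.sub continuous_subtype_val).smul continuous_const⟩,
    show ((1 : ℝ) - ((1 : unitInterval) : ℝ)) • (1 : Matrix (Fin p) (Fin p) ℂ) = 0 by simp⟩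

/-- The function `t ↦ t·1_q`, as an element of `C_q⁺`. -/
def tSmulOne (q : ℕ) : ConeAtZero q :=
  ⟨⟨fun t => ((t : ℝ)) • (1 : Matrix (Fin q) (Fin q) ℂ),
      continuous_subtype_val.smul continuous_const⟩,
    show (((0 : unitInterval) : ℝ)) • (1 : Matrix (Fin q) (Fin q) ℂ) = 0 by simp⟩

/-- The embedding `C_p⁻ → Z_{p,q}`, `f ↦ f ⊗ 1_q`. -/
def inclLeft (p q : ℕ) (f : ConeAtOne p) : DimDrop p q :=
  ⟨⟨fun t => ((f : C(unitInterval, Matrix (Fin p) (Fin p) ℂ)) t) ⊗ₖ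
        (1 : Matrix (Fin q) (Fin q) ℂ),
      by
        apply continuous_matrix
        rintro ⟨i, k⟩ ⟨j, l⟩
        exact (((continuous_apply j).comp ((continuous_apply i).comp
          (map_continuous (f : C(unitInterval, Matrix (Fin p) (Fin p) ℂ))))).mul
            continuous_const)⟩,
    ⟨(f : C(unitInterval, Matrix (Fin p) (Fin p) ℂ)) 0, rfl⟩,
    ⟨0, by
      show ((f : C(unitInterval, Matrix (Fin p) (Fin p) ℂ)) 1) ⊗ₖ
          (1 : Matrix (Fin q) (Fin q) ℂ) = _
      rw [show (f : C(unitInterval, Matrix (Fin p) (Fin p) ℂ)) 1 = 0 from f.2,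
        Matrix.zero_kronecker, Matrix.kronecker_zero]⟩⟩

/-- The embedding `C_q⁺ → Z_{p,q}`, `g ↦ 1_p ⊗ g`. -/
def inclRight (p q : ℕ) (g : ConeAtZero q) : DimDrop p q :=
  ⟨⟨fun t => (1 : Matrix (Fin p) (Fin p) ℂ) ⊗ₖ
        ((g : C(unitInterval, Matrix (Fin q) (Fin q) ℂ)) t),
      by
        apply continuous_matrix
        rintro ⟨i, k⟩ ⟨j, l⟩
        exact (continuous_const.mul ((continuous_apply l).comp ((continuous_apply k).comp
          (map_continuous (g : C(unitInterval, Matrix (Fin q) (Fin q) ℂ))))))⟩,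
    ⟨0, by
      show (1 : Matrix (Fin p) (Fin p) ℂ) ⊗ₖ
          ((g : C(unitInterval, Matrix (Fin q) (Fin q) ℂ)) 0) = _
      rw [show (g : C(unitInterval, Matrix (Fin q) (Fin q) ℂ)) 0 = 0 from g.2,
        Matrix.kronecker_zero, Matrix.zero_kronecker]⟩,
    ⟨(g : C(unitInterval, Matrix (Fin q) (Fin q) ℂ)) 1, rfl⟩⟩

section Norms
open scoped Matrix.Norms.L2Operator

lemma DD_continuous_hom {A : Type*} [CStarAlgebra A] {n : ℕ}
    (S : NonUnitalStarSubalgebra ℂ C(unitInterval, Matrix (Fin n) (Fin n) ℂ))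
    (hS : IsClosed (S : Set C(unitInterval, Matrix (Fin n) (Fin n) ℂ)))
    (σ : S →⋆ₙₐ[ℂ] A) : Continuous σ := by
  let _ : CStarAlgebra (Matrix (Fin n) (Fin n) ℂ) := {}
  have := hS
  let _ : NonUnitalCStarAlgebra S := NonUnitalStarSubalgebra.nonUnitalCStarAlgebra S
  have h : ∀ a : S, ‖σ a‖ ≤ ‖a‖ := fun a => NonUnitalStarAlgHom.norm_apply_le σ a
  exact AddMonoidHomClass.continuous_of_bound σ 1 (by simpa using h)

/-- the approximate unit `min 1 (n t)` -/
def DDu (n : ℕ) : C(unitInterval, ℂ) :=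
  ⟨fun t => ((min 1 ((n : ℝ) * (t : ℝ)) : ℝ) : ℂ), by fun_prop⟩

lemma DDu_zero (n : ℕ) : DDu n 0 = 0 := by simp [DDu]

lemma DDu_tendsto {m : ℕ} (g : C(unitInterval, Matrix (Fin m) (Fin m) ℂ)) (hg : g 0 = 0) :
    Filter.Tendsto (fun n => DDu n • g) Filter.atTop (nhds g) := by
  rw [Metric.tendsto_atTop]
  intro ε hε
  have hc : ContinuousAt g 0 := g.continuous.continuousAt
  rw [Metric.continuousAt_iff] at hc
  obtain ⟨δ, hδ, h⟩ := hc (ε / 2) (by positivity)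
  obtain ⟨N, hN⟩ := exists_nat_ge (1 / δ)
  refine ⟨N, fun n hn => ?_⟩
  refine lt_of_le_of_lt ?_ (half_lt_self hε)
  rw [ContinuousMap.dist_le (by positivity)]
  intro t
  have ht0 : (0 : ℝ) ≤ t := t.2.1
  have hn0 : (0 : ℝ) ≤ (n : ℝ) * t := by positivity
  by_cases htd : (t : ℝ) < δ
  · have h1 := h (x := t) (by
      rw [Subtype.dist_eq]; simp [abs_of_nonneg ht0, htd])
    rw [hg, dist_zero_right] at h1
    rw [dist_eq_norm, ContinuousMap.smul_apply']
    have : (DDu n) t • g t - g t = (((min 1 ((n : ℝ) * (t : ℝ)) - 1 : ℝ)) : ℂ) • g t := by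
      simp [DDu, sub_smul]
    rw [this, norm_smul, Complex.norm_real, Real.norm_eq_abs]
    have h2 : |min 1 ((n : ℝ) * (t : ℝ)) - 1| ≤ 1 := by
      rw [abs_le]
      constructor
      · have : 0 ≤ min 1 ((n : ℝ) * (t : ℝ)) := le_min zero_le_one hn0
        linarith
      · have := min_le_left 1 ((n : ℝ) * (t : ℝ))
        linarith
    calc _ ≤ 1 * ‖g t‖ := by gcongr
      _ ≤ ε / 2 := by linarith
  · have h2 : 1 ≤ (n : ℝ) * t := by
      have h3 : (1 / δ) ≤ n := hN.trans (by exact_mod_cast hn)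
      push Not at htd
      calc (1 : ℝ) = 1 / δ * δ := by field_simp
        _ ≤ n * t := by gcongr
    have : DDu n t = 1 := by simp [DDu, h2]
    rw [ContinuousMap.smul_apply', this, one_smul, dist_self]
    positivity

end Norms

section Main
variable {A : Type*} [CStarAlgebra A] {p q : ℕ}

/-- A continuous linear functional on functions restricted from cone at one. -/
def DDS (σ : ConeAtOne p →⋆ₙₐ[ℂ] A) : C(unitInterval, Matrix (Fin p) (Fin p) ℂ) →ₗ[ℂ] A where
  toFun f := σ ⟨f - ContinuousMap.const _ (f 1), show _ = _ by simp⟩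
  map_add' f g := by
    rw [← map_add]; congr 1; ext1; ext1 t
    simp [add_sub_add_comm]
  map_smul' c f := by
    rw [RingHom.id_apply, ← map_smul]; congr 1; ext1; ext1 t
    simp [smul_sub]

def DDR (ρ : ConeAtZero q →⋆ₙₐ[ℂ] A) : C(unitInterval, Matrix (Fin q) (Fin q) ℂ) →ₗ[ℂ] A where
  toFun f := ρ ⟨f - ContinuousMap.const _ (f 0), show _ = _ by simp⟩
  map_add' f g := by
    rw [← map_add]; congr 1; ext1; ext1 t
    simp [add_sub_add_comm]
  map_smul' c f := by
    rw [RingHom.id_apply, ← map_smul]; congr 1; ext1; ext1 t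
    simp [smul_sub]

lemma DDS_eq (σ : ConeAtOne p →⋆ₙₐ[ℂ] A) (f : ConeAtOne p) : DDS σ f.1 = σ f := by
  simp only [DDS, LinearMap.coe_mk, AddHom.coe_mk]
  congr 1; ext1; ext1 t
  simp [show f.1 1 = 0 from f.2]

lemma DDR_eq (ρ : ConeAtZero q →⋆ₙₐ[ℂ] A) (f : ConeAtZero q) : DDR ρ f.1 = ρ f := by
  simp only [DDR, LinearMap.coe_mk, AddHom.coe_mk]
  congr 1; ext1; ext1 t
  simp [show f.1 0 = 0 from f.2]

lemma DDS_cont (σ : ConeAtOne p →⋆ₙₐ[ℂ] A) : Continuous (DDS σ) := by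
  refine (DD_continuous_hom (ConeAtOne p) ?_ σ).comp
    (f := fun f => ⟨f - ContinuousMap.const _ (f 1), show _ = _ by simp⟩) ?_
  · exact isClosed_eq (continuous_eval_const 1) continuous_const
  · refine Continuous.subtype_mk ?_ _
    exact continuous_id.sub (ContinuousMap.continuous_const'.comp
      (continuous_eval_const 1))

lemma DDR_cont (ρ : ConeAtZero q →⋆ₙₐ[ℂ] A) : Continuous (DDR ρ) := by
  refine (DD_continuous_hom (ConeAtZero q) ?_ ρ).comp
    (f := fun f => ⟨f - ContinuousMap.const _ (f 0), show _ = _ by simp⟩) ?_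
  · exact isClosed_eq (continuous_eval_const 0) continuous_const
  · refine Continuous.subtype_mk ?_ _
    exact continuous_id.sub (ContinuousMap.continuous_const'.comp
      (continuous_eval_const 0))

lemma DDS_mul (σ : ConeAtOne p →⋆ₙₐ[ℂ] A) (f g : C(unitInterval, Matrix (Fin p) (Fin p) ℂ))
    (hf : f 1 = 0) (hg : g 1 = 0) : DDS σ f * DDS σ g = DDS σ (f * g) := by
  have h1 := DDS_eq σ ⟨f, hf⟩
  have h2 := DDS_eq σ ⟨g, hg⟩
  have h3 := DDS_eq σ (⟨f, hf⟩ * ⟨g, hg⟩)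
  rw [map_mul, ← h1, ← h2] at h3
  exact h3.symm

lemma DDR_mul (ρ : ConeAtZero q →⋆ₙₐ[ℂ] A) (f g : C(unitInterval, Matrix (Fin q) (Fin q) ℂ))
    (hf : f 0 = 0) (hg : g 0 = 0) : DDR ρ f * DDR ρ g = DDR ρ (f * g) := by
  have h1 := DDR_eq ρ ⟨f, hf⟩
  have h2 := DDR_eq ρ ⟨g, hg⟩
  have h3 := DDR_eq ρ (⟨f, hf⟩ * ⟨g, hg⟩)
  rw [map_mul, ← h1, ← h2] at h3
  exact h3.symm

/-- identity function -/
def DDt : C(unitInterval, ℂ) := ⟨fun t => ((t : ℝ) : ℂ), by fun_prop⟩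

/-- a linear continuous map on scalar functions vanishing on powers of t vanishes -/
lemma DD_weier (D : C(unitInterval, ℂ) →ₗ[ℂ] A) (hD : Continuous D)
    (h : ∀ n : ℕ, D (DDt ^ n) = 0) (f : C(unitInterval, ℂ)) : D f = 0 := by
  let e : C(unitInterval, ℝ) → C(unitInterval, ℂ) := fun f =>
    (⟨Complex.ofReal, Complex.continuous_ofReal⟩ : C(ℝ, ℂ)).comp f
  have he : Continuous e := ContinuousMap.continuous_postcomp _
  have key : ∀ f : C(unitInterval, ℝ), D (e f) = 0 := by
    intro f
    have hcl : IsClosed {f : C(unitInterval, ℝ) | D (e f) = 0} :=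
      isClosed_eq (hD.comp he) continuous_const
    have hsub : (polynomialFunctions unitInterval : Set C(unitInterval, ℝ)) ⊆
        {f : C(unitInterval, ℝ) | D (e f) = 0} := by
      rintro _ ⟨P, -, rfl⟩
      induction P using Polynomial.induction_on' with
      | add P Q hP hQ =>
        simp only [Set.mem_setOf_eq] at *
        rw [map_add]
        have : ∀ a b, e (a + b) = e a + e b := by
          intro a b; ext t; simp [e]
        rw [this, map_add, hP, hQ, add_zero]
      | monomial n a =>
        simp only [Set.mem_setOf_eq]
        have : e ((Polynomial.toContinuousMapOnAlgHom unitInterval) (Polynomial.monomial n a))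
            = (a : ℂ) • DDt ^ n := by
          ext t; simp [e, DDt]
        erw [this]
        rw [map_smul, h, smul_zero]
    have htop : f ∈ (polynomialFunctions unitInterval).topologicalClosure := by
      have := polynomialFunctions_closure_eq_top 0 1
      change (polynomialFunctions unitInterval).topologicalClosure = ⊤ at this
      rw [this]; trivial
    exact closure_minimal hsub hcl htop
  have : f = e (⟨fun t => (f t).re, by fun_prop⟩) + Complex.I • e (⟨fun t => (f t).im, by fun_prop⟩) := by
    ext t
    simp [e, mul_comm Complex.I, Complex.re_add_im]
  rw [this, map_add, map_smul, key, key, smul_zero, add_zero]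

end Main
section Main2
variable {A : Type*} [CStarAlgebra A] {p q : ℕ}

lemma DD_weier' (D : C(unitInterval, ℂ) →ₗ[ℂ] A) (hD : Continuous D)
    (h : ∀ n : ℕ, D ((1 - DDt) ^ n) = 0) (f : C(unitInterval, ℂ)) : D f = 0 := by
  let s : C(unitInterval, unitInterval) := ⟨unitInterval.symm, unitInterval.continuous_symm⟩
  let c : C(unitInterval, ℂ) →ₗ[ℂ] C(unitInterval, ℂ) :=
    { toFun := fun f => f.comp s
      map_add' := fun _ _ => rfl
      map_smul' := fun _ _ => rfl }
  have hc : Continuous c := ContinuousMap.continuous_precomp s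
  have := DD_weier (D ∘ₗ c) (hD.comp hc) (fun n => by
    have : c (DDt ^ n) = (1 - DDt) ^ n := by
      ext t; simp [c, s, DDt]
    rw [LinearMap.comp_apply, this, h]) (c f)
  have hcc : c (c f) = f := by ext t; simp [c, s]
  rwa [LinearMap.comp_apply, hcc] at this

lemma DDS_const (σ : ConeAtOne p →⋆ₙₐ[ℂ] A) (x) : DDS σ (ContinuousMap.const _ x) = 0 := by
  simp only [DDS, LinearMap.coe_mk, AddHom.coe_mk]
  rw [← map_zero σ]; congr 1; ext1; ext1 t; simp

lemma DDR_const (ρ : ConeAtZero q →⋆ₙₐ[ℂ] A) (x) : DDR ρ (ContinuousMap.const _ x) = 0 := by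
  simp only [DDR, LinearMap.coe_mk, AddHom.coe_mk]
  rw [← map_zero ρ]; congr 1; ext1; ext1 t; simp

lemma DD_hone (σ : ConeAtOne p →⋆ₙₐ[ℂ] A) (ρ : ConeAtZero q →⋆ₙₐ[ℂ] A)
    (hone : σ (oneMinusT p) + ρ (tSmulOne q) = 1) :
    DDS σ ((1 - DDt) • 1) + DDR ρ (DDt • 1) = 1 := by
  rw [← hone, ← DDS_eq, ← DDR_eq]
  congr 2
  · ext1 t
    simp only [oneMinusT, DDt, ContinuousMap.smul_apply', ContinuousMap.coe_mk,
      ContinuousMap.sub_apply, ContinuousMap.one_apply]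
    ext i j
    simp [Matrix.smul_apply]

lemma DD_smul_cont {m : ℕ} (f : C(unitInterval, Matrix (Fin m) (Fin m) ℂ)) :
    Continuous (fun h : C(unitInterval, ℂ) => h • f) := by
  refine ContinuousMap.continuous_of_continuous_uncurry _ ?_
  have h1 : Continuous (fun x : C(unitInterval, ℂ) × unitInterval => x.1 x.2) := by fun_prop
  exact h1.smul (f.continuous.comp continuous_snd)

lemma DD_smul_smul {m : Type*} [Fintype m] (a b : C(unitInterval, ℂ))
    (f : C(unitInterval, Matrix m m ℂ)) : a • (b • f) = (a * b) • f := by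
  ext1 t; simp [smul_smul]

lemma DD_add_smul {m : Type*} [Fintype m] (a b : C(unitInterval, ℂ))
    (f : C(unitInterval, Matrix m m ℂ)) : (a + b) • f = a • f + b • f := by
  ext1 t; simp [add_smul]

lemma DD_smul_assoc {m : Type*} [Fintype m] (a : ℂ) (b : C(unitInterval, ℂ))
    (f : C(unitInterval, Matrix m m ℂ)) : (a • b) • f = a • (b • f) := by
  ext1 t; simp [smul_smul]

lemma DD_K1_pow (σ : ConeAtOne p →⋆ₙₐ[ℂ] A) (ρ : ConeAtZero q →⋆ₙₐ[ℂ] A)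
    (hone : σ (oneMinusT p) + ρ (tSmulOne q) = 1) (n : ℕ) :
    ∀ (f : C(unitInterval, Matrix (Fin p) (Fin p) ℂ)), f 1 = 0 →
    DDS σ f * DDR ρ (DDt ^ (n + 1) • 1) = DDS σ (DDt ^ (n + 1) • f) := by
  have h1 : ∀ (f : C(unitInterval, Matrix (Fin p) (Fin p) ℂ)), f 1 = 0 →
      DDS σ f * DDR ρ (DDt • 1) = DDS σ (DDt • f) := by
    intro f hf
    rw [eq_sub_of_add_eq' (DD_hone σ ρ hone), mul_sub, mul_one, DDS_mul _ _ _ hf, ← map_sub]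
    · congr 1; ext1 t; simp [sub_smul, mul_sub, sub_mul]
    · simp [DDt]
  induction n with
  | zero => simpa using h1
  | succ n ih =>
    intro f hf
    have : (DDt ^ (n + 1 + 1) • 1 : C(unitInterval, Matrix (Fin q) (Fin q) ℂ))
      = (DDt ^ (n + 1) • 1) * (DDt • 1) := by
      ext1 t; simp [pow_succ, smul_smul, mul_comm, mul_assoc]
    rw [this, ← DDR_mul, ← mul_assoc, ih f hf, h1]
    · rw [DD_smul_smul, pow_succ' _ (n+1)]
    · simp [hf]
    · simp [DDt]
    · simp [DDt]

lemma DD_K2_pow (σ : ConeAtOne p →⋆ₙₐ[ℂ] A) (ρ : ConeAtZero q →⋆ₙₐ[ℂ] A)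
    (hone : σ (oneMinusT p) + ρ (tSmulOne q) = 1) (n : ℕ) :
    ∀ (g : C(unitInterval, Matrix (Fin q) (Fin q) ℂ)), g 0 = 0 →
    DDS σ ((1 - DDt) ^ (n + 1) • 1) * DDR ρ g = DDR ρ ((1 - DDt) ^ (n + 1) • g) := by
  have h1 : ∀ (g : C(unitInterval, Matrix (Fin q) (Fin q) ℂ)), g 0 = 0 →
      DDS σ ((1 - DDt) • 1) * DDR ρ g = DDR ρ ((1 - DDt) • g) := by
    intro f hf
    rw [eq_sub_of_add_eq (DD_hone σ ρ hone), sub_mul, one_mul, DDR_mul _ _ _ _ hf, ← map_sub]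
    · congr 1; ext1 t; simp [sub_smul, mul_sub, sub_mul]
    · simp [DDt]
  induction n with
  | zero => simpa using h1
  | succ n ih =>
    intro f hf
    have : ((1 - DDt) ^ (n + 1 + 1) • 1 : C(unitInterval, Matrix (Fin p) (Fin p) ℂ))
      = ((1 - DDt) • 1) * ((1 - DDt) ^ (n + 1) • 1) := by
      ext1 t; simp [pow_succ, smul_smul, mul_comm, mul_assoc]
    rw [this, ← DDS_mul, mul_assoc, ih f hf, h1]
    · rw [DD_smul_smul, pow_succ' _ (n+1)]
    · simp [hf]
    · simp [DDt]
    · simp [DDt]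

lemma DD_K1 (σ : ConeAtOne p →⋆ₙₐ[ℂ] A) (ρ : ConeAtZero q →⋆ₙₐ[ℂ] A)
    (hone : σ (oneMinusT p) + ρ (tSmulOne q) = 1)
    (f : C(unitInterval, Matrix (Fin p) (Fin p) ℂ)) (hf : f 1 = 0)
    (h : C(unitInterval, ℂ)) (hh : h 0 = 0) :
    DDS σ f * DDR ρ (h • 1) = DDS σ (h • f) := by
  let D : C(unitInterval, ℂ) →ₗ[ℂ] A :=
    { toFun := fun h => DDS σ f * DDR ρ (h • 1) -
        DDS σ ((h - ContinuousMap.const _ (h 0)) • f)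
      map_add' := fun a b => by
        have : (a + b - ContinuousMap.const _ ((a + b) 0)) • f =
          (a - ContinuousMap.const _ (a 0)) • f + (b - ContinuousMap.const _ (b 0)) • f := by
          ext1 t; simp [sub_smul, add_smul]; abel
        rw [this, DD_add_smul, map_add, map_add, mul_add]; abel
      map_smul' := fun c a => by
        have : (c • a - ContinuousMap.const _ ((c • a) 0)) • f =
          c • ((a - ContinuousMap.const _ (a 0)) • f) := by
          ext1 t; simp [sub_smul, smul_sub, smul_smul]
        rw [this, DD_smul_assoc, map_smul (DDR ρ) c, map_smul (DDS σ) c, RingHom.id_apply, smul_sub, mul_smul_comm] }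
  have hD : Continuous D := by
    refine (continuous_const.mul ((DDR_cont ρ).comp (DD_smul_cont _))).sub ?_
    refine (DDS_cont σ).comp ((DD_smul_cont f).comp ?_)
    exact continuous_id.sub (ContinuousMap.continuous_const'.comp
      (continuous_eval_const 0))
  have := DD_weier D hD (fun n => by
    cases n with
    | zero =>
      have h1 : ((DDt ^ 0 - ContinuousMap.const _ ((DDt ^ 0 : C(unitInterval, ℂ)) 0)) • f) = 0 := by
        ext1 t; simp
      have h2 : (DDt ^ 0 • 1 : C(unitInterval, Matrix (Fin q) (Fin q) ℂ))
        = ContinuousMap.const _ 1 := by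
        ext1 t; simp
      simp only [D, LinearMap.coe_mk, AddHom.coe_mk]
      rw [h1, h2, DDR_const]; simp
    | succ n =>
      have h1 : ((DDt ^ (n+1) - ContinuousMap.const _ ((DDt ^ (n+1) : C(unitInterval, ℂ)) 0)) • f)
          = DDt ^ (n+1) • f := by
        ext1 t; simp [DDt]
      simp only [D, LinearMap.coe_mk, AddHom.coe_mk]
      rw [h1, DD_K1_pow σ ρ hone n f hf, sub_self]) h
  have h1 : (h - ContinuousMap.const _ (h 0)) • f = h • f := by
    ext1 t; simp [hh]
  simp only [D, LinearMap.coe_mk, AddHom.coe_mk] at this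
  rw [h1] at this
  exact sub_eq_zero.mp this

lemma DD_K2 (σ : ConeAtOne p →⋆ₙₐ[ℂ] A) (ρ : ConeAtZero q →⋆ₙₐ[ℂ] A)
    (hone : σ (oneMinusT p) + ρ (tSmulOne q) = 1)
    (f : C(unitInterval, Matrix (Fin q) (Fin q) ℂ)) (hf : f 0 = 0)
    (h : C(unitInterval, ℂ)) (hh : h 1 = 0) :
    DDS σ (h • 1) * DDR ρ f = DDR ρ (h • f) := by
  let D : C(unitInterval, ℂ) →ₗ[ℂ] A :=
    { toFun := fun h => DDS σ (h • 1) * DDR ρ f -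
        DDR ρ ((h - ContinuousMap.const _ (h 1)) • f)
      map_add' := fun a b => by
        have : (a + b - ContinuousMap.const _ ((a + b) 1)) • f =
          (a - ContinuousMap.const _ (a 1)) • f + (b - ContinuousMap.const _ (b 1)) • f := by
          ext1 t; simp [sub_smul, add_smul]; abel
        rw [this, DD_add_smul, map_add, map_add, add_mul]; abel
      map_smul' := fun c a => by
        have : (c • a - ContinuousMap.const _ ((c • a) 1)) • f =
          c • ((a - ContinuousMap.const _ (a 1)) • f) := by
          ext1 t; simp [sub_smul, smul_sub, smul_smul]
        rw [this, DD_smul_assoc, map_smul (DDR ρ) c, map_smul (DDS σ) c, RingHom.id_apply, smul_sub, smul_mul_assoc] }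
  have hD : Continuous D := by
    refine (((DDS_cont σ).comp (DD_smul_cont _)).mul continuous_const).sub ?_
    refine (DDR_cont ρ).comp ((DD_smul_cont f).comp ?_)
    exact continuous_id.sub (ContinuousMap.continuous_const'.comp
      (continuous_eval_const 1))
  have := DD_weier' D hD (fun n => by
    cases n with
    | zero =>
      have h1 : (((1 - DDt) ^ 0 -
          ContinuousMap.const _ (((1 - DDt) ^ 0 : C(unitInterval, ℂ)) 1)) • f) = 0 := by
        ext1 t; simp
      have h2 : ((1 - DDt) ^ 0 • 1 : C(unitInterval, Matrix (Fin p) (Fin p) ℂ))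
        = ContinuousMap.const _ 1 := by
        ext1 t; simp
      simp only [D, LinearMap.coe_mk, AddHom.coe_mk]
      rw [h1, h2, DDS_const]; simp
    | succ n =>
      have h1 : (((1 - DDt) ^ (n+1) -
          ContinuousMap.const _ (((1 - DDt) ^ (n+1) : C(unitInterval, ℂ)) 1)) • f)
          = (1 - DDt) ^ (n+1) • f := by
        ext1 t; simp [DDt]
      simp only [D, LinearMap.coe_mk, AddHom.coe_mk]
      rw [h1, DD_K2_pow σ ρ hone n f hf, sub_self]) h
  have h1 : (h - ContinuousMap.const _ (h 1)) • f = h • f := by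
    ext1 t; simp [hh]
  simp only [D, LinearMap.coe_mk, AddHom.coe_mk] at this
  rw [h1] at this
  exact sub_eq_zero.mp this

end Main2
section Main3
variable {A : Type*} [CStarAlgebra A] {p q : ℕ}

/-- pointwise Kronecker product -/
def DDkr (f : C(unitInterval, Matrix (Fin p) (Fin p) ℂ))
    (g : C(unitInterval, Matrix (Fin q) (Fin q) ℂ)) :
    C(unitInterval, Matrix (Fin p × Fin q) (Fin p × Fin q) ℂ) :=
  ⟨fun t => f t ⊗ₖ g t, by
    apply continuous_matrix
    rintro ⟨i, k⟩ ⟨j, l⟩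
    exact (((continuous_apply j).comp ((continuous_apply i).comp
          (map_continuous f))).mul ((continuous_apply l).comp ((continuous_apply k).comp
          (map_continuous g))))⟩

lemma DDkr_apply (f : C(unitInterval, Matrix (Fin p) (Fin p) ℂ))
    (g : C(unitInterval, Matrix (Fin q) (Fin q) ℂ)) (t) (i j k l) :
    DDkr f g t (i, k) (j, l) = f t i j * g t k l := rfl

lemma DDkr_mul (f f' : C(unitInterval, Matrix (Fin p) (Fin p) ℂ))
    (g g' : C(unitInterval, Matrix (Fin q) (Fin q) ℂ)) :
    DDkr f g * DDkr f' g' = DDkr (f * f') (g * g') := by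
  ext1 t
  exact (Matrix.mul_kronecker_mul _ _ _ _).symm

lemma DDkr_star (f : C(unitInterval, Matrix (Fin p) (Fin p) ℂ))
    (g : C(unitInterval, Matrix (Fin q) (Fin q) ℂ)) :
    star (DDkr f g) = DDkr (star f) (star g) := by
  ext1 t
  exact star_kronecker _ _

/-- block of a function -/
def DDblk (k l : Fin q) : C(unitInterval, Matrix (Fin p × Fin q) (Fin p × Fin q) ℂ) →ₗ[ℂ]
    C(unitInterval, Matrix (Fin p) (Fin p) ℂ) where
  toFun F := ⟨fun t => Matrix.of fun i j => F t (i, k) (j, l), by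
    apply continuous_matrix
    intro i j
    exact ((continuous_apply (j, l)).comp ((continuous_apply (i, k)).comp (map_continuous F)))⟩
  map_add' F G := rfl
  map_smul' c F := rfl

/-- scalar entry of a function -/
def DDent {m : Type*} (k l : m) (g : C(unitInterval, Matrix m m ℂ)) : C(unitInterval, ℂ) :=
  ⟨fun t => g t k l, (continuous_apply l).comp ((continuous_apply k).comp (map_continuous g))⟩

lemma DDent_apply {m : Type*} (k l : m) (g : C(unitInterval, Matrix m m ℂ)) (t) :
    DDent k l g t = g t k l := rfl

/-- constant matrix unit -/
def DDe (k l : Fin q) : C(unitInterval, Matrix (Fin q) (Fin q) ℂ) :=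
  ContinuousMap.const _ (Matrix.single k l 1)

lemma DD_sum_ent (g : C(unitInterval, Matrix (Fin q) (Fin q) ℂ)) :
    ∑ k, ∑ l, DDent k l g • DDe k l = g := by
  ext1 t
  conv_rhs => rw [Matrix.matrix_eq_sum_single (g t)]
  simp [ContinuousMap.sum_apply, DDe, DDent_apply]

lemma DDblk_kr (f : C(unitInterval, Matrix (Fin p) (Fin p) ℂ))
    (g : C(unitInterval, Matrix (Fin q) (Fin q) ℂ)) (k l : Fin q) :
    DDblk k l (DDkr f g) = DDent k l g • f := by
  ext t i j
  change f t i j * g t k l = _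
  simp [DDent_apply, mul_comm]

/-- the middle approximant -/
def DDM (σ : ConeAtOne p →⋆ₙₐ[ℂ] A) (ρ : ConeAtZero q →⋆ₙₐ[ℂ] A) (n : ℕ) :
    C(unitInterval, Matrix (Fin p × Fin q) (Fin p × Fin q) ℂ) →ₗ[ℂ] A where
  toFun F := ∑ k, ∑ l, DDS σ (DDblk k l F) * DDR ρ (DDu n • DDe k l)
  map_add' F G := by
    simp only [map_add, add_mul, Finset.sum_add_distrib]
  map_smul' c F := by
    simp only [map_smul, smul_mul_assoc, Finset.smul_sum, RingHom.id_apply]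

/-- left endpoint part -/
def DDE1 (k : Fin q) : C(unitInterval, Matrix (Fin p × Fin q) (Fin p × Fin q) ℂ) →ₗ[ℂ]
    C(unitInterval, Matrix (Fin p) (Fin p) ℂ) where
  toFun F := (1 - DDt) • ContinuousMap.const _ (DDblk k k F 0)
  map_add' F G := by
    ext1 t; simp
  map_smul' c F := by
    ext1 t; simp [smul_smul, mul_comm]

/-- right endpoint part -/
def DDE2 (i : Fin p) : C(unitInterval, Matrix (Fin p × Fin q) (Fin p × Fin q) ℂ) →ₗ[ℂ]
    C(unitInterval, Matrix (Fin q) (Fin q) ℂ) where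
  toFun F := DDt • ContinuousMap.const _ (Matrix.of fun k l => F 1 (i, k) (i, l))
  map_add' F G := by
    ext t a b; simp [mul_add]
  map_smul' c F := by
    ext t a b; simp [mul_left_comm]

/-- middle part -/
def DDE0 : C(unitInterval, Matrix (Fin p × Fin q) (Fin p × Fin q) ℂ) →ₗ[ℂ]
    C(unitInterval, Matrix (Fin p × Fin q) (Fin p × Fin q) ℂ) where
  toFun F := F - (1 - DDt) • ContinuousMap.const _ (F 0) - DDt • ContinuousMap.const _ (F 1)
  map_add' F G := by
    ext1 t; simp; abel
  map_smul' c F := by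
    ext1 t; simp [smul_smul, mul_comm, smul_sub]

/-- the approximant -/
def DDP (σ : ConeAtOne p →⋆ₙₐ[ℂ] A) (ρ : ConeAtZero q →⋆ₙₐ[ℂ] A) (i : Fin p) (k : Fin q) (n : ℕ) :
    C(unitInterval, Matrix (Fin p × Fin q) (Fin p × Fin q) ℂ) →ₗ[ℂ] A :=
  DDS σ ∘ₗ DDE1 k + DDR ρ ∘ₗ DDE2 i + DDM σ ρ n ∘ₗ DDE0

/-- the limit relation -/
def DDT (σ : ConeAtOne p →⋆ₙₐ[ℂ] A) (ρ : ConeAtZero q →⋆ₙₐ[ℂ] A) (i : Fin p) (k : Fin q)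
    (F : C(unitInterval, Matrix (Fin p × Fin q) (Fin p × Fin q) ℂ)) (a : A) : Prop :=
  Filter.Tendsto (fun n => DDP σ ρ i k n F) Filter.atTop (nhds a)

lemma DDM_kr (σ : ConeAtOne p →⋆ₙₐ[ℂ] A) (ρ : ConeAtZero q →⋆ₙₐ[ℂ] A)
    (hone : σ (oneMinusT p) + ρ (tSmulOne q) = 1) (n : ℕ)
    (f : C(unitInterval, Matrix (Fin p) (Fin p) ℂ)) (hf : f 1 = 0)
    (g : C(unitInterval, Matrix (Fin q) (Fin q) ℂ)) (hg : g 0 = 0) :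
    DDM σ ρ n (DDkr f g) = DDS σ f * DDR ρ (DDu n • g) := by
  conv_rhs => rw [← DD_sum_ent g]
  have : DDu n • ∑ k, ∑ l, DDent k l g • DDe k l =
      ∑ k, ∑ l, (DDent k l g • 1) * (DDu n • DDe k l) := by
    ext1 t; simp [Finset.smul_sum, ContinuousMap.sum_apply, smul_smul, mul_comm]
  rw [this]
  simp only [map_sum, Finset.mul_sum, DDM, LinearMap.coe_mk, AddHom.coe_mk]
  refine Finset.sum_congr rfl fun k _ => Finset.sum_congr rfl fun l _ => ?_
  rw [DDblk_kr, ← DDR_mul, ← mul_assoc, DD_K1 σ ρ hone f hf]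
  · simp [DDent_apply, hg]
  · simp [DDent_apply, hg]
  · simp [DDu_zero]

lemma DDM_kr_left (σ : ConeAtOne p →⋆ₙₐ[ℂ] A) (ρ : ConeAtZero q →⋆ₙₐ[ℂ] A)
    (hone : σ (oneMinusT p) + ρ (tSmulOne q) = 1) (n : ℕ)
    (f : C(unitInterval, Matrix (Fin p) (Fin p) ℂ)) (hf : f 1 = 0) :
    DDM σ ρ n (DDkr f 1) = DDS σ (DDu n • f) := by
  rw [← DD_K1 σ ρ hone f hf _ (DDu_zero n)]
  conv_rhs => rw [← DD_sum_ent 1]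
  have : DDu n • ∑ k, ∑ l, DDent k l (1 : C(unitInterval, Matrix (Fin q) (Fin q) ℂ)) • DDe k l =
      ∑ k, ∑ l, (1 : Matrix (Fin q) (Fin q) ℂ) k l • (DDu n • DDe k l) := by
    ext1 t; simp [Finset.smul_sum, ContinuousMap.sum_apply, smul_smul, mul_comm, DDent_apply]
  rw [this]
  simp only [map_sum, Finset.mul_sum, DDM, LinearMap.coe_mk, AddHom.coe_mk]
  refine Finset.sum_congr rfl fun k _ => Finset.sum_congr rfl fun l _ => ?_
  have h2 : DDblk k l (DDkr f (1 : C(unitInterval, Matrix (Fin q) (Fin q) ℂ))) =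
      (1 : Matrix (Fin q) (Fin q) ℂ) k l • f := by
    rw [DDblk_kr]
    ext1 t; simp [DDent_apply]
  rw [h2, map_smul (DDS σ), map_smul (DDR ρ), smul_mul_assoc, mul_smul_comm]

lemma DDM_kr_right (σ : ConeAtOne p →⋆ₙₐ[ℂ] A) (ρ : ConeAtZero q →⋆ₙₐ[ℂ] A)
    (hone : σ (oneMinusT p) + ρ (tSmulOne q) = 1) (n : ℕ)
    (g : C(unitInterval, Matrix (Fin q) (Fin q) ℂ)) (hg : g 1 = 0) :
    DDM σ ρ n (DDkr 1 g) = DDR ρ (DDu n • g) := by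
  conv_rhs => rw [← DD_sum_ent g]
  have : DDu n • ∑ k, ∑ l, DDent k l g • DDe k l =
      ∑ k, ∑ l, DDent k l g • (DDu n • DDe k l) := by
    ext1 t; simp [Finset.smul_sum, ContinuousMap.sum_apply, smul_smul, mul_comm]
  rw [this]
  simp only [map_sum, DDM, LinearMap.coe_mk, AddHom.coe_mk]
  refine Finset.sum_congr rfl fun k _ => Finset.sum_congr rfl fun l _ => ?_
  rw [DDblk_kr, DD_K2 σ ρ hone]
  · simp [DDu_zero]
  · simp [DDent_apply, hg]

variable (σ : ConeAtOne p →⋆ₙₐ[ℂ] A) (ρ : ConeAtZero q →⋆ₙₐ[ℂ] A)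
  (hone : σ (oneMinusT p) + ρ (tSmulOne q) = 1) (i : Fin p) (k : Fin q)

lemma DDT_kr (hone : σ (oneMinusT p) + ρ (tSmulOne q) = 1)
    (f : C(unitInterval, Matrix (Fin p) (Fin p) ℂ)) (hf : f 1 = 0)
    (g : C(unitInterval, Matrix (Fin q) (Fin q) ℂ)) (hg : g 0 = 0) :
    DDT σ ρ i k (DDkr f g) (DDS σ f * DDR ρ g) := by
  have h1 : DDE1 k (DDkr f g) = 0 := by
    ext t a b; simp [DDE1, DDblk_kr, DDent_apply, hg]
  have h2 : DDE2 i (DDkr f g) = 0 := by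
    ext t a b; simp [DDE2, DDkr_apply, hf]
  have h0 : DDE0 (DDkr f g) = DDkr f g := by
    ext t ⟨a, b⟩ ⟨c, d⟩; simp [DDE0, DDkr_apply, hf, hg]
  simp only [DDT, DDP, LinearMap.add_apply, LinearMap.comp_apply, h1, h2, h0, map_zero, zero_add,
    DDM_kr σ ρ hone _ f hf g hg]
  exact tendsto_const_nhds.mul (((DDR_cont ρ).tendsto g).comp (DDu_tendsto g hg))

lemma DDT_left (hone : σ (oneMinusT p) + ρ (tSmulOne q) = 1)
    (f : C(unitInterval, Matrix (Fin p) (Fin p) ℂ)) (hf : f 1 = 0) :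
    DDT σ ρ i k (DDkr f 1) (DDS σ f) := by
  set f' := f - (1 - DDt) • ContinuousMap.const _ (f 0) with hf'
  have h1 : DDE1 k (DDkr f (1 : C(unitInterval, Matrix (Fin q) (Fin q) ℂ))) =
      (1 - DDt) • ContinuousMap.const _ (f 0) := by
    ext t a b; simp [DDE1, DDblk_kr, DDent_apply]
  have h2 : DDE2 i (DDkr f (1 : C(unitInterval, Matrix (Fin q) (Fin q) ℂ))) = 0 := by
    ext t a b; simp [DDE2, DDkr_apply, hf]
  have h0 : DDE0 (DDkr f (1 : C(unitInterval, Matrix (Fin q) (Fin q) ℂ))) = DDkr f' 1 := by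
    ext t ⟨a, b⟩ ⟨c, d⟩; simp [DDE0, DDkr_apply, hf, hf']; ring
  have h3 : f' 1 = 0 := by simp [hf', hf, DDt]
  have h4 : f' 0 = 0 := by simp [hf', DDt]
  simp only [DDT, DDP, LinearMap.add_apply, LinearMap.comp_apply, h1, h2, h0, map_zero, add_zero,
    DDM_kr_left σ ρ hone _ f' h3]
  have h5 : DDS σ f = DDS σ ((1 - DDt) • ContinuousMap.const _ (f 0)) + DDS σ f' := by
    rw [← map_add, hf', add_sub_cancel]
  rw [h5]
  exact tendsto_const_nhds.add (((DDS_cont σ).tendsto f').comp (DDu_tendsto f' h4))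

lemma DDT_right (hone : σ (oneMinusT p) + ρ (tSmulOne q) = 1)
    (g : C(unitInterval, Matrix (Fin q) (Fin q) ℂ)) (hg : g 0 = 0) :
    DDT σ ρ i k (DDkr 1 g) (DDR ρ g) := by
  set f' := g - DDt • ContinuousMap.const _ (g 1) with hf'
  have h1 : DDE2 i (DDkr (1 : C(unitInterval, Matrix (Fin p) (Fin p) ℂ)) g) =
      DDt • ContinuousMap.const _ (g 1) := by
    ext t a b; simp [DDE2, DDkr_apply]
  have h2 : DDE1 k (DDkr (1 : C(unitInterval, Matrix (Fin p) (Fin p) ℂ)) g) = 0 := by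
    ext t a b; simp [DDE1, DDblk_kr, DDent_apply, hg]
  have h0 : DDE0 (DDkr (1 : C(unitInterval, Matrix (Fin p) (Fin p) ℂ)) g) = DDkr 1 f' := by
    ext t ⟨a, b⟩ ⟨c, d⟩; simp [DDE0, DDkr_apply, hg, hf']; ring
  have h3 : f' 1 = 0 := by simp [hf', DDt]
  have h4 : f' 0 = 0 := by simp [hf', hg, DDt]
  simp only [DDT, DDP, LinearMap.add_apply, LinearMap.comp_apply, h1, h2, h0, map_zero, zero_add,
    DDM_kr_right σ ρ hone _ f' h3]
  have h5 : DDR ρ g = DDR ρ (DDt • ContinuousMap.const _ (g 1)) + DDR ρ f' := by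
    rw [← map_add, hf', add_sub_cancel]
  rw [h5]
  exact tendsto_const_nhds.add (((DDR_cont ρ).tendsto f').comp (DDu_tendsto f' h4))

end Main3
section Main4
variable {A : Type*} [CStarAlgebra A] {p q : ℕ}

/-- generators -/
inductive DDGen : C(unitInterval, Matrix (Fin p × Fin q) (Fin p × Fin q) ℂ) → Prop
  | left (f : C(unitInterval, Matrix (Fin p) (Fin p) ℂ)) (hf : f 1 = 0) : DDGen (DDkr f 1)
  | right (g : C(unitInterval, Matrix (Fin q) (Fin q) ℂ)) (hg : g 0 = 0) : DDGen (DDkr 1 g)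
  | both (f : C(unitInterval, Matrix (Fin p) (Fin p) ℂ)) (hf : f 1 = 0)
      (g : C(unitInterval, Matrix (Fin q) (Fin q) ℂ)) (hg : g 0 = 0) : DDGen (DDkr f g)

lemma DD_sqrt_cont : Continuous (fun z : ℂ => z / ((Real.sqrt ‖z‖ : ℝ) : ℂ)) := by
  rw [continuous_iff_continuousAt]
  intro z
  by_cases hz : z = 0
  · subst hz
    rw [ContinuousAt]
    simp only [zero_div]
    refine squeeze_zero_norm (a := fun z : ℂ => Real.sqrt ‖z‖) ?_ ?_
    · intro w
      rw [norm_div, Complex.norm_real, Real.norm_of_nonneg (Real.sqrt_nonneg _),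
        Real.div_sqrt]
    · have : Continuous (fun z : ℂ => Real.sqrt ‖z‖) := by fun_prop
      simpa using this.tendsto 0
  · refine ContinuousAt.div continuousAt_id ?_ ?_
    · fun_prop
    · have : Real.sqrt ‖z‖ ≠ 0 := by
        rw [Real.sqrt_ne_zero']; exact norm_pos_iff.mpr hz
      exact_mod_cast this

lemma DD_factor (h : C(unitInterval, ℂ)) (h0 : h 0 = 0) (h1 : h 1 = 0) :
    ∃ a b : C(unitInterval, ℂ), a 1 = 0 ∧ b 0 = 0 ∧ h = a * b := by
  refine ⟨⟨fun t => h t / ((Real.sqrt ‖h t‖ : ℝ) : ℂ), DD_sqrt_cont.comp h.continuous⟩,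
    ⟨fun t => ((Real.sqrt ‖h t‖ : ℝ) : ℂ), by fun_prop⟩, ?_, ?_, ?_⟩
  · simp [h1]
  · simp [h0]
  · ext t
    simp only [ContinuousMap.mul_apply, ContinuousMap.coe_mk]
    by_cases hz : h t = 0
    · simp [hz]
    · have : ((Real.sqrt ‖h t‖ : ℝ) : ℂ) ≠ 0 := by
        have : Real.sqrt ‖h t‖ ≠ 0 := by
          rw [Real.sqrt_ne_zero']; exact norm_pos_iff.mpr hz
        exact_mod_cast this
      field_simp

lemma DD_span_mid (F : C(unitInterval, Matrix (Fin p × Fin q) (Fin p × Fin q) ℂ))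
    (h0 : F 0 = 0) (h1 : F 1 = 0) : F ∈ Submodule.span ℂ {F | DDGen F} := by
  have : F = ∑ i : Fin p, ∑ j : Fin p, ∑ k : Fin q, ∑ l : Fin q,
      DDent (i, k) (j, l) F • DDkr (DDe i j) (DDe k l) := by
    ext t ⟨a, b⟩ ⟨c, d⟩
    simp only [ContinuousMap.sum_apply, Matrix.sum_apply, ContinuousMap.smul_apply',
      Matrix.smul_apply, DDkr_apply, DDent_apply, DDe, ContinuousMap.const_apply,
      Matrix.single_apply]
    rw [Finset.sum_eq_single a, Finset.sum_eq_single c, Finset.sum_eq_single b,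
      Finset.sum_eq_single d]
    all_goals simp +contextual
  rw [this]
  refine Submodule.sum_mem _ fun i _ => Submodule.sum_mem _ fun j _ =>
    Submodule.sum_mem _ fun k _ => Submodule.sum_mem _ fun l _ => ?_
  obtain ⟨a, b, ha, hb, hab⟩ := DD_factor (DDent (i, k) (j, l) F) (by simp [DDent_apply, h0])
    (by simp [DDent_apply, h1])
  have h2 : DDent (i, k) (j, l) F • DDkr (DDe i j) (DDe k l) =
      DDkr (a • DDe i j) (b • DDe k l) := by
    rw [hab]
    ext t ⟨x, y⟩ ⟨z, w⟩
    simp [DDkr_apply]; ring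
  rw [h2]
  exact Submodule.subset_span (DDGen.both _ (by simp [ha]) _ (by simp [hb]))

lemma DD_span (F : C(unitInterval, Matrix (Fin p × Fin q) (Fin p × Fin q) ℂ))
    (hF : F ∈ DimDrop p q) : F ∈ Submodule.span ℂ {F | DDGen F} := by
  obtain ⟨⟨x, hx⟩, ⟨y, hy⟩⟩ := hF
  set L : C(unitInterval, Matrix (Fin p × Fin q) (Fin p × Fin q) ℂ) :=
    DDkr ((1 - DDt) • ContinuousMap.const _ x) 1 with hL
  set R : C(unitInterval, Matrix (Fin p × Fin q) (Fin p × Fin q) ℂ) :=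
    DDkr 1 (DDt • ContinuousMap.const _ y) with hR
  have hLm : L ∈ Submodule.span ℂ {F | DDGen F} :=
    Submodule.subset_span (DDGen.left _ (by simp [DDt]))
  have hRm : R ∈ Submodule.span ℂ {F | DDGen F} :=
    Submodule.subset_span (DDGen.right _ (by simp [DDt]))
  have hM : F - L - R ∈ Submodule.span ℂ {F | DDGen F} := by
    apply DD_span_mid
    · ext ⟨a, b⟩ ⟨c, d⟩
      simp [hL, hR, DDkr_apply, hx, DDt]
    · ext ⟨a, b⟩ ⟨c, d⟩
      simp [hL, hR, DDkr_apply, hy, DDt]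
  have : F = (F - L - R) + L + R := by abel
  rw [this]
  exact Submodule.add_mem _ (Submodule.add_mem _ hM hLm) hRm

variable (σ : ConeAtOne p →⋆ₙₐ[ℂ] A) (ρ : ConeAtZero q →⋆ₙₐ[ℂ] A) (i : Fin p) (k : Fin q)

lemma DDT_unique {F} {a b : A} (ha : DDT σ ρ i k F a) (hb : DDT σ ρ i k F b) : a = b :=
  tendsto_nhds_unique ha hb

lemma DDT_zero : DDT σ ρ i k 0 0 := by
  simp only [DDT, map_zero]; exact tendsto_const_nhds

lemma DDT_add {F G} {a b : A} (ha : DDT σ ρ i k F a) (hb : DDT σ ρ i k G b) :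
    DDT σ ρ i k (F + G) (a + b) := by
  simp only [DDT, map_add]; exact Filter.Tendsto.add ha hb

lemma DDT_smul {F} {a : A} (c : ℂ) (ha : DDT σ ρ i k F a) :
    DDT σ ρ i k (c • F) (c • a) := by
  simp only [DDT, map_smul]; exact Filter.Tendsto.const_smul ha c

lemma DD_comm (hcomm : ∀ (f : ConeAtOne p) (g : ConeAtZero q), σ f * ρ g = ρ g * σ f) (f g) :
    DDS σ f * DDR ρ g = DDR ρ g * DDS σ f := hcomm _ _

lemma DDS_star (f : C(unitInterval, Matrix (Fin p) (Fin p) ℂ)) :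
    DDS σ (star f) = star (DDS σ f) := by
  simp only [DDS, LinearMap.coe_mk, AddHom.coe_mk]
  rw [← map_star]; congr 1; ext1; ext1 t; simp

lemma DDR_star (f : C(unitInterval, Matrix (Fin q) (Fin q) ℂ)) :
    DDR ρ (star f) = star (DDR ρ f) := by
  simp only [DDR, LinearMap.coe_mk, AddHom.coe_mk]
  rw [← map_star]; congr 1; ext1; ext1 t; simp

lemma DDT_gen_mul (hcomm : ∀ (f : ConeAtOne p) (g : ConeAtZero q), σ f * ρ g = ρ g * σ f)
    (hone : σ (oneMinusT p) + ρ (tSmulOne q) = 1)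
    {F G : C(unitInterval, Matrix (Fin p × Fin q) (Fin p × Fin q) ℂ)}
    (hF : DDGen F) (hG : DDGen G) :
    ∃ a b, DDT σ ρ i k F a ∧ DDT σ ρ i k G b ∧ DDT σ ρ i k (F * G) (a * b) := by
  have hc := DD_comm σ ρ hcomm
  have hL := DDT_left σ ρ i k hone
  have hR := DDT_right σ ρ i k hone
  have hB := DDT_kr σ ρ i k hone
  have m0 : ∀ f f' : C(unitInterval, Matrix (Fin p) (Fin p) ℂ), f 1 = 0 → (f * f') 1 = 0 := by
    intro f f' h; simp [h]
  have m1 : ∀ f f' : C(unitInterval, Matrix (Fin q) (Fin q) ℂ), f 0 = 0 → (f * f') 0 = 0 := by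
    intro f f' h; simp [h]
  cases hF with
  | left f hf =>
    cases hG with
    | left f' hf' =>
      refine ⟨_, _, hL f hf, hL f' hf', ?_⟩
      rw [DDkr_mul, one_mul, DDS_mul σ f f' hf hf']
      exact hL _ (m0 _ _ hf)
    | right g' hg' =>
      refine ⟨_, _, hL f hf, hR g' hg', ?_⟩
      rw [DDkr_mul, one_mul, mul_one]
      exact hB _ hf _ hg'
    | both f' hf' g' hg' =>
      refine ⟨_, _, hL f hf, hB f' hf' g' hg', ?_⟩
      rw [DDkr_mul, one_mul, ← mul_assoc, DDS_mul σ f f' hf hf']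
      exact hB _ (m0 _ _ hf) _ hg'
  | right g hg =>
    cases hG with
    | left f' hf' =>
      refine ⟨_, _, hR g hg, hL f' hf', ?_⟩
      rw [DDkr_mul, one_mul, mul_one, ← hc]
      exact hB _ hf' _ hg
    | right g' hg' =>
      refine ⟨_, _, hR g hg, hR g' hg', ?_⟩
      rw [DDkr_mul, one_mul, DDR_mul ρ g g' hg hg']
      exact hR _ (m1 _ _ hg)
    | both f' hf' g' hg' =>
      refine ⟨_, _, hR g hg, hB f' hf' g' hg', ?_⟩
      rw [DDkr_mul, one_mul, ← mul_assoc, ← hc, mul_assoc, DDR_mul ρ g g' hg hg']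
      exact hB _ hf' _ (m1 _ _ hg)
  | both f hf g hg =>
    cases hG with
    | left f' hf' =>
      refine ⟨_, _, hB f hf g hg, hL f' hf', ?_⟩
      rw [DDkr_mul, mul_one, mul_assoc, ← hc, ← mul_assoc, DDS_mul σ f f' hf hf']
      exact hB _ (m0 _ _ hf) _ hg
    | right g' hg' =>
      refine ⟨_, _, hB f hf g hg, hR g' hg', ?_⟩
      rw [DDkr_mul, mul_one, mul_assoc, DDR_mul ρ g g' hg hg']
      exact hB _ hf _ (m1 _ _ hg)
    | both f' hf' g' hg' =>
      refine ⟨_, _, hB f hf g hg, hB f' hf' g' hg', ?_⟩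
      rw [DDkr_mul, mul_assoc, ← mul_assoc (DDR ρ g), ← hc, mul_assoc, ← mul_assoc (DDS σ f),
        DDR_mul ρ g g' hg hg', DDS_mul σ f f' hf hf']
      exact hB _ (m0 _ _ hf) _ (m1 _ _ hg)

lemma DDT_gen_star (hcomm : ∀ (f : ConeAtOne p) (g : ConeAtZero q), σ f * ρ g = ρ g * σ f)
    (hone : σ (oneMinusT p) + ρ (tSmulOne q) = 1)
    {F : C(unitInterval, Matrix (Fin p × Fin q) (Fin p × Fin q) ℂ)} (hF : DDGen F) :
    ∃ a, DDT σ ρ i k F a ∧ DDT σ ρ i k (star F) (star a) := by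
  have hL := DDT_left σ ρ i k hone
  have hR := DDT_right σ ρ i k hone
  have hB := DDT_kr σ ρ i k hone
  cases hF with
  | left f hf =>
    refine ⟨_, hL f hf, ?_⟩
    rw [DDkr_star, star_one, ← DDS_star]
    exact hL _ (by simp [hf])
  | right g hg =>
    refine ⟨_, hR g hg, ?_⟩
    rw [DDkr_star, star_one, ← DDR_star]
    exact hR _ (by simp [hg])
  | both f hf g hg =>
    refine ⟨_, hB f hf g hg, ?_⟩
    rw [DDkr_star, star_mul, ← DDR_star, ← DDS_star, ← DD_comm σ ρ hcomm]
    exact hB _ (by simp [hf]) _ (by simp [hg])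

lemma DDT_span_star (hcomm : ∀ (f : ConeAtOne p) (g : ConeAtZero q), σ f * ρ g = ρ g * σ f)
    (hone : σ (oneMinusT p) + ρ (tSmulOne q) = 1)
    {F : C(unitInterval, Matrix (Fin p × Fin q) (Fin p × Fin q) ℂ)}
    (hF : F ∈ Submodule.span ℂ {F | DDGen F}) :
    ∃ a, DDT σ ρ i k F a ∧ DDT σ ρ i k (star F) (star a) := by
  induction hF using Submodule.span_induction with
  | mem F hF => exact DDT_gen_star σ ρ i k hcomm hone hF
  | zero => exact ⟨0, DDT_zero σ ρ i k, by simpa using DDT_zero σ ρ i k⟩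
  | add F G _ _ h1 h2 =>
    obtain ⟨a, ha, ha'⟩ := h1
    obtain ⟨b, hb, hb'⟩ := h2
    refine ⟨a + b, DDT_add σ ρ i k ha hb, ?_⟩
    rw [star_add, star_add]
    exact DDT_add σ ρ i k ha' hb'
  | smul c F _ h1 =>
    obtain ⟨a, ha, ha'⟩ := h1
    refine ⟨c • a, DDT_smul σ ρ i k c ha, ?_⟩
    rw [star_smul, star_smul]
    exact DDT_smul σ ρ i k _ ha'

lemma DDT_span_mul (hcomm : ∀ (f : ConeAtOne p) (g : ConeAtZero q), σ f * ρ g = ρ g * σ f)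
    (hone : σ (oneMinusT p) + ρ (tSmulOne q) = 1)
    {F G : C(unitInterval, Matrix (Fin p × Fin q) (Fin p × Fin q) ℂ)}
    (hF : F ∈ Submodule.span ℂ {F | DDGen F}) (hG : G ∈ Submodule.span ℂ {F | DDGen F})
    {a b : A} (ha : DDT σ ρ i k F a) (hb : DDT σ ρ i k G b) :
    DDT σ ρ i k (F * G) (a * b) := by
  induction hF using Submodule.span_induction generalizing a with
  | zero =>
    rw [DDT_unique σ ρ i k ha (DDT_zero σ ρ i k), zero_mul, zero_mul]
    exact DDT_zero σ ρ i k
  | add F F' hF hF' h1 h2 =>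
    obtain ⟨c, hc, -⟩ := DDT_span_star σ ρ i k hcomm hone hF
    obtain ⟨d, hd, -⟩ := DDT_span_star σ ρ i k hcomm hone hF'
    rw [DDT_unique σ ρ i k ha (DDT_add σ ρ i k hc hd), add_mul, add_mul]
    exact DDT_add σ ρ i k (h1 hc) (h2 hd)
  | smul z F hF h1 =>
    obtain ⟨c, hc, -⟩ := DDT_span_star σ ρ i k hcomm hone hF
    rw [DDT_unique σ ρ i k ha (DDT_smul σ ρ i k z hc), smul_mul_assoc, smul_mul_assoc]
    exact DDT_smul σ ρ i k z (h1 hc)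
  | mem F hF =>
    induction hG using Submodule.span_induction generalizing b with
    | zero =>
      rw [DDT_unique σ ρ i k hb (DDT_zero σ ρ i k), mul_zero, mul_zero]
      exact DDT_zero σ ρ i k
    | add G G' hG hG' h1 h2 =>
      obtain ⟨c, hc, -⟩ := DDT_span_star σ ρ i k hcomm hone hG
      obtain ⟨d, hd, -⟩ := DDT_span_star σ ρ i k hcomm hone hG'
      rw [DDT_unique σ ρ i k hb (DDT_add σ ρ i k hc hd), mul_add, mul_add]
      exact DDT_add σ ρ i k (h1 hc) (h2 hd)
    | smul z G hG h1 =>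
      obtain ⟨c, hc, -⟩ := DDT_span_star σ ρ i k hcomm hone hG
      rw [DDT_unique σ ρ i k hb (DDT_smul σ ρ i k z hc), mul_smul_comm, mul_smul_comm]
      exact DDT_smul σ ρ i k z (h1 hc)
    | mem G hG =>
      obtain ⟨a', b', ha', hb', h⟩ := DDT_gen_mul σ ρ i k hcomm hone hF hG
      rw [DDT_unique σ ρ i k ha ha', DDT_unique σ ρ i k hb hb']
      exact h

lemma DDT_one (hone : σ (oneMinusT p) + ρ (tSmulOne q) = 1) : DDT σ ρ i k 1 1 := by
  have h1 := DDT_left σ ρ i k hone ((1 - DDt) • 1) (by simp [DDt])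
  have h2 := DDT_right σ ρ i k hone (DDt • 1) (by simp [DDt])
  have h3 := DDT_add σ ρ i k h1 h2
  rw [DD_hone σ ρ hone] at h3
  convert h3 using 1
  ext t ⟨a, b⟩ ⟨c, d⟩
  have : (1 : Matrix (Fin p × Fin q) (Fin p × Fin q) ℂ) (a, b) (c, d)
      = (1 : Matrix (Fin p) (Fin p) ℂ) a c * (1 : Matrix (Fin q) (Fin q) ℂ) b d := by
    rw [← Matrix.one_kronecker_one]; rfl
  simp only [ContinuousMap.one_apply, ContinuousMap.add_apply, Matrix.add_apply, DDkr_apply, this,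
    ContinuousMap.smul_apply', Matrix.smul_apply, ContinuousMap.sub_apply, smul_eq_mul]
  ring

end Main4
/-- Universal property of the dimension-drop algebra: commuting *-homomorphisms
`σ : C_p⁻ → A` and `ρ : C_q⁺ → A` with `σ(t ↦ (1-t)·1_p) + ρ(t ↦ t·1_q) = 1` induce a
unique unital *-homomorphism `Z_{p,q} → A` restricting to `σ` and `ρ`. -/
theorem dimDrop_universal_property {A : Type*} [CStarAlgebra A] (p q : ℕ)
    (hp : 0 < p) (hq : 0 < q) (hpq : Nat.Coprime p q)
    (σ : ConeAtOne p →⋆ₙₐ[ℂ] A) (ρ : ConeAtZero q →⋆ₙₐ[ℂ] A)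
    (hcomm : ∀ (f : ConeAtOne p) (g : ConeAtZero q), σ f * ρ g = ρ g * σ f)
    (hone : σ (oneMinusT p) + ρ (tSmulOne q) = 1) :
    ∃! φ : DimDrop p q →⋆ₐ[ℂ] A,
      (∀ f : ConeAtOne p, φ (inclLeft p q f) = σ f) ∧
      (∀ g : ConeAtZero q, φ (inclRight p q g) = ρ g) := by
  have i : Fin p := ⟨0, hp⟩
  have k : Fin q := ⟨0, hq⟩
  have hex : ∀ F : DimDrop p q, ∃ a : A, DDT σ ρ i k F.1 a ∧ DDT σ ρ i k (star F.1) (star a) :=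
    fun F => DDT_span_star σ ρ i k hcomm hone (DD_span F.1 F.2)
  choose L hL hLs using hex
  have hu : ∀ (F : DimDrop p q) (a : A), DDT σ ρ i k F.1 a → L F = a :=
    fun F a h => DDT_unique σ ρ i k (hL F) h
  let φ : DimDrop p q →⋆ₐ[ℂ] A :=
    { toFun := L
      map_one' := hu _ _ (DDT_one σ ρ i k hone)
      map_mul' := fun F G => hu _ _ (DDT_span_mul σ ρ i k hcomm hone (DD_span F.1 F.2)
        (DD_span G.1 G.2) (hL F) (hL G))
      map_zero' := hu _ _ (DDT_zero σ ρ i k)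
      map_add' := fun F G => hu _ _ (DDT_add σ ρ i k (hL F) (hL G))
      commutes' := fun c => by
        rw [Algebra.algebraMap_eq_smul_one, Algebra.algebraMap_eq_smul_one]
        exact hu _ _ (DDT_smul σ ρ i k c (DDT_one σ ρ i k hone))
      map_star' := fun F => hu _ _ (hLs F) }
  have hl : ∀ f : ConeAtOne p, (inclLeft p q f).1 = DDkr f.1 1 := fun f => rfl
  have hr : ∀ g : ConeAtZero q, (inclRight p q g).1 = DDkr 1 g.1 := fun g => rfl
  refine ⟨φ, ⟨fun f => ?_, fun g => ?_⟩, ?_⟩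
  · refine hu _ _ ?_
    rw [hl, ← DDS_eq]
    exact DDT_left σ ρ i k hone f.1 f.2
  · refine hu _ _ ?_
    rw [hr, ← DDR_eq]
    exact DDT_right σ ρ i k hone g.1 g.2
  · rintro ψ ⟨h1, h2⟩
    have key : ∀ F : C(unitInterval, Matrix (Fin p × Fin q) (Fin p × Fin q) ℂ),
        F ∈ Submodule.span ℂ {F | DDGen F} →
        ∃ hF : F ∈ DimDrop p q, DDT σ ρ i k F (ψ ⟨F, hF⟩) := by
      intro F hF
      induction hF using Submodule.span_induction with
      | mem F hF =>
        cases hF with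
        | left f hf =>
          refine ⟨(inclLeft p q ⟨f, hf⟩).2, ?_⟩
          have := DDT_left σ ρ i k hone f hf
          rw [DDS_eq σ ⟨f, hf⟩, ← h1] at this
          exact this
        | right g hg =>
          refine ⟨(inclRight p q ⟨g, hg⟩).2, ?_⟩
          have := DDT_right σ ρ i k hone g hg
          rw [DDR_eq ρ ⟨g, hg⟩, ← h2] at this
          exact this
        | both f hf g hg =>
          have he : DDkr f g = (inclLeft p q ⟨f, hf⟩ * inclRight p q ⟨g, hg⟩ : DimDrop p q).1 := by
            change _ = (inclLeft p q ⟨f, hf⟩).1 * (inclRight p q ⟨g, hg⟩).1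
            rw [hl, hr, DDkr_mul, one_mul, mul_one]
          have := DDT_kr σ ρ i k hone f hf g hg
          rw [DDS_eq σ ⟨f, hf⟩, DDR_eq ρ ⟨g, hg⟩, ← h1, ← h2, ← map_mul] at this
          rw [he] at this ⊢
          exact ⟨Subtype.property _, this⟩
      | zero => exact ⟨zero_mem _, by
          have := map_zero ψ
          rw [show (⟨0, zero_mem _⟩ : DimDrop p q) = 0 from rfl, this]
          exact DDT_zero σ ρ i k⟩
      | add F G _ _ hF hG =>
        obtain ⟨hF, hF'⟩ := hF
        obtain ⟨hG, hG'⟩ := hG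
        refine ⟨add_mem hF hG, ?_⟩
        have := DDT_add σ ρ i k hF' hG'
        rw [← map_add] at this
        exact this
      | smul c F _ hF =>
        obtain ⟨hF, hF'⟩ := hF
        refine ⟨(c • (⟨F, hF⟩ : DimDrop p q)).2, ?_⟩
        have := DDT_smul σ ρ i k c hF'
        rw [← map_smul] at this
        exact this
    ext F
    obtain ⟨_, h⟩ := key F.1 (DD_span F.1 F.2)
    exact (hu F _ h).symm
end
end

section
/- Let A be a unital C*-algebra of stable rank one, let a and b be positive elements of M_k(A), and let p ∈ M_m(A) be a projection (p = p* = p²). If a ⊕ p ≾ b ⊕ p, then a ≾ b. -/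
open Filter Topology

noncomputable section

variable {A : Type*}

/-- A positive element of a matrix algebra over a C*-algebra: an element of the form `z* z`. -/
def IsPos [NonUnitalCStarAlgebra A] {ι : Type*} [Fintype ι] (a : Matrix ι ι A) : Prop :=
  ∃ z : Matrix ι ι A, a = z.conjTranspose * z

/-- Cuntz subequivalence `a ≾ b` of elements of matrix algebras over a C*-algebra:
there is a sequence `x k` of rectangular matrices with `x k * b * (x k)* → a`.
(Convergence is entrywise, which for matrices agrees with norm convergence in the
matrix C*-algebra.) -/
def CuntzLE [NonUnitalCStarAlgebra A] {ι κ : Type*} [Fintype ι] [Fintype κ]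
    (a : Matrix ι ι A) (b : Matrix κ κ A) : Prop :=
  ∃ x : ℕ → Matrix ι κ A,
    Tendsto (fun k => x k * b * (x k).conjTranspose) atTop (nhds a)

/-- The block-diagonal direct sum `a ⊕ b` of two square matrices. -/
def dsum [NonUnitalCStarAlgebra A] {ι κ : Type*} (a : Matrix ι ι A) (b : Matrix κ κ A) :
    Matrix (ι ⊕ κ) (ι ⊕ κ) A :=
  Matrix.fromBlocks a 0 0 b

/-- A unital C*-algebra has stable rank one if its invertible elements are dense. -/
def StableRankOne (A : Type*) [CStarAlgebra A] : Prop :=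
  Dense {a : A | IsUnit a}

open Matrix

section helpers

lemma cz_isOpen_units [CStarAlgebra A] {n : Type*} [Fintype n] [DecidableEq n] :
    IsOpen {x : Matrix n n A | IsUnit x} := by
  let _ : PartialOrder A := CStarAlgebra.spectralOrder A
  have : StarOrderedRing A := CStarAlgebra.spectralOrderedRing A
  have h : IsOpen {x : CStarMatrix n n A | IsUnit x} := Units.isOpen
  have h2 := h.preimage (CStarMatrix.ofMatrixL (m := n) (n := n) (A := A)).continuous
  exact h2

lemma cz_inverse_tendsto [CStarAlgebra A] {n : Type*} [Fintype n] [DecidableEq n]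
    (f : ℕ → Matrix n n A) (hf : Tendsto f atTop (𝓝 1)) :
    Tendsto (fun i => Ring.inverse (f i)) atTop (𝓝 1) := by
  let _ : PartialOrder A := CStarAlgebra.spectralOrder A
  have : StarOrderedRing A := CStarAlgebra.spectralOrderedRing A
  have h : ContinuousAt (Ring.inverse : CStarMatrix n n A → CStarMatrix n n A) 1 := by
    simpa using NormedRing.inverse_continuousAt (1 : (CStarMatrix n n A)ˣ)
  have h2 : Tendsto (fun i => (Ring.inverse (f i : CStarMatrix n n A) : CStarMatrix n n A)) atTop
      (𝓝 (Ring.inverse 1)) := h.tendsto.comp hf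
  rw [Ring.inverse_one] at h2
  exact h2

lemma cz_key {B : Type*} [CStarAlgebra B] (v : B) : ∃ x : ℕ → B,
      Tendsto (fun i => x i * ((star v * v) * (star v * v)) * star (x i)) atTop
        (𝓝 (star v * v)) := by
  let _ : PartialOrder B := CStarAlgebra.spectralOrder B
  have : StarOrderedRing B := CStarAlgebra.spectralOrderedRing B
  set e := star v * v with he
  have hpos : 0 ≤ e := star_mul_self_nonneg v
  have hsa : IsSelfAdjoint e := IsSelfAdjoint.star_mul_self v
  let ε : ℕ → ℝ := fun i => 1 / ((i : ℝ) + 1)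
  have hε : ∀ i, 0 < ε i := fun i => by positivity
  let f : ℕ → ℝ → ℝ := fun i t => 1 / √(max t (ε i))
  have hmax : ∀ i t, 0 < max t (ε i) := fun i t => lt_max_of_lt_right (hε i)
  have hfc : ∀ i, Continuous (f i) := fun i => by
    refine Continuous.div continuous_const (by fun_prop) fun t => ?_
    exact (Real.sqrt_pos.2 (hmax i t)).ne'
  refine ⟨fun i => cfc (f i) e, ?_⟩
  rw [tendsto_iff_norm_sub_tendsto_zero]
  refine squeeze_zero (fun _ => norm_nonneg _) (g := ε) (fun i => ?_)
    tendsto_one_div_add_atTop_nhds_zero_nat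
  have hst : star (cfc (f i) e) = cfc (f i) e := (IsSelfAdjoint.cfc (f := f i) (a := e)).star_eq
  have hc : ∀ s, ContinuousOn (f i) s := fun s => (hfc i).continuousOn
  have hid : cfc (fun t : ℝ => t) e = e := cfc_id' ℝ e
  have heq : cfc (f i) e * (e * e) * star (cfc (f i) e) - e
      = cfc (fun t => f i t * (t * t) * f i t - t) e := by
    have hci : ContinuousOn (fun t => f i t * (t * t)) (spectrum ℝ e) :=
      ((hfc i).mul (by fun_prop)).continuousOn
    rw [cfc_sub (fun t => f i t * (t * t) * f i t) (fun t => t) e (hci.mul (hc _)) (by fun_prop),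
        cfc_mul (fun t => f i t * (t * t)) (f i) e hci (hc _),
      cfc_mul (f i) (fun t => t * t) e (hc _) (by fun_prop),
        cfc_mul (fun t => t) (fun t => t) e (by fun_prop) (by fun_prop), hid, hst]
  rw [heq]
  refine norm_cfc_le (hε i).le fun t ht => ?_
  have ht0 : 0 ≤ t := spectrum_nonneg_of_nonneg hpos ht
  have hff : f i t * (t * t) * f i t - t = t * t / max t (ε i) - t := by
    have : f i t * f i t = 1 / max t (ε i) := by
      simp only [f]
      rw [div_mul_div_comm, Real.mul_self_sqrt (hmax i t).le, one_mul]
    calc _ = t * t * (f i t * f i t) - t := by ring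
      _ = _ := by rw [this]; ring
  rw [hff, Real.norm_eq_abs]
  rcases le_total t (ε i) with h | h
  · rw [max_eq_right h, abs_le]
    have h1 : 0 ≤ t * t / ε i := by have := hε i; positivity
    have h2 : t * t / ε i ≤ t := by
      rw [div_le_iff₀ (hε i)]; nlinarith
    constructor <;> linarith [hε i]
  · rw [max_eq_left h]
    have : 0 < t := (hε i).trans_le h
    rw [mul_div_assoc, div_self this.ne']
    simpa using (hε i).le

lemma cz_self_le_sq [CStarAlgebra A] {n : Type*} [Fintype n]
    (w : Matrix n n A) : CuntzLE (wᴴ * w) ((wᴴ * w) * (wᴴ * w)) := by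
  classical
  let _ : PartialOrder A := CStarAlgebra.spectralOrder A
  have : StarOrderedRing A := CStarAlgebra.spectralOrderedRing A
  obtain ⟨x, hx⟩ := cz_key (B := CStarMatrix n n A) w
  exact ⟨x, hx⟩

lemma cz_iff [CStarAlgebra A] {ι κ : Type*} [Fintype ι] [Fintype κ]
    (a : Matrix ι ι A) (b : Matrix κ κ A) :
    CuntzLE a b ↔ a ∈ closure (Set.range fun x : Matrix ι κ A => x * b * xᴴ) := by
  have : FirstCountableTopology (Matrix ι ι A) :=
    inferInstanceAs (FirstCountableTopology (ι → ι → A))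
  rw [mem_closure_iff_seq_limit]
  constructor
  · rintro ⟨x, hx⟩
    exact ⟨_, fun i => ⟨x i, rfl⟩, hx⟩
  · rintro ⟨y, hy, hl⟩
    choose x hx using hy
    refine ⟨x, ?_⟩
    convert hl using 2 with i
    exact hx i

lemma cz_conj [CStarAlgebra A] {ι κ : Type*} [Fintype ι] [Fintype κ]
    (x : Matrix ι κ A) (b : Matrix κ κ A) : CuntzLE (x * b * xᴴ) b :=
  ⟨fun _ => x, tendsto_const_nhds⟩

lemma cz_closed [CStarAlgebra A] {ι κ : Type*} [Fintype ι] [Fintype κ]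
    (b : Matrix κ κ A) (f : ℕ → Matrix ι ι A) (a : Matrix ι ι A)
    (hf : Tendsto f atTop (𝓝 a)) (h : ∀ᶠ i in atTop, CuntzLE (f i) b) : CuntzLE a b := by
  rw [cz_iff]
  exact isClosed_closure.mem_of_tendsto hf (h.mono fun i hi => (cz_iff _ _).1 hi)

lemma cz_trans [CStarAlgebra A] {ι κ μ : Type*} [Fintype ι] [Fintype κ] [Fintype μ]
    {a : Matrix ι ι A} {b : Matrix κ κ A} {c : Matrix μ μ A}
    (hab : CuntzLE a b) (hbc : CuntzLE b c) : CuntzLE a c := by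
  obtain ⟨x, hx⟩ := hab
  refine cz_closed c _ a hx (Eventually.of_forall fun i => ?_)
  obtain ⟨y, hy⟩ := hbc
  refine ⟨fun j => x i * y j, ?_⟩
  have hcont : Continuous fun m : Matrix κ κ A => x i * m * (x i)ᴴ := by fun_prop
  have := (hcont.tendsto b).comp hy
  convert this using 2 with j
  simp [Matrix.mul_assoc, conjTranspose_mul]

lemma cz_isUnit_blocks [CStarAlgebra A] {ι κ : Type*} [Fintype ι] [Fintype κ]
    [DecidableEq ι] [DecidableEq κ]
    (u u' : Matrix ι ι A) (b : Matrix ι κ A) (c : Matrix κ ι A) (d : Matrix κ κ A)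
    (h1 : u * u' = 1) (h2 : u' * u = 1) (hd : IsUnit (d - c * u' * b)) :
    IsUnit (fromBlocks u b c d) := by
  obtain ⟨v, hv⟩ := hd
  have hL : IsUnit (fromBlocks (1 : Matrix ι ι A) 0 (c * u') (1 : Matrix κ κ A)) := by
    refine isUnit_iff_exists.2 ⟨fromBlocks 1 0 (-(c * u')) 1, ?_, ?_⟩ <;> simp [fromBlocks_multiply]
  have hU : IsUnit (fromBlocks (1 : Matrix ι ι A) (u' * b) 0 (1 : Matrix κ κ A)) := by
    refine isUnit_iff_exists.2 ⟨fromBlocks 1 (-(u' * b)) 0 1, ?_, ?_⟩ <;> simp [fromBlocks_multiply]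
  have hD : IsUnit (fromBlocks u 0 0 (v : Matrix κ κ A)) := by
    refine isUnit_iff_exists.2 ⟨fromBlocks u' 0 0 (↑v⁻¹ : Matrix κ κ A), ?_, ?_⟩ <;>
      simp [fromBlocks_multiply, h1, h2]
  have : fromBlocks u b c d = fromBlocks (1 : Matrix ι ι A) 0 (c * u') (1 : Matrix κ κ A)
      * fromBlocks u 0 0 (v : Matrix κ κ A) *
      fromBlocks (1 : Matrix ι ι A) (u' * b) 0 (1 : Matrix κ κ A) := by
    have e1 : u * (u' * b) = b := by rw [← Matrix.mul_assoc, h1, Matrix.one_mul]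
    have e2 : c * u' * u = c := by rw [Matrix.mul_assoc, h2, Matrix.mul_one]
    simp [fromBlocks_multiply, hv, e1, e2, Matrix.mul_assoc]
  rw [this]
  exact (hL.mul hD).mul hU

lemma cz_dense_blocks [CStarAlgebra A] {ι κ : Type*} [Fintype ι] [Fintype κ]
    [DecidableEq ι] [DecidableEq κ]
    (h1 : Dense {x : Matrix ι ι A | IsUnit x}) (h2 : Dense {x : Matrix κ κ A | IsUnit x}) :
    Dense {x : Matrix (ι ⊕ κ) (ι ⊕ κ) A | IsUnit x} := by
  intro M
  rw [← fromBlocks_toBlocks M]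
  set a := M.toBlocks₁₁
  set b := M.toBlocks₁₂
  set c := M.toBlocks₂₁
  set d := M.toBlocks₂₂
  have hc1 : Continuous fun a : Matrix ι ι A => fromBlocks a b c d := by fun_prop
  have := map_mem_closure (t := closure {x : Matrix (ι ⊕ κ) (ι ⊕ κ) A | IsUnit x}) hc1 (h1 a) ?_
  · rwa [closure_closure] at this
  rintro _ ⟨u, rfl⟩
  have hc2 : Continuous fun d : Matrix κ κ A =>
    fromBlocks (u : Matrix ι ι A) b c (d + c * (↑u⁻¹ : Matrix ι ι A) * b) := by fun_prop
  have := map_mem_closure (t := {x : Matrix (ι ⊕ κ) (ι ⊕ κ) A | IsUnit x}) hc2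
    (h2 (d - c * (↑u⁻¹ : Matrix ι ι A) * b)) ?_
  · simpa using this
  intro d' hd'
  refine cz_isUnit_blocks (u : Matrix ι ι A) (↑u⁻¹ : Matrix ι ι A) _ _ _ (by simp) (by simp) ?_
  simpa using hd'

lemma cz_dense_equiv [CStarAlgebra A] {ι κ : Type*} [Fintype ι] [Fintype κ]
    [DecidableEq ι] [DecidableEq κ] (e : ι ≃ κ)
    (h1 : Dense {x : Matrix ι ι A | IsUnit x}) : Dense {x : Matrix κ κ A | IsUnit x} := by
  intro M
  have hc : Continuous fun x : Matrix ι ι A => x.submatrix e.symm e.symm := by fun_prop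
  have := map_mem_closure (t := {x : Matrix κ κ A | IsUnit x}) hc (h1 (M.submatrix e e)) ?_
  · simpa using this
  rintro _ ⟨u, rfl⟩
  refine isUnit_iff_exists.2 ⟨(↑u⁻¹ : Matrix ι ι A).submatrix e.symm e.symm, ?_, ?_⟩ <;>
    simp [submatrix_mul_equiv]

lemma cz_dense_fin [CStarAlgebra A] (hA : StableRankOne A) (m : ℕ) :
    Dense {x : Matrix (Fin m) (Fin m) A | IsUnit x} := by
  induction m with
  | zero =>
    intro M
    apply subset_closure
    exact ⟨1, Subsingleton.elim _ _⟩
  | succ m ih =>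
    refine cz_dense_equiv (finSumFinEquiv (m := m) (n := 1)) (cz_dense_blocks ih ?_)
    intro M
    have hc : Continuous fun x : A => (Matrix.of fun _ _ => x : Matrix (Fin 1) (Fin 1) A) := by
      fun_prop
    have := map_mem_closure (t := {x : Matrix (Fin 1) (Fin 1) A | IsUnit x}) hc (hA (M 0 0)) ?_
    · convert this using 1
      ext i j
      rw [Subsingleton.elim i 0, Subsingleton.elim j 0]; rfl
    rintro _ ⟨u, rfl⟩
    refine isUnit_iff_exists.2 ⟨Matrix.of fun _ _ => (↑u⁻¹ : A), ?_, ?_⟩ <;>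
    · ext i j
      rw [Subsingleton.elim i 0, Subsingleton.elim j 0]
      simp [Matrix.mul_apply]

/-- The algebraic heart: with the second row `(γ, δ)` of full rank, any column `(v₁, v₂)`
annihilated by it is seen by the first row through `y * zᴴ` only. -/
lemma cz_core [CStarAlgebra A] {ι κ : Type*} [Fintype ι] [Fintype κ]
    [DecidableEq ι] [DecidableEq κ] (hd : Dense {x : Matrix κ κ A | IsUnit x})
    (z x11 : Matrix ι ι A) (x21 : Matrix κ ι A) (β : Matrix ι κ A) (δ : Matrix κ κ A)
    (hu : IsUnit ((x21 * zᴴ) * (x21 * zᴴ)ᴴ + δ * δᴴ))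
    (v1 : Matrix ι ι A) (v2 : Matrix κ ι A) (hv : x21 * zᴴ * v1 + δ * v2 = 0) :
    ∃ y u : Matrix ι ι A, x11 * zᴴ * v1 + β * v2 = y * zᴴ * u := by
  set γ := x21 * zᴴ with hγ
  have hc : Continuous fun s : Matrix κ κ A => γ * γᴴ + δ * s := by fun_prop
  obtain ⟨s, hs1, hs2⟩ := hd.inter_open_nonempty _ (cz_isOpen_units.preimage hc) ⟨δᴴ, hu⟩
  obtain ⟨s, rfl⟩ := hs2
  obtain ⟨g, hg⟩ := hs1
  simp only at hg
  set si : Matrix κ κ A := (↑s⁻¹ : Matrix κ κ A)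
  set gi : Matrix κ κ A := (↑g⁻¹ : Matrix κ κ A)
  set α := x11 * zᴴ with hα
  set t := γᴴ * si with ht
  have hG : (γ * t + δ) * (s : Matrix κ κ A) = g := by
    rw [hg, Matrix.add_mul, ht, Matrix.mul_assoc γ, Matrix.mul_assoc γᴴ, Units.inv_mul,
      Matrix.mul_one]
  have hG' : (γ * t + δ) = (g : Matrix κ κ A) * si := by
    rw [← hG, Matrix.mul_assoc (γ * t + δ), Units.mul_inv, Matrix.mul_one]
  set h := (α * t + β) * ((s : Matrix κ κ A) * gi) with hh
  have h0 : h * (γ * t + δ) = α * t + β := by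
    have : ((s : Matrix κ κ A) * gi) * ((g : Matrix κ κ A) * si) = 1 := by
      rw [Matrix.mul_assoc, ← Matrix.mul_assoc gi, Units.inv_mul, Matrix.one_mul, Units.mul_inv]
    rw [hG', hh, Matrix.mul_assoc (α * t + β), this, Matrix.mul_one]
  refine ⟨x11 - h * x21, v1 - t * v2, ?_⟩
  have h1 : (x11 - h * x21) * zᴴ = α - h * γ := by
    rw [Matrix.sub_mul, Matrix.mul_assoc h]
  rw [h1]
  have h2 : h * (γ * v1) = - (h * (δ * v2)) := by
    rw [← Matrix.mul_neg]; congr 1; exact eq_neg_of_add_eq_zero_left hv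
  have h3 : h * (γ * (t * v2)) + h * (δ * v2) = α * (t * v2) + β * v2 := by
    have := congrArg (· * v2) h0
    simpa only [Matrix.mul_add, Matrix.add_mul, Matrix.mul_assoc] using this
  simp only [Matrix.sub_mul, Matrix.mul_sub, Matrix.mul_assoc]
  rw [h2]
  have h4 : β * v2 = h * (γ * (t * v2)) + h * (δ * v2) - α * (t * v2) := by rw [h3]; abel
  rw [h4]
  abel

lemma cz_sq_le [CStarAlgebra A] {ι : Type*} [Fintype ι] (z y u : Matrix ι ι A) :
    CuntzLE ((y * zᴴ * u)ᴴ * (y * zᴴ * u)) (zᴴ * z) := by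
  have h1 : (y * zᴴ * u)ᴴ * (y * zᴴ * u) = uᴴ * ((y * zᴴ)ᴴ * (y * zᴴ)) * (uᴴ)ᴴ := by
    simp [conjTranspose_mul, Matrix.mul_assoc]
  have h2 : ((y * zᴴ)ᴴ * (y * zᴴ)) * ((y * zᴴ)ᴴ * (y * zᴴ)) =
      (z * yᴴ * y) * (zᴴ * z) * (z * yᴴ * y)ᴴ := by
    simp [conjTranspose_mul, Matrix.mul_assoc]
  rw [h1]
  refine cz_trans (cz_conj _ _) (cz_trans (cz_self_le_sq _) ?_)
  rw [h2]
  exact cz_conj _ _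

lemma cz_to_one [CStarAlgebra A] {ι κ : Type*} [Fintype ι] [Fintype κ] [DecidableEq ι]
    [DecidableEq κ] (a b : Matrix ι ι A) (p : Matrix κ κ A)
    (hp_star : pᴴ = p) (hp_idem : p * p = p)
    (h : CuntzLE (dsum a p) (dsum b p)) : CuntzLE (dsum a (1 : Matrix κ κ A)) (dsum b (1 : Matrix κ κ A)) := by
  obtain ⟨x, hx⟩ := h
  set P : Matrix (ι ⊕ κ) (ι ⊕ κ) A := fromBlocks 1 0 0 p with hP
  set Q : Matrix (ι ⊕ κ) (ι ⊕ κ) A := fromBlocks 0 0 0 (1 - p) with hQ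
  have hPs : Pᴴ = P := by simp [hP, fromBlocks_conjTranspose, hp_star]
  have hQs : Qᴴ = Q := by simp [hQ, fromBlocks_conjTranspose, hp_star]
  have e1 : P * dsum b (1 : Matrix κ κ A) * P = dsum b p := by
    simp [hP, dsum, fromBlocks_multiply, hp_idem]
  have e2 : P * dsum b (1 : Matrix κ κ A) * Q = 0 := by
    simp [hP, hQ, dsum, fromBlocks_multiply, Matrix.mul_sub, hp_idem]
  have e3 : Q * dsum b (1 : Matrix κ κ A) * P = 0 := by
    simp [hP, hQ, dsum, fromBlocks_multiply, Matrix.sub_mul, hp_idem]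
  have e4 : Q * dsum b (1 : Matrix κ κ A) * Q = Q := by
    simp [hQ, dsum, fromBlocks_multiply, Matrix.sub_mul, Matrix.mul_sub, hp_idem]
  have e5 : P * dsum a p * P + Q = dsum a (1 : Matrix κ κ A) := by
    simp [hP, hQ, dsum, fromBlocks_multiply, hp_idem, fromBlocks_add]
  refine ⟨fun i => P * x i * P + Q, ?_⟩
  have hc : Continuous fun m : Matrix (ι ⊕ κ) (ι ⊕ κ) A => P * m * P + Q := by fun_prop
  have := (hc.tendsto _).comp hx
  rw [e5] at this
  convert this using 2 with i
  simp only [Function.comp]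
  rw [conjTranspose_add, conjTranspose_mul, conjTranspose_mul, hPs, hQs, ← e1]
  calc _ = P * x i * (P * dsum b (1 : Matrix κ κ A) * P) * (x i)ᴴ * P + P * x i * (P * dsum b (1 : Matrix κ κ A) * Q)
        + (Q * dsum b (1 : Matrix κ κ A) * P) * (x i)ᴴ * P + Q * dsum b (1 : Matrix κ κ A) * Q := by noncomm_ring
    _ = _ := by rw [e2, e3, e4]; noncomm_ring

end helpers

/-- If `A` has stable rank one, `a, b` are positive matrices over `A`, `p` is a projection
matrix over `A`, and `a ⊕ p ≾ b ⊕ p`, then `a ≾ b`. -/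
theorem cuntz_cancel_projection [CStarAlgebra A] (hA : StableRankOne A)
    {k m : ℕ} (a b : Matrix (Fin k) (Fin k) A) (p : Matrix (Fin m) (Fin m) A)
    (ha : IsPos a) (hb : IsPos b)
    (hp_star : p.conjTranspose = p) (hp_idem : p * p = p)
    (h : CuntzLE (dsum a p) (dsum b p)) :
    CuntzLE a b := by
  obtain ⟨x, hx⟩ := cz_to_one a b p hp_star hp_idem h
  obtain ⟨w, rfl⟩ := ha
  obtain ⟨z, rfl⟩ := hb
  refine cz_trans (cz_self_le_sq w) ?_
  set a := wᴴ * w with ha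
  have haa : aᴴ = a := by simp [ha, conjTranspose_mul]
  set M := fun i => x i * dsum (zᴴ * z) (1 : Matrix (Fin m) (Fin m) A) * (x i)ᴴ with hM
  have h11 : Tendsto (fun i => (M i).toBlocks₁₁) atTop (𝓝 a) := by
    have hc : Continuous fun X : Matrix (Fin k ⊕ Fin m) (Fin k ⊕ Fin m) A => X.toBlocks₁₁ :=
      continuous_id.matrix_submatrix Sum.inl Sum.inl
    simpa [dsum, Function.comp_def] using (hc.tendsto _).comp hx
  have h12 : Tendsto (fun i => (M i).toBlocks₁₂) atTop (𝓝 0) := by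
    have hc : Continuous fun X : Matrix (Fin k ⊕ Fin m) (Fin k ⊕ Fin m) A => X.toBlocks₁₂ :=
      continuous_id.matrix_submatrix Sum.inl Sum.inr
    simpa [dsum, Function.comp_def] using (hc.tendsto _).comp hx
  have h21 : Tendsto (fun i => (M i).toBlocks₂₁) atTop (𝓝 0) := by
    have hc : Continuous fun X : Matrix (Fin k ⊕ Fin m) (Fin k ⊕ Fin m) A => X.toBlocks₂₁ :=
      continuous_id.matrix_submatrix Sum.inr Sum.inl
    simpa [dsum, Function.comp_def] using (hc.tendsto _).comp hx
  have h22 : Tendsto (fun i => (M i).toBlocks₂₂) atTop (𝓝 1) := by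
    have hc : Continuous fun X : Matrix (Fin k ⊕ Fin m) (Fin k ⊕ Fin m) A => X.toBlocks₂₂ :=
      continuous_id.matrix_submatrix Sum.inr Sum.inr
    simpa [dsum, Function.comp_def] using (hc.tendsto _).comp hx
  have hinv := cz_inverse_tendsto _ h22
  set c := fun i => (M i).toBlocks₁₁ -
    (M i).toBlocks₁₂ * (Ring.inverse (M i).toBlocks₂₂ * (M i).toBlocks₂₁) with hcdef
  have hc : Tendsto c atTop (𝓝 a) := by
    have hcont : Continuous fun q : Matrix (Fin k) (Fin k) A × Matrix (Fin k) (Fin m) A ×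
        Matrix (Fin m) (Fin m) A × Matrix (Fin m) (Fin k) A =>
        q.1 - q.2.1 * (q.2.2.1 * q.2.2.2) := by fun_prop
    have := (hcont.tendsto (a, 0, 1, 0)).comp
      (h11.prodMk_nhds (h12.prodMk_nhds (hinv.prodMk_nhds h21)))
    simpa [Function.comp_def, hcdef] using this
  have hcc : Tendsto (fun i => (c i)ᴴ * c i) atTop (𝓝 (a * a)) := by
    have hcont : Continuous fun q : Matrix (Fin k) (Fin k) A => qᴴ * q := by fun_prop
    have := (hcont.tendsto a).comp hc
    rwa [haa] at this
  refine cz_closed _ _ _ hcc ?_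
  filter_upwards [h22.eventually_mem (cz_isOpen_units.mem_nhds (isUnit_one))] with i hi
  -- the blocks of `M i`
  set x11 := (x i).toBlocks₁₁ with hx11
  set x12 := (x i).toBlocks₁₂ with hx12
  set x21 := (x i).toBlocks₂₁ with hx21
  set x22 := (x i).toBlocks₂₂ with hx22
  have hMi : M i = fromBlocks (x11 * zᴴ * (x11 * zᴴ)ᴴ + x12 * x12ᴴ)
      (x11 * zᴴ * (x21 * zᴴ)ᴴ + x12 * x22ᴴ) (x21 * zᴴ * (x11 * zᴴ)ᴴ + x22 * x12ᴴ)
      (x21 * zᴴ * (x21 * zᴴ)ᴴ + x22 * x22ᴴ) := by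
    simp only [hM]
    rw [← fromBlocks_toBlocks (x i)]
    simp [dsum, fromBlocks_multiply, fromBlocks_conjTranspose, conjTranspose_mul, Matrix.mul_assoc,
      hx11, hx12, hx21, hx22]
  have hu : IsUnit (x21 * zᴴ * (x21 * zᴴ)ᴴ + x22 * x22ᴴ) := by
    have : IsUnit (M i).toBlocks₂₂ := hi
    rwa [hMi, toBlocks_fromBlocks₂₂] at this
  set E := x21 * zᴴ * (x21 * zᴴ)ᴴ + x22 * x22ᴴ with hE
  set F := Ring.inverse E * (x21 * zᴴ * (x11 * zᴴ)ᴴ + x22 * x12ᴴ) with hF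
  have hEF : E * F = x21 * zᴴ * (x11 * zᴴ)ᴴ + x22 * x12ᴴ := by
    rw [hF, ← Matrix.mul_assoc, Ring.mul_inverse_cancel _ hu, Matrix.one_mul]
  have hci : c i = x11 * zᴴ * (x11 * zᴴ)ᴴ + x12 * x12ᴴ -
      (x11 * zᴴ * (x21 * zᴴ)ᴴ + x12 * x22ᴴ) * F := by
    simp only [hcdef, hMi, toBlocks_fromBlocks₁₁, toBlocks_fromBlocks₁₂, toBlocks_fromBlocks₂₁,
      toBlocks_fromBlocks₂₂, hF]
  obtain ⟨y, u, hyu⟩ := cz_core (cz_dense_fin hA m) z x11 x21 x12 x22 hu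
    ((x11 * zᴴ)ᴴ - (x21 * zᴴ)ᴴ * F) (x12ᴴ - x22ᴴ * F) (by
      have : E * F = x21 * zᴴ * ((x21 * zᴴ)ᴴ * F) + x22 * (x22ᴴ * F) := by
        rw [hE, Matrix.add_mul, Matrix.mul_assoc (x21 * zᴴ), Matrix.mul_assoc x22]
      rw [Matrix.mul_sub, Matrix.mul_sub, sub_add_sub_comm, ← this, hEF, sub_self])
  have : c i = y * zᴴ * u := by
    rw [← hyu, hci, Matrix.mul_sub, Matrix.mul_sub, sub_add_sub_comm, Matrix.add_mul,
      Matrix.mul_assoc (x11 * zᴴ) (x21 * zᴴ)ᴴ, Matrix.mul_assoc x12 x22ᴴ]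
  rw [this]
  exact cz_sq_le z y u
end
end

section
/- (Cancellation theorem) Let A be a unital C*-algebra of stable rank one, let a ∈ M_k(A), b ∈ M_l(A), c ∈ M_m(A) be positive elements, and let ε > 0. If a ⊕ c ≾ b ⊕ (c − ε)₊, then a ≾ b. -/
open Filter Topology

noncomputable section

variable {A : Type*}

/-- `c'` is the cut-down `(c - ε)₊` of the positive matrix `c`.  This is characterized (without
reference to the continuous functional calculus) by the unique orthogonal decomposition
`c - ε·1 = c' - y` of the selfadjoint element `c - ε·1` into orthogonal positive parts. -/
def IsCutMinus [CStarAlgebra A] {ι : Type*} [Fintype ι] [DecidableEq ι]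
    (ε : ℝ) (c c' : Matrix ι ι A) : Prop :=
  IsPos c' ∧ ∃ y : Matrix ι ι A, IsPos y ∧ c' * y = 0 ∧ c' - y = c - ε • (1 : Matrix ι ι A)

/-- The closed set of elements Cuntz-below `b`, inside a fixed algebra. -/
def below {B : Type*} [CStarAlgebra B] (b : B) : Set B :=
  closure (Set.range fun x : B => x * b * star x)

theorem below_conj {B : Type*} [CStarAlgebra B] {b r : B} (h : r ∈ below b) (z : B) :
    z * r * star z ∈ below b := by
  refine map_mem_closure (f := fun r => z * r * star z) (by fun_prop) h ?_
  rintro _ ⟨x, rfl⟩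
  exact ⟨z * x, by simp [mul_assoc]⟩

theorem below_sq {B : Type*} [CStarAlgebra B] [PartialOrder B] [StarOrderedRing B] {r : B}
    (hr : 0 ≤ r) : r ∈ below (r * r) := by
  rw [below, Metric.mem_closure_iff]
  intro ε hε
  have hs : ∀ t ∈ spectrum ℝ r, 0 ≤ t := fun t ht => spectrum_nonneg_of_nonneg hr ht
  have hsa : IsSelfAdjoint r := .of_nonneg hr
  set η := ε / 2 with hη
  have hη0 : 0 < η := by positivity
  have hc : ContinuousOn (fun t : ℝ => (√(t + η))⁻¹) (spectrum ℝ r) := by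
    refine ContinuousOn.inv₀ (by fun_prop) fun t ht => ?_
    have := hs t ht
    positivity
  refine ⟨_, ⟨cfc (fun t : ℝ => (√(t + η))⁻¹) r, rfl⟩, ?_⟩
  have hst : star (cfc (fun t : ℝ => (√(t + η))⁻¹) r) = cfc (fun t : ℝ => (√(t + η))⁻¹) r :=
    (cfc_predicate (R := ℝ) _ r : IsSelfAdjoint _)
  have key : r - cfc (fun t : ℝ => (√(t + η))⁻¹) r * (r * r) *
      star (cfc (fun t : ℝ => (√(t + η))⁻¹) r) =
      cfc (fun t : ℝ => t - (√(t + η))⁻¹ * (t * t) * (√(t + η))⁻¹) r := by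
    rw [hst, cfc_sub (fun t : ℝ => t) _ r (by fun_prop) (by fun_prop),
      cfc_mul (fun t => (√(t + η))⁻¹ * (t * t)) _ r (by fun_prop) hc,
      cfc_mul _ (fun t => t * t) r hc (by fun_prop),
      cfc_mul (fun t => t) (fun t => t) r (by fun_prop) (by fun_prop), cfc_id' ℝ r]
  rw [dist_eq_norm, key]
  refine lt_of_le_of_lt (norm_cfc_le hη0.le fun t ht => ?_) (half_lt_self hε)
  have h0 := hs t ht
  have h1 : 0 < t + η := by positivity
  have h2 : t - (√(t + η))⁻¹ * (t * t) * (√(t + η))⁻¹ = t * η / (t + η) := by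
    have : (√(t + η))⁻¹ * (t * t) * (√(t + η))⁻¹ = t * t / (t + η) := by
      rw [mul_right_comm, ← mul_inv, Real.mul_self_sqrt h1.le]; field_simp
    rw [this]; field_simp; ring
  rw [h2, Real.norm_of_nonneg (by positivity), div_le_iff₀ h1]
  nlinarith

theorem below_schur {B : Type*} [CStarAlgebra B] [PartialOrder B] [StarOrderedRing B]
    {b s X₁ X₂ Q v : B} (hs : star s = s) (hb : b = s * s) (hv : IsUnit v)
    (hN : IsUnit (X₂ * b * star X₂ + v * star v)) :
    (X₁ * b * star X₁ + Q * star Q) -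
      (X₁ * b * star X₂ + Q * star v) * Ring.inverse (X₂ * b * star X₂ + v * star v) *
        star (X₁ * b * star X₂ + Q * star v) ∈ below b := by
  obtain ⟨P, hP⟩ : ∃ P, P = X₁ * s := ⟨_, rfl⟩
  obtain ⟨u, hu⟩ : ∃ u, u = X₂ * s := ⟨_, rfl⟩
  have e1 : X₁ * b * star X₁ = P * star P := by simp [hP, hb, hs, mul_assoc]
  have e2 : X₁ * b * star X₂ = P * star u := by simp [hP, hu, hb, hs, mul_assoc]
  have e3 : X₂ * b * star X₂ = u * star u := by simp [hu, hb, hs, mul_assoc]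
  rw [e1, e2, e3]
  rw [e3] at hN
  obtain ⟨N, hNd⟩ : ∃ N, N = u * star u + v * star v := ⟨_, rfl⟩
  obtain ⟨O, hO⟩ : ∃ O, O = P * star u + Q * star v := ⟨_, rfl⟩
  rw [← hNd] at hN ⊢
  rw [← hO]
  obtain ⟨M, hM⟩ : ∃ M, M = Ring.inverse N := ⟨_, rfl⟩
  have hNM : N * M = 1 := hM ▸ Ring.mul_inverse_cancel _ hN
  have hMN : M * N = 1 := hM ▸ Ring.inverse_mul_cancel _ hN
  have hNs : star N = N := by simp [hNd]
  have hMs : star M = M := by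
    have : star M * N = 1 := by rw [← hNs, ← star_mul, hNM, star_one]
    calc star M = star M * (N * M) := by rw [hNM, mul_one]
      _ = M := by rw [← mul_assoc, this, one_mul]
  rw [← hM]
  obtain ⟨w, hvw, hwv⟩ : ∃ w, v * w = 1 ∧ w * v = 1 :=
    ⟨Ring.inverse v, Ring.mul_inverse_cancel _ hv, Ring.inverse_mul_cancel _ hv⟩
  obtain ⟨α, hα⟩ : ∃ α, α = 1 - star u * M * u := ⟨_, rfl⟩
  have hαs : star α = α := by simp [hα, hMs, mul_assoc]
  have hαpos : 0 ≤ α := by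
    have : α = α * star α + (star u * M * v) * star (star u * M * v) := by
      rw [hαs]
      have h1 : star u * M * v * star (star u * M * v) =
          star u * M * (N - u * star u) * M * u := by
        simp [hNd, hMs, mul_assoc]
      rw [h1, mul_sub, mul_assoc (star u) M N, hMN, hα]
      noncomm_ring
    rw [this]
    exact add_nonneg (mul_star_self_nonneg _) (mul_star_self_nonneg _)
  have h1 : w * u * α = star v * M * u := by
    have : u * α = (v * star v) * M * u := by
      have : v * star v = N - u * star u := by simp [hNd]
      rw [this, sub_mul, hNM, hα]
      noncomm_ring
    rw [mul_assoc, this, ← mul_assoc, ← mul_assoc, ← mul_assoc, hwv, one_mul]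
  have h2 : α * star u * star w = star u * M * v := by
    have := congrArg star h1
    simpa [hαs, hMs, mul_assoc] using this
  have h3 : w * u * star u * M * v = 1 - star v * M * v := by
    have : u * star u = N - v * star v := by simp [hNd]
    rw [mul_assoc w u, this, mul_sub, ← mul_assoc w v, hwv, one_mul, sub_mul, mul_assoc w N M, hNM,
      mul_one, sub_mul, hwv]
  have main : P * star P + Q * star Q - O * M * star O =
      (X₁ - Q * w * X₂) * (s * α * s) * star (X₁ - Q * w * X₂) := by
    have hW : (X₁ - Q * w * X₂) * (s * α * s) * star (X₁ - Q * w * X₂) =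
        (P - Q * (w * u)) * α * star (P - Q * (w * u)) := by
      simp only [hP, hu, star_sub, star_mul, hs]; noncomm_ring
    rw [hW]
    have a1 : (P - Q * (w * u)) * α = P * α - Q * (star v * M * u) := by
      rw [← h1]; noncomm_ring
    have a2 : (P - Q * (w * u)) * α * star (P - Q * (w * u)) =
        (P * α - Q * (star v * M * u)) * star P -
          (P - Q * (w * u)) * (α * star u * star w) * star Q := by
      rw [← a1]; simp only [star_sub, star_mul]; noncomm_ring
    have a3 : (P - Q * (w * u)) * (star u * M * v) =
        P * star u * M * v - Q * (w * u * star u * M * v) := by noncomm_ring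
    rw [a2, h2, a3, h3, hα, hO]
    simp only [star_add, star_mul, star_star]
    noncomm_ring
  rw [main]
  refine below_conj ?_ _
  have hr : 0 ≤ s * α * s := by
    simpa [hs] using star_left_conjugate_nonneg hαpos s
  have := below_sq hr
  refine closure_mono ?_ this
  rintro _ ⟨x, rfl⟩
  refine ⟨x * (s * α), ?_⟩
  simp [hb, hs, hαs, mul_assoc]

theorem core {B : Type*} [CStarAlgebra B] [PartialOrder B] [StarOrderedRing B]
    (hB : Dense {x : B | IsUnit x}) {a b c c' y : B} (hb : 0 ≤ b) (hc' : 0 ≤ c') (hy : 0 ≤ y)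
    (hcy : c' * y = 0) {ε : ℝ} (hε : 0 < ε) (hc : c + y = c' + ε • (1 : B))
    {x₁ x₂ x₃ x₄ : ℕ → B}
    (h₁ : Tendsto (fun n => x₁ n * b * star (x₁ n) + x₂ n * c' * star (x₂ n)) atTop (𝓝 a))
    (h₂ : Tendsto (fun n => x₁ n * b * star (x₃ n) + x₂ n * c' * star (x₄ n)) atTop (𝓝 0))
    (h₃ : Tendsto (fun n => x₃ n * b * star (x₃ n) + x₄ n * c' * star (x₄ n)) atTop (𝓝 c)) :
    a ∈ below b := by
  obtain ⟨s, hs, hbs⟩ : ∃ s : B, star s = s ∧ b = s * s :=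
    ⟨CFC.sqrt b, IsSelfAdjoint.of_nonneg (CFC.sqrt_nonneg b), (CFC.sqrt_mul_sqrt_self b hb).symm⟩
  obtain ⟨p, hp, hcp⟩ : ∃ s : B, star s = s ∧ c' = s * s :=
    ⟨CFC.sqrt c', IsSelfAdjoint.of_nonneg (CFC.sqrt_nonneg c'),
      (CFC.sqrt_mul_sqrt_self c' hc').symm⟩
  obtain ⟨t, ht, hyt⟩ : ∃ s : B, star s = s ∧ y = s * s :=
    ⟨CFC.sqrt y, IsSelfAdjoint.of_nonneg (CFC.sqrt_nonneg y), (CFC.sqrt_mul_sqrt_self y hy).symm⟩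
  have hpt : p * t = 0 := by
    have hys : star y = y := IsSelfAdjoint.of_nonneg hy
    have hcs : star c' = c' := IsSelfAdjoint.of_nonneg hc'
    have k0 : y * c' = 0 := by simpa [hys, hcs] using congrArg star hcy
    have k1 : star (p * y * p) * (p * y * p) = 0 := by
      have : star (p * y * p) * (p * y * p) = p * (y * c') * y * p := by
        simp [hp, hys, hcp, mul_assoc]
      rw [this, k0]; simp
    have k2 : p * y * p = 0 := CStarRing.star_mul_self_eq_zero_iff _ |>.1 k1
    have k3 : (p * t) * star (p * t) = 0 := by
      rw [← k2]; simp [hp, ht, hyt, mul_assoc]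
    exact CStarRing.mul_star_self_eq_zero_iff _ |>.1 k3
  have htp : t * p = 0 := by simpa [hp, ht] using congrArg star hpt
  have hN : IsUnit (c + y) := by
    rw [hc]
    have : IsStrictlyPositive (c' + ε • (1 : B)) := by
      have h1 : IsStrictlyPositive (ε • (1 : B)) := by
        exact IsStrictlyPositive.smul hε isStrictlyPositive_one
      exact IsStrictlyPositive.nonneg_add hc' h1
    exact this.isUnit
  have hv : ∀ n, ∃ v : B, IsUnit v ∧
      dist (v * star v) ((x₄ n * p + t) * star (x₄ n * p + t)) < 1 / ((n : ℝ) + 1) ∧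
      dist (x₂ n * p * star v) (x₂ n * p * star (x₄ n * p + t)) < 1 / ((n : ℝ) + 1) := by
    intro n
    have ho : IsOpen {v : B | dist (v * star v) ((x₄ n * p + t) * star (x₄ n * p + t))
        < 1 / ((n : ℝ) + 1) ∧
      dist (x₂ n * p * star v) (x₂ n * p * star (x₄ n * p + t)) < 1 / ((n : ℝ) + 1)} :=
      IsOpen.and (isOpen_lt (by fun_prop) (by fun_prop)) (isOpen_lt (by fun_prop) (by fun_prop))
    obtain ⟨v, hv, hu⟩ := hB.exists_mem_open ho
      ⟨x₄ n * p + t, by simp; positivity⟩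
    exact ⟨v, hv, hu⟩
  choose v hvu hv1 hv2 using hv
  have hz := tendsto_one_div_add_atTop_nhds_zero_nat (𝕜 := ℝ)
  have close : ∀ {f g : ℕ → B} {l : B}, (∀ n, dist (f n) (g n) < 1 / ((n : ℝ) + 1)) →
      Tendsto g atTop (𝓝 l) → Tendsto f atTop (𝓝 l) := by
    intro f g l hfg hg
    refine (tendsto_iff_of_dist ?_).2 hg
    exact squeeze_zero (fun _ => dist_nonneg) (fun n => (hfg n).le) hz
  have T1 : Tendsto (fun n => x₁ n * b * star (x₁ n) + (x₂ n * p) * star (x₂ n * p)) atTop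
      (𝓝 a) := by
    refine h₁.congr fun n => ?_
    simp [hcp, hp, mul_assoc]
  have T2 : Tendsto (fun n => x₁ n * b * star (x₃ n) + (x₂ n * p) * star (v n)) atTop
      (𝓝 0) := by
    refine close (g := fun n => x₁ n * b * star (x₃ n) + x₂ n * c' * star (x₄ n)) ?_ h₂
    intro n
    have : x₂ n * c' * star (x₄ n) = x₂ n * p * star (x₄ n * p + t) := by
      rw [star_add, mul_add, ht, mul_assoc _ p t, hpt]
      simp [hcp, hp, mul_assoc]
    rw [this, dist_add_left]; exact hv2 n
  have T3 : Tendsto (fun n => x₃ n * b * star (x₃ n) + v n * star (v n)) atTop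
      (𝓝 (c + y)) := by
    refine close (g := fun n => x₃ n * b * star (x₃ n) + x₄ n * c' * star (x₄ n) + y) ?_
      (h₃.add_const y)
    intro n
    have : x₄ n * c' * star (x₄ n) + y = (x₄ n * p + t) * star (x₄ n * p + t) := by
      have e : (x₄ n * p + t) * star (x₄ n * p + t) = x₄ n * (p * p) * star (x₄ n) +
          x₄ n * (p * t) + (t * p) * star (x₄ n) + t * t := by
        simp only [star_add, star_mul, hp, ht]; noncomm_ring
      rw [e, hpt, htp, hcp, hyt]; simp
    rw [add_assoc, this, dist_add_left]; exact hv1 n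
  have Tinv := (NormedRing.inverse_continuousAt hN.unit).tendsto.comp
    (by simpa using T3)
  have T := T1.sub ((T2.mul Tinv).mul T2.star)
  simp only [zero_mul, star_zero, mul_zero, sub_zero] at T
  refine isClosed_closure.mem_of_tendsto T ?_
  have hev := T3.eventually (Units.isOpen.mem_nhds hN)
  filter_upwards [hev] with n hn
  exact below_schur hs hbs (hvu n) hn

theorem isUnit_blocks {R : Type*} [Ring R] {ι κ : Type*} [Fintype ι] [Fintype κ] [DecidableEq ι]
    [DecidableEq κ] {P : Matrix ι ι R} {Q : Matrix ι κ R} {T : Matrix κ ι R} {S S' : Matrix κ κ R}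
    (h1 : S * S' = 1) (h2 : S' * S = 1) (hP : IsUnit (P - Q * S' * T)) :
    IsUnit (Matrix.fromBlocks P Q T S) := by
  obtain ⟨⟨D, D', hD, hD'⟩, rfl : D = _⟩ := hP
  have u1 : IsUnit (Matrix.fromBlocks 1 (Q * S') 0 1 : Matrix (ι ⊕ κ) (ι ⊕ κ) R) :=
    isUnit_iff_exists.2 ⟨Matrix.fromBlocks 1 (-(Q * S')) 0 1, by simp [Matrix.fromBlocks_multiply],
      by simp [Matrix.fromBlocks_multiply]⟩
  have u2 : IsUnit (Matrix.fromBlocks (P - Q * S' * T) 0 0 S : Matrix (ι ⊕ κ) (ι ⊕ κ) R) :=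
    isUnit_iff_exists.2 ⟨Matrix.fromBlocks D' 0 0 S', by simp [Matrix.fromBlocks_multiply, hD, h1],
      by simp [Matrix.fromBlocks_multiply, hD', h2]⟩
  have u3 : IsUnit (Matrix.fromBlocks 1 0 (S' * T) 1 : Matrix (ι ⊕ κ) (ι ⊕ κ) R) :=
    isUnit_iff_exists.2 ⟨Matrix.fromBlocks 1 0 (-(S' * T)) 1, by simp [Matrix.fromBlocks_multiply],
      by simp [Matrix.fromBlocks_multiply]⟩
  have : Matrix.fromBlocks P Q T S = Matrix.fromBlocks 1 (Q * S') 0 1 *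
      Matrix.fromBlocks (P - Q * S' * T) 0 0 S * Matrix.fromBlocks 1 0 (S' * T) 1 := by
    simp only [Matrix.fromBlocks_multiply]
    congr 1
    · simp [Matrix.mul_assoc, ← Matrix.mul_assoc S S', h1]
    · simp [Matrix.mul_assoc, h2]
    · simp [← Matrix.mul_assoc S S', h1]
    · simp
  rw [this]
  exact (u1.mul u2).mul u3

theorem dense_blocks {R : Type*} [Ring R] [TopologicalSpace R] [IsTopologicalRing R]
    {ι κ : Type*} [Fintype ι] [Fintype κ] [DecidableEq ι] [DecidableEq κ]
    (h1 : Dense {x : Matrix ι ι R | IsUnit x}) (h2 : Dense {x : Matrix κ κ R | IsUnit x}) :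
    Dense {x : Matrix (ι ⊕ κ) (ι ⊕ κ) R | IsUnit x} := by
  rw [dense_iff_inter_open]
  rintro U hU ⟨M, hM⟩
  rw [← Matrix.fromBlocks_toBlocks M] at hM
  obtain ⟨S, hS, hSU⟩ := h2.exists_mem_open
    (hU.preimage (f := fun S => Matrix.fromBlocks M.toBlocks₁₁ M.toBlocks₁₂ M.toBlocks₂₁ S)
      (by fun_prop)) ⟨_, hM⟩
  obtain ⟨⟨S, S', e1, e2⟩, rfl⟩ := hS
  obtain ⟨P, hP, hPU⟩ := h1.exists_mem_open
    (hU.preimage (f := fun P => Matrix.fromBlocks (P + M.toBlocks₁₂ * S' * M.toBlocks₂₁)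
      M.toBlocks₁₂ M.toBlocks₂₁ S)
      (by fun_prop)) ⟨M.toBlocks₁₁ - M.toBlocks₁₂ * S' * M.toBlocks₂₁, by simpa using hSU⟩
  exact ⟨_, hPU, isUnit_blocks e1 e2 (by simpa using hP)⟩

theorem dense_fin {R : Type*} [Ring R] [TopologicalSpace R] [IsTopologicalRing R]
    (h : Dense {x : R | IsUnit x}) (n : ℕ) :
    Dense {x : Matrix (Fin n) (Fin n) R | IsUnit x} := by
  induction n with
  | zero =>
    intro x
    exact subset_closure (isUnit_of_subsingleton x)
  | succ n ih =>
    have h1 : Dense {x : Matrix (Fin 1) (Fin 1) R | IsUnit x} := by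
      intro x
      have := map_mem_closure (f := fun r : R => (Matrix.of fun _ _ => r : Matrix (Fin 1) (Fin 1) R))
        (t := {x | IsUnit x}) (by fun_prop) (h (x 0 0)) ?_
      · convert this using 1
        ext i j; simp [Subsingleton.elim i 0, Subsingleton.elim j 0]
      · rintro _ ⟨⟨r, r', e1, e2⟩, rfl⟩
        refine isUnit_iff_exists.2 ⟨Matrix.of fun _ _ => r', ?_, ?_⟩ <;>
          · ext i j; obtain rfl := Subsingleton.elim i j; simp [Matrix.mul_apply, e1, e2]
    intro x
    have := map_mem_closure (f := Matrix.reindexAlgEquiv ℕ R (finSumFinEquiv (m := n) (n := 1)))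
      (t := {x | IsUnit x}) ?_ (dense_blocks ih h1
        ((Matrix.reindexAlgEquiv ℕ R (finSumFinEquiv (m := n) (n := 1))).symm x)) ?_
    · simpa using this
    · change Continuous fun M : Matrix _ _ R => Matrix.reindex _ _ M
      simp only [Matrix.reindex_apply]
      fun_prop
    · intro y hy
      exact hy.map _

theorem coreM [CStarAlgebra A] {n : ℕ} (hA : StableRankOne A)
    {a b c c' y : Matrix (Fin n) (Fin n) A} (hb : IsPos b) (hc' : IsPos c')
    {y₁ y₂ : Matrix (Fin n) (Fin n) A} (hy : y = y₁.conjTranspose * y₁ + y₂.conjTranspose * y₂)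
    (hcy : c' * y = 0) {ε : ℝ} (hε : 0 < ε)
    (hc : c + y = c' + ε • (1 : Matrix (Fin n) (Fin n) A))
    {x₁ x₂ x₃ x₄ : ℕ → Matrix (Fin n) (Fin n) A}
    (h₁ : Tendsto (fun n => x₁ n * b * (x₁ n).conjTranspose + x₂ n * c' * (x₂ n).conjTranspose)
      atTop (𝓝 a))
    (h₂ : Tendsto (fun n => x₁ n * b * (x₃ n).conjTranspose + x₂ n * c' * (x₄ n).conjTranspose)
      atTop (𝓝 0))
    (h₃ : Tendsto (fun n => x₃ n * b * (x₃ n).conjTranspose + x₄ n * c' * (x₄ n).conjTranspose)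
      atTop (𝓝 c)) :
    a ∈ closure (Set.range fun x : Matrix (Fin n) (Fin n) A => x * b * x.conjTranspose) := by
  let _ : PartialOrder A := CStarAlgebra.spectralOrder A
  have : StarOrderedRing A := CStarAlgebra.spectralOrderedRing A
  obtain ⟨z, hz⟩ := hb
  obtain ⟨w, hw⟩ := hc'
  have hb0 : @LE.le (CStarMatrix (Fin n) (Fin n) A) _ 0 b := by
    rw [hz]; exact star_mul_self_nonneg (R := CStarMatrix (Fin n) (Fin n) A) z
  have hc0 : @LE.le (CStarMatrix (Fin n) (Fin n) A) _ 0 c' := by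
    rw [hw]; exact star_mul_self_nonneg (R := CStarMatrix (Fin n) (Fin n) A) w
  have hy0 : @LE.le (CStarMatrix (Fin n) (Fin n) A) _ 0 y := by
    rw [hy]
    exact add_nonneg (star_mul_self_nonneg (R := CStarMatrix (Fin n) (Fin n) A) y₁)
      (star_mul_self_nonneg (R := CStarMatrix (Fin n) (Fin n) A) y₂)
  exact core (B := CStarMatrix (Fin n) (Fin n) A) (dense_fin hA n) hb0 hc0 hy0 hcy hε hc h₁ h₂ h₃

theorem exists_iso [CStarAlgebra A] {k n : ℕ} (h : k ≤ n) :
    ∃ J : Matrix (Fin n) (Fin k) A, J.conjTranspose * J = 1 := by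
  refine ⟨(1 : Matrix (Fin n) (Fin n) A).submatrix id (Fin.castLE h), ?_⟩
  ext i j
  simp [Matrix.mul_apply, Matrix.one_apply, apply_ite]
  split_ifs <;> simp_all

theorem isPos_pad [CStarAlgebra A] {k n : ℕ} {J : Matrix (Fin n) (Fin k) A}
    (hJ : J.conjTranspose * J = 1) {b : Matrix (Fin k) (Fin k) A} (hb : IsPos b) :
    IsPos (J * b * J.conjTranspose) := by
  obtain ⟨z, rfl⟩ := hb
  refine ⟨J * z * J.conjTranspose, ?_⟩
  simp only [Matrix.conjTranspose_mul, Matrix.conjTranspose_conjTranspose, Matrix.mul_assoc]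
  rw [← Matrix.mul_assoc J.conjTranspose J, hJ, Matrix.one_mul]

theorem pad_mul [CStarAlgebra A] {i j k n : ℕ} (I : Matrix (Fin n) (Fin i) A)
    {J : Matrix (Fin n) (Fin j) A} (K : Matrix (Fin n) (Fin k) A)
    (hJ : J.conjTranspose * J = 1) (x : Matrix (Fin i) (Fin j) A) (b : Matrix (Fin j) (Fin j) A)
    (y : Matrix (Fin k) (Fin j) A) :
    (I * x * J.conjTranspose) * (J * b * J.conjTranspose) * (K * y * J.conjTranspose).conjTranspose
      = I * (x * b * y.conjTranspose) * K.conjTranspose := by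
  simp only [Matrix.conjTranspose_mul, Matrix.conjTranspose_conjTranspose, Matrix.mul_assoc]
  rw [← Matrix.mul_assoc J.conjTranspose J, hJ, Matrix.one_mul,
    ← Matrix.mul_assoc J.conjTranspose J, hJ, Matrix.one_mul]

/-- Cancellation theorem for the Cuntz semigroup of a C*-algebra of stable rank one:
if `a ⊕ c ≾ b ⊕ (c - ε)₊` then `a ≾ b`. -/
theorem cuntz_cancellation [CStarAlgebra A] (hA : StableRankOne A)
    {k l m : ℕ} (a : Matrix (Fin k) (Fin k) A) (b : Matrix (Fin l) (Fin l) A)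
    (c : Matrix (Fin m) (Fin m) A) (ha : IsPos a) (hb : IsPos b) (hc : IsPos c)
    (ε : ℝ) (hε : 0 < ε) (c' : Matrix (Fin m) (Fin m) A) (hc' : IsCutMinus ε c c')
    (h : CuntzLE (dsum a c) (dsum b c')) :
    CuntzLE a b := by
  classical
  obtain ⟨hcp, y, ⟨w, hw⟩, hcy, hce⟩ := hc'
  obtain ⟨x, hx⟩ := h
  obtain ⟨n, hk, hl, hm⟩ : ∃ n, k ≤ n ∧ l ≤ n ∧ m ≤ n :=
    ⟨k + l + m, by omega, by omega, by omega⟩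
  obtain ⟨I, hI⟩ := exists_iso (A := A) hk
  obtain ⟨J, hJ⟩ := exists_iso (A := A) hl
  obtain ⟨K, hK⟩ := exists_iso (A := A) hm
  have hprod : ∀ i, x i * dsum b c' * (x i).conjTranspose = Matrix.fromBlocks
      ((x i).toBlocks₁₁ * b * (x i).toBlocks₁₁.conjTranspose +
        (x i).toBlocks₁₂ * c' * (x i).toBlocks₁₂.conjTranspose)
      ((x i).toBlocks₁₁ * b * (x i).toBlocks₂₁.conjTranspose +
        (x i).toBlocks₁₂ * c' * (x i).toBlocks₂₂.conjTranspose)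
      ((x i).toBlocks₂₁ * b * (x i).toBlocks₁₁.conjTranspose +
        (x i).toBlocks₂₂ * c' * (x i).toBlocks₁₂.conjTranspose)
      ((x i).toBlocks₂₁ * b * (x i).toBlocks₂₁.conjTranspose +
        (x i).toBlocks₂₂ * c' * (x i).toBlocks₂₂.conjTranspose) := by
    intro i
    conv_lhs => rw [← Matrix.fromBlocks_toBlocks (x i)]
    simp [dsum, Matrix.fromBlocks_multiply, Matrix.fromBlocks_conjTranspose]
  simp only [hprod] at hx
  have q₁ := ((show Continuous fun M : Matrix (Fin k ⊕ Fin m) (Fin k ⊕ Fin m) A =>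
    I * M.submatrix Sum.inl Sum.inl * I.conjTranspose by fun_prop).tendsto _).comp hx
  have q₂ := ((show Continuous fun M : Matrix (Fin k ⊕ Fin m) (Fin k ⊕ Fin m) A =>
    I * M.submatrix Sum.inl Sum.inr * K.conjTranspose by fun_prop).tendsto _).comp hx
  have q₃ := ((show Continuous fun M : Matrix (Fin k ⊕ Fin m) (Fin k ⊕ Fin m) A =>
    K * M.submatrix Sum.inr Sum.inr * K.conjTranspose by fun_prop).tendsto _).comp hx
  have s11 : ∀ {P : Matrix (Fin k) (Fin k) A} {Q R} {S : Matrix (Fin m) (Fin m) A},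
    (Matrix.fromBlocks P Q R S).submatrix Sum.inl Sum.inl = P := fun {_ _ _ _} => rfl
  have s12 : ∀ {P : Matrix (Fin k) (Fin k) A} {Q R} {S : Matrix (Fin m) (Fin m) A},
    (Matrix.fromBlocks P Q R S).submatrix Sum.inl Sum.inr = Q := fun {_ _ _ _} => rfl
  have s22 : ∀ {P : Matrix (Fin k) (Fin k) A} {Q R} {S : Matrix (Fin m) (Fin m) A},
    (Matrix.fromBlocks P Q R S).submatrix Sum.inr Sum.inr = S := fun {_ _ _ _} => rfl
  simp only [Function.comp_def, dsum, s11, s12, s22, Matrix.mul_add, Matrix.add_mul] at q₁ q₂ q₃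
  rw [Matrix.mul_zero, Matrix.zero_mul] at q₂
  obtain ⟨G, hG⟩ : ∃ G : Matrix (Fin n) (Fin n) A, G = 1 - K * K.conjTranspose := ⟨_, rfl⟩
  have hGs : G.conjTranspose = G := by
    simp [hG, Matrix.conjTranspose_sub, Matrix.conjTranspose_mul]
  have hKG : K.conjTranspose * G = 0 := by
    rw [hG, Matrix.mul_sub, ← Matrix.mul_assoc, hK]; simp
  have hGG : G * G = G := by
    nth_rewrite 1 [hG]
    rw [Matrix.sub_mul, Matrix.mul_assoc, hKG]; simp
  have hfin := coreM hA (isPos_pad hJ hb) (isPos_pad hK hcp)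
    (y := K * y * K.conjTranspose + ε • G) (y₁ := K * w * K.conjTranspose) (y₂ := √ε • G)
    (c := K * c * K.conjTranspose) ?_ ?_ hε ?_
    (x₁ := fun i => I * (x i).toBlocks₁₁ * J.conjTranspose)
    (x₂ := fun i => I * (x i).toBlocks₁₂ * K.conjTranspose)
    (x₃ := fun i => K * (x i).toBlocks₂₁ * J.conjTranspose)
    (x₄ := fun i => K * (x i).toBlocks₂₂ * K.conjTranspose)
    (a := I * a * I.conjTranspose)
    (by simpa only [pad_mul _ _ hJ, pad_mul _ _ hK] using q₁)
    (by simpa only [pad_mul _ _ hJ, pad_mul _ _ hK] using q₂)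
    (by simpa only [pad_mul _ _ hJ, pad_mul _ _ hK] using q₃)
  · have := map_mem_closure (f := fun M : Matrix (Fin n) (Fin n) A => I.conjTranspose * M * I)
      (t := Set.range fun x : Matrix (Fin k) (Fin l) A => x * b * x.conjTranspose)
      (by fun_prop) hfin ?_
    · have e : I.conjTranspose * (I * a * I.conjTranspose) * I = a := by
        rw [Matrix.mul_assoc I, ← Matrix.mul_assoc, hI, Matrix.one_mul, Matrix.mul_assoc, hI,
          Matrix.mul_one]
      simp only [e] at this
      have hfc : FirstCountableTopology (Matrix (Fin k) (Fin k) A) :=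
        inferInstanceAs (FirstCountableTopology (Fin k → Fin k → A))
      obtain ⟨f, hf, hlim⟩ := mem_closure_iff_seq_limit.1 this
      choose g hg using hf
      exact ⟨g, by simpa only [hg] using hlim⟩
    · rintro _ ⟨X, rfl⟩
      exact ⟨I.conjTranspose * X * J, by simp [Matrix.mul_assoc]⟩
  · rw [Matrix.conjTranspose_smul, hGs, Matrix.smul_mul, Matrix.mul_smul, smul_smul, hGG]
    congr 1
    · rw [hw]
      simp only [Matrix.conjTranspose_mul, Matrix.conjTranspose_conjTranspose, Matrix.mul_assoc]
      rw [← Matrix.mul_assoc K.conjTranspose K, hK, Matrix.one_mul]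
    · simp [Real.mul_self_sqrt hε.le]
  · rw [Matrix.mul_add, Matrix.mul_smul, Matrix.mul_assoc _ _ G, hKG]
    simp only [Matrix.mul_assoc]
    rw [← Matrix.mul_assoc K.conjTranspose K, hK, Matrix.one_mul, ← Matrix.mul_assoc c', hcy]
    simp
  · have e : c + y = c' + ε • (1 : Matrix (Fin m) (Fin m) A) := by
      rw [sub_eq_sub_iff_add_eq_add] at hce
      exact hce.symm
    rw [← add_assoc, ← Matrix.add_mul, ← Matrix.mul_add, e, Matrix.mul_add, Matrix.add_mul, hG,
      Matrix.mul_smul, Matrix.smul_mul, Matrix.mul_one, smul_sub]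
    abel
end
end

section
/- Let A be a unital C*-algebra of stable rank one, and let a, b be positive elements of A such that 1_A ≾ a ⊕ b. Then there exists ε > 0 such that 1_A − f_ε(a) ≾ (b − ε)₊. -/
open Filter Topology

noncomputable section

variable {A : Type*}

/-- An element of `A` viewed as a `1 × 1` matrix over `A`. -/
def m1 [NonUnitalCStarAlgebra A] (a : A) : Matrix (Fin 1) (Fin 1) A :=
  Matrix.of fun _ _ => a

/-- `(a - ε)₊`, via the continuous functional calculus. -/
def cutPlus [CStarAlgebra A] (ε : ℝ) (a : A) : A :=
  cfc (fun t : ℝ => (t - ε) ⊔ 0) a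

/-- `f_ε(a)`, where `f_ε(t) = min(t/ε, 1)`, via the continuous functional calculus. -/
def fEps [CStarAlgebra A] (ε : ℝ) (a : A) : A :=
  cfc (fun t : ℝ => (t / ε) ⊓ 1) a


lemma exists_w_aux [CStarAlgebra A] [PartialOrder A] [StarOrderedRing A]
    (hA : StableRankOne A) (u g : A) (hg : IsSelfAdjoint g) (hug : u * g = 0) (δ : ℝ) (hδ : 0 < δ) :
    ∃ w : A, star w * w = 1 ∧ ‖star u * w * g‖ ≤ δ := by
  have hG : 0 < ‖g‖ + 1 := by positivity
  obtain ⟨v, hv, hd⟩ := Metric.dense_iff.1 hA u (δ / (2 * (‖g‖ + 1))) (by positivity)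
  rw [Metric.mem_ball, dist_eq_norm] at hv
  have hd : IsUnit v := hd
  have habs : CFC.abs v * CFC.abs v = star v * v := CFC.abs_mul_abs v
  have hU : IsUnit (CFC.abs v) := by
    have h1 : IsUnit (CFC.abs v * CFC.abs v) := by
      rw [habs]; exact hd.star.mul hd
    exact ((Commute.refl (CFC.abs v)).isUnit_mul_iff.1 h1).1
  obtain ⟨p, hp1, hp2⟩ := isUnit_iff_exists.1 hU
  have hsa : star (CFC.abs v) = CFC.abs v := (CFC.abs_nonneg v).isSelfAdjoint.star_eq
  have hps : star p * CFC.abs v = 1 := by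
    have := congrArg star hp1
    rwa [star_mul, hsa, star_one] at this
  have hw : star v * (v * p) = CFC.abs v := by
    rw [← mul_assoc, ← habs, mul_assoc, hp1, mul_one]
  have hww : star (v * p) * (v * p) = 1 := by
    rw [star_mul, mul_assoc, hw, hps]
  refine ⟨v * p, hww, ?_⟩
  have hvg : ‖v * g‖ ≤ δ / 2 := by
    have : v * g = (v - u) * g := by rw [sub_mul, hug, sub_zero]
    rw [this]
    calc ‖(v - u) * g‖ ≤ ‖v - u‖ * ‖g‖ := norm_mul_le _ _
      _ ≤ (δ / (2 * (‖g‖ + 1))) * (‖g‖ + 1) := by gcongr; linarith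
      _ = δ / 2 := by field_simp
  have habsg : ‖CFC.abs v * g‖ = ‖v * g‖ := by
    have h1 : star (CFC.abs v * g) * (CFC.abs v * g) = star (v * g) * (v * g) := by
      rw [star_mul, star_mul, hsa, mul_assoc, ← mul_assoc (CFC.abs v), habs]
      simp only [mul_assoc]
    have h2 := congrArg norm h1
    rw [CStarRing.norm_star_mul_self, CStarRing.norm_star_mul_self] at h2
    nlinarith [norm_nonneg (CFC.abs v * g), norm_nonneg (v * g)]
  have hwn : ‖v * p‖ ≤ 1 := by
    have h2 := congrArg norm hww
    rw [CStarRing.norm_star_mul_self] at h2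
    have : ‖(1 : A)‖ ≤ 1 := by
      rcases subsingleton_or_nontrivial A with h | h
      · rw [Subsingleton.elim (1 : A) 0, norm_zero]; exact zero_le_one
      · exact CStarRing.norm_one.le
    nlinarith [norm_nonneg (v * p)]
  have hdec : star u * (v * p) * g = CFC.abs v * g - star (v - u) * (v * p) * g := by
    rw [star_sub, sub_mul, hw, sub_mul, sub_sub_cancel]
  rw [hdec]
  calc ‖CFC.abs v * g - star (v - u) * (v * p) * g‖
      ≤ ‖CFC.abs v * g‖ + ‖star (v - u) * (v * p) * g‖ := norm_sub_le _ _
    _ ≤ δ / 2 + δ / 2 := by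
        gcongr
        · rw [habsg]; exact hvg
        · calc ‖star (v - u) * (v * p) * g‖ ≤ ‖star (v - u)‖ * ‖v * p‖ * ‖g‖ := by
                refine (norm_mul_le _ _).trans ?_
                gcongr
                exact norm_mul_le _ _
            _ ≤ (δ / (2 * (‖g‖ + 1))) * 1 * (‖g‖ + 1) := by
                rw [norm_star]; gcongr; linarith
            _ = δ / 2 := by field_simp
    _ = δ := by ring

lemma norm_cutPlus_sub_le [CStarAlgebra A] [PartialOrder A] [StarOrderedRing A]
    (a : A) (ha : 0 ≤ a) (ε : ℝ) (hε : 0 < ε) : ‖cutPlus ε a - a‖ ≤ ε := by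
  have hsa : IsSelfAdjoint a := ha.isSelfAdjoint
  have : cutPlus ε a - a = cfc (fun t : ℝ => ((t - ε) ⊔ 0) - t) a := by
    rw [cfc_sub (fun t : ℝ => (t - ε) ⊔ 0) (fun t => t) a, cfc_id' ℝ a]; rfl
  rw [this]
  refine norm_cfc_le hε.le fun t ht => ?_
  have ht0 : 0 ≤ t := spectrum_nonneg_of_nonneg ha ht
  rw [Real.norm_eq_abs, abs_le]
  rcases max_cases (t - ε) 0 with h | h <;> constructor <;> linarith [h.1, h.2]

lemma cutPlus_nonneg_aux [CStarAlgebra A] [PartialOrder A] [StarOrderedRing A]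
    (a : A) (ε : ℝ) : 0 ≤ cutPlus ε a :=
  cfc_nonneg fun _ _ => le_max_right _ _

lemma exists_exact_aux [CStarAlgebra A] [PartialOrder A] [StarOrderedRing A]
    (a b : A) (ha : 0 ≤ a) (hb : 0 ≤ b)
    (h : CuntzLE (m1 (1 : A)) (dsum (m1 a) (m1 b))) :
    ∃ ε : ℝ, 0 < ε ∧ ∃ r s : A,
      r * cutPlus ε a * star r + s * cutPlus ε b * star s = 1 := by
  obtain ⟨x, hx⟩ := h
  have hx' : Tendsto (fun k => x k (0 : Fin 1) (Sum.inl 0) * a * star (x k 0 (Sum.inl 0))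
      + x k 0 (Sum.inr 0) * b * star (x k 0 (Sum.inr 0))) atTop (nhds (1 : A)) := by
    have h1 := tendsto_pi_nhds.1 (tendsto_pi_nhds.1 hx 0) 0
    refine h1.congr fun k => ?_
    simp [Matrix.mul_apply, dsum, m1]
  obtain ⟨k, hk⟩ := ((Metric.tendsto_nhds.1 hx') (1 / 2) (by norm_num)).exists
  rw [dist_eq_norm] at hk
  set r := x k (0 : Fin 1) (Sum.inl 0)
  set s := x k (0 : Fin 1) (Sum.inr 0)
  obtain ⟨ε, hε, hε'⟩ : ∃ ε : ℝ, 0 < ε ∧ ε * (‖r‖ * ‖r‖ + ‖s‖ * ‖s‖) < 1 / 2 := by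
    refine ⟨1 / (4 * (‖r‖ * ‖r‖ + ‖s‖ * ‖s‖ + 1)), by positivity, ?_⟩
    have : 0 ≤ ‖r‖ * ‖r‖ + ‖s‖ * ‖s‖ := by positivity
    rw [div_mul_eq_mul_div, div_lt_iff₀ (by positivity)]
    linarith
  refine ⟨ε, hε, ?_⟩
  have key : ∀ (z c : A), 0 ≤ c → ‖z * (cutPlus ε c - c) * star z‖ ≤ ε * (‖z‖ * ‖z‖) := by
    intro z c hc
    have := norm_cutPlus_sub_le c hc ε hε
    calc ‖z * (cutPlus ε c - c) * star z‖ ≤ ‖z‖ * ‖cutPlus ε c - c‖ * ‖star z‖ := by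
          refine (norm_mul_le _ _).trans ?_
          gcongr
          exact norm_mul_le _ _
      _ ≤ ‖z‖ * ε * ‖z‖ := by rw [norm_star]; gcongr
      _ = ε * (‖z‖ * ‖z‖) := by ring
  set y := r * cutPlus ε a * star r + s * cutPlus ε b * star s with hy
  have hy0 : 0 ≤ y := add_nonneg (star_right_conjugate_nonneg (cutPlus_nonneg_aux a ε) r)
    (star_right_conjugate_nonneg (cutPlus_nonneg_aux b ε) s)
  have hyn : ‖1 - y‖ < 1 := by
    have e : y - 1 = (r * a * star r + s * b * star s - 1)
        + (r * (cutPlus ε a - a) * star r + s * (cutPlus ε b - b) * star s) := by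
      rw [hy]; noncomm_ring
    rw [norm_sub_rev, e]
    refine (norm_add_le _ _).trans_lt ?_
    have := norm_add_le (r * (cutPlus ε a - a) * star r) (s * (cutPlus ε b - b) * star s)
    linarith [key r a ha, key s b hb]
  have hyu : IsUnit y := by
    have := isUnit_one_sub_of_norm_lt_one hyn
    rwa [sub_sub_cancel] at this
  have hz : CFC.sqrt y * CFC.sqrt y = y := CFC.sqrt_mul_sqrt_self y hy0
  have hzu : IsUnit (CFC.sqrt y) :=
    ((Commute.refl (CFC.sqrt y)).isUnit_mul_iff.1 (hz.symm ▸ hyu)).1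
  have hzs : star (CFC.sqrt y) = CFC.sqrt y := (CFC.sqrt_nonneg y).isSelfAdjoint.star_eq
  obtain ⟨q, hq1, hq2⟩ := isUnit_iff_exists.1 hzu
  have hqs : CFC.sqrt y * star q = 1 := by
    have := congrArg star hq2
    rwa [star_mul, hzs, star_one] at this
  refine ⟨q * r, q * s, ?_⟩
  calc q * r * cutPlus ε a * star (q * r) + q * s * cutPlus ε b * star (q * s)
      = q * y * star q := by rw [hy, star_mul, star_mul]; noncomm_ring
    _ = (q * CFC.sqrt y) * (CFC.sqrt y * star q) := by
        conv_lhs => rw [← hz]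
        simp only [mul_assoc]
    _ = 1 := by rw [hq2, hqs, one_mul]

/-- If `A` is unital of stable rank one and `a, b` are positive with `1 ≾ a ⊕ b`, then there is
`ε > 0` with `1 - f_ε(a) ≾ (b - ε)₊`. -/
theorem one_sub_fEps_cuntzLE [CStarAlgebra A] [PartialOrder A] [StarOrderedRing A]
    (hA : StableRankOne A) (a b : A) (ha : 0 ≤ a) (hb : 0 ≤ b)
    (h : CuntzLE (m1 (1 : A)) (dsum (m1 a) (m1 b))) :
    ∃ ε : ℝ, 0 < ε ∧ CuntzLE (m1 ((1 : A) - fEps ε a)) (m1 (cutPlus ε b)) := by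
  obtain ⟨ε, hε, r, s, hrs⟩ := exists_exact_aux a b ha hb h
  refine ⟨ε, hε, ?_⟩
  have hsa : IsSelfAdjoint a := ha.isSelfAdjoint
  set c : A := cfc (fun t : ℝ => Real.sqrt ((t - ε) ⊔ 0)) a with hc
  set g : A := cfc (fun t : ℝ => Real.sqrt (1 - (t / ε) ⊓ 1)) a with hg
  have hcc : c * c = cutPlus ε a := by
    rw [hc, ← cfc_mul _ _ a, cutPlus]
    refine cfc_congr fun t _ => ?_
    exact Real.mul_self_sqrt (le_max_right _ _)
  have hgg : g * g = 1 - fEps ε a := by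
    rw [hg, ← cfc_mul _ _ a, fEps, ← cfc_one ℝ a,
      ← cfc_sub (1 : ℝ → ℝ) (fun t : ℝ => (t / ε) ⊓ 1) a]
    refine cfc_congr fun t _ => ?_
    exact Real.mul_self_sqrt (sub_nonneg.2 (min_le_right _ _))
  have hcg : c * g = 0 := by
    rw [hc, hg, ← cfc_mul _ _ a, ← cfc_zero ℝ a]
    refine cfc_congr fun t _ => ?_
    rcases le_total t ε with ht | ht
    · simp [ht]
    · have : 1 ≤ t / ε := (one_le_div hε).2 ht
      simp [this]
  have hcs : star c = c := (show IsSelfAdjoint c from IsSelfAdjoint.cfc).star_eq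
  have hgsa : IsSelfAdjoint g := IsSelfAdjoint.cfc
  have hgs : star g = g := hgsa.star_eq
  have hug : (r * c) * g = 0 := by rw [mul_assoc, hcg, mul_zero]
  have hw : ∀ k : ℕ, ∃ w : A, star w * w = 1 ∧ ‖star (r * c) * w * g‖ ≤ 1 / ((k : ℝ) + 1) :=
    fun k => exists_w_aux hA (r * c) g hgsa hug _ (by positivity)
  choose w hw1 hw2 using hw
  refine ⟨fun k => m1 (g * star (w k) * s), ?_⟩
  have hent : Tendsto (fun k => (g * star (w k) * s) * cutPlus ε b *
      star (g * star (w k) * s)) atTop (nhds (1 - fEps ε a)) := by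
    have h0 : Tendsto (fun k => star (r * c) * w k * g) atTop (nhds 0) :=
      squeeze_zero_norm hw2 tendsto_one_div_add_atTop_nhds_zero_nat
    have h1 : Tendsto (fun k => (1 - fEps ε a) -
        star (star (r * c) * w k * g) * (star (r * c) * w k * g)) atTop
        (nhds (1 - fEps ε a)) := by
      simpa using (h0.star.mul h0).const_sub (1 - fEps ε a)
    refine h1.congr fun k => ?_
    have e1 : s * cutPlus ε b * star s = 1 - r * (c * c) * star r := by
      rw [hcc, ← hrs, add_sub_cancel_left]
    have e2 : (g * star (w k) * s) * cutPlus ε b * star (g * star (w k) * s)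
        = g * star (w k) * (s * cutPlus ε b * star s) * w k * g := by
      simp only [star_mul, star_star, hgs, mul_assoc]
    rw [e2, e1, ← hgg]
    have e3 : g * g = g * (star (w k) * w k) * g := by rw [hw1, mul_one]
    rw [e3]
    simp only [star_mul, star_star, hgs, hcs]
    noncomm_ring
  refine tendsto_pi_nhds.2 fun i => tendsto_pi_nhds.2 fun j => ?_
  refine hent.congr fun k => ?_
  simp [Matrix.mul_apply, m1]
end
end

section
/- Let A be a unital C*-algebra of stable rank one and let n ≥ 1 be a natural number. Suppose there exist k ≥ 1 and a positive element d ∈ M_k(A) such that d^{⊕n} ≾ 1_A and 1_A ≾ d^{⊕(n+1)}. Then there exist ε > 0 and positive elements b_1, …, b_n ∈ A which are pairwise orthogonal (b_i b_j = 0 for i ≠ j) and mutually equivalent (b_i ∼ b_1 for all i), such that b_1 + ⋯ + b_n ≤ 1_A and 1_A − (b_1 + ⋯ + b_n) ≾ (b_1 − ε)₊. -/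
open Filter Topology

noncomputable section

variable {A : Type*}

/-- The `n`-fold direct sum `d ⊕ ⋯ ⊕ d` of a square matrix `d`. -/
def dpow [NonUnitalCStarAlgebra A] {ι : Type*} (d : Matrix ι ι A) (n : ℕ) :
    Matrix (ι × Fin n) (ι × Fin n) A :=
  Matrix.blockDiagonal fun _ : Fin n => d

/-- Equivalence of positive elements: `a = x* x` and `b = x x*`. -/
def EquivPos [NonUnitalCStarAlgebra A] (a b : A) : Prop :=
  ∃ x : A, a = star x * x ∧ b = x * star x

section abstractLemmas

lemma aux_exists_unitary [CStarAlgebra A] [PartialOrder A] [StarOrderedRing A]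
    (hA : StableRankOne A) (s : A) {ε : ℝ} (hε : 0 < ε) :
    ∃ u : A, star u * u = 1 ∧ u * star u = 1 ∧
      ‖u * (s * star s) * star u - star s * s‖ < ε := by
  have hopen : IsOpen {t : A | ‖s * star s - star t * t‖ + ‖t * star t - star s * s‖ < ε} :=
    isOpen_lt (by fun_prop) continuous_const
  obtain ⟨t, ht, htu⟩ := hA.inter_open_nonempty _ hopen ⟨star s, by simpa using hε⟩
  have htu' : IsUnit t := htu
  have hpos : IsStrictlyPositive (star t * t) :=
    (htu'.star.mul htu').isStrictlyPositive (star_mul_self_nonneg t)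
  set R : A := (star t * t) ^ (-(1 / 2) : ℝ) with hR
  have hRR : R * (star t * t) * R = 1 := CFC.conjugate_rpow_neg_one_half _ hpos
  have hRs : star R = R := (IsSelfAdjoint.of_nonneg CFC.rpow_nonneg).star_eq
  have hRu : IsUnit R := hpos.isUnit.cfcRpow _ hpos.nonneg
  have h1 : star (t * R) * (t * R) = 1 := by
    rw [star_mul, hRs, ← hRR]; noncomm_ring
  have huu : IsUnit (t * R) := htu'.mul hRu
  have h2 : (t * R) * star (t * R) = 1 := by
    obtain ⟨y, hy⟩ := huu
    have : star (t * R) = ↑y⁻¹ := by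
      rw [← hy] at h1 ⊢
      exact (Units.inv_eq_of_mul_eq_one_left h1).symm
    rw [this, ← hy]; simp
  have hn : ‖t * R‖ ≤ 1 := by
    have := CStarRing.norm_star_mul_self (x := t * R)
    rw [h1] at this
    have h3 : ‖(1 : A)‖ ≤ 1 := by
      by_cases hT : Nontrivial A
      · simp
      · rw [not_nontrivial_iff_subsingleton] at hT
        rw [Subsingleton.elim (1 : A) 0]; simp
    nlinarith [norm_nonneg (t * R)]
  refine ⟨t * R, h1, h2, ?_⟩
  have h3 : (t * R) * (star t * t) * star (t * R) = t * star t := by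
    have : R * (star t * t) * R = 1 := hRR
    rw [star_mul, hRs]
    calc t * R * (star t * t) * (R * star t) = t * (R * (star t * t) * R) * star t := by noncomm_ring
      _ = _ := by rw [this]; simp
  have h4 : (t * R) * (s * star s) * star (t * R) - star s * s =
      (t * R) * (s * star s - star t * t) * star (t * R) + (t * star t - star s * s) := by
    rw [← h3]; noncomm_ring
  rw [h4]
  refine lt_of_le_of_lt (norm_add_le _ _) (lt_of_le_of_lt ?_ ht)
  gcongr
  calc _ ≤ ‖t * R‖ * ‖s * star s - star t * t‖ * ‖star (t * R)‖ := norm_mul₃_le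
    _ ≤ 1 * ‖s * star s - star t * t‖ * 1 := by
      rw [norm_star]; gcongr
    _ = _ := by ring

lemma aux_cut [CStarAlgebra A] (s b : A) (hb : IsSelfAdjoint b) (h : s * b = s) :
    s * cutPlus (1 / 2) b = (1 / 2 : ℝ) • s := by
  have h1 : cutPlus (1 / 2) b = algebraMap ℝ A (1 / 2) +
      (b - 1) * cfc (fun t : ℝ => 1 / (2 * max (1 - t) (1 / 2))) b := by
    have hc : Continuous (fun t : ℝ => 1 / (2 * max (1 - t) (1 / 2))) := by
      refine Continuous.div (by fun_prop) (by fun_prop) fun t => ?_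
      have : (1 / 2 : ℝ) ≤ max (1 - t) (1 / 2) := le_max_right _ _
      positivity
    have e1 : b - 1 = cfc (fun t : ℝ => t - 1) b := by
      rw [cfc_sub (fun t : ℝ => t) (fun _ => 1) b, cfc_id' ℝ b, cfc_const_one ℝ b]
    rw [e1, ← cfc_mul _ _ b (by fun_prop) hc.continuousOn, ← cfc_const (1 / 2 : ℝ) b,
      ← cfc_add b _ _ (by fun_prop) (by fun_prop)]
    unfold cutPlus
    congr 1
    ext t
    rcases le_total t (1 / 2) with ht | ht
    · rw [max_eq_right (by linarith), max_eq_left (by linarith)]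
      have : (1 - t) ≠ 0 := by linarith
      field_simp
      ring
    · rw [max_eq_left (by linarith), max_eq_right (by linarith)]
      ring
  rw [h1, mul_add, ← mul_assoc, mul_sub, h, mul_one, sub_self, zero_mul, add_zero,
    Algebra.algebraMap_eq_smul_one, mul_smul_comm, mul_one]

lemma aux_core [CStarAlgebra A] [PartialOrder A] [StarOrderedRing A]
    (hA : StableRankOne A) (p s s₀ b₀ : A) (hp : p ≤ 1) (hb : IsSelfAdjoint b₀)
    (hs : s * p = s) (hs₀ : s₀ * b₀ = s₀) (h1 : s * star s + s₀ * star s₀ = 1) :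
    CuntzLE (m1 (1 - p)) (m1 (cutPlus (1 / 2) b₀)) := by
  have hq : 0 ≤ 1 - p := sub_nonneg.2 hp
  set e : A := CFC.sqrt (1 - p) with he
  have hee : e * e = 1 - p := CFC.sqrt_mul_sqrt_self _ hq
  have hes : star e = e := (IsSelfAdjoint.of_nonneg (CFC.sqrt_nonneg _)).star_eq
  have hse : s * e = 0 := by
    rw [← CStarRing.mul_star_self_eq_zero_iff, star_mul, hes]
    calc s * e * (e * star s) = s * (e * e) * star s := by noncomm_ring
      _ = (s - s * p) * star s := by rw [hee]; noncomm_ring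
      _ = 0 := by rw [hs]; simp
  have hes' : e * star s = 0 := by
    have := congrArg star hse
    simpa [hes] using this
  choose u hu1 hu2 hu3 using fun m : ℕ =>
    aux_exists_unitary hA s (ε := 1 / ((m : ℝ) + 1)) (by positivity)
  have hy : ∀ m, (Real.sqrt 2 • (e * u m * s₀)) * cutPlus (1 / 2) b₀ *
      star (Real.sqrt 2 • (e * u m * s₀)) =
      1 - p - e * (u m * (s * star s) * star (u m) - star s * s) * e := by
    intro m
    rw [smul_mul_assoc, mul_assoc _ s₀, aux_cut s₀ b₀ hb hs₀, star_smul, mul_smul_comm,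
      smul_mul_assoc, mul_smul_comm (1 / 2 : ℝ), smul_mul_assoc, smul_smul, smul_smul]
    have h2 : star (Real.sqrt 2) * Real.sqrt 2 * (1 / 2) = 1 := by
      rw [star_trivial, Real.mul_self_sqrt (by norm_num)]; norm_num
    rw [h2]
    have h3 : s₀ * star s₀ = 1 - s * star s := by rw [← h1]; abel
    rw [one_smul, star_mul, star_mul, hes]
    calc e * u m * s₀ * (star s₀ * (star (u m) * e))
        = e * u m * (s₀ * star s₀) * star (u m) * e := by noncomm_ring
      _ = e * (u m * star (u m)) * e - e * u m * (s * star s) * star (u m) * e := by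
        rw [h3]; noncomm_ring
      _ = 1 - p - e * u m * (s * star s) * star (u m) * e := by rw [hu2]; simp [hee]
      _ = 1 - p - (e * u m * (s * star s) * star (u m) * e - (e * star s) * (s * e)) := by
        rw [hse]; simp
      _ = _ := by noncomm_ring
  refine ⟨fun m => m1 (Real.sqrt 2 • (e * u m * s₀)), ?_⟩
  have hmm : ∀ m, m1 (Real.sqrt 2 • (e * u m * s₀)) * m1 (cutPlus (1 / 2) b₀) *
      (m1 (Real.sqrt 2 • (e * u m * s₀))).conjTranspose =
      m1 (1 - p - e * (u m * (s * star s) * star (u m) - star s * s) * e) := by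
    intro m
    rw [← hy m]
    ext i j
    simp only [m1, Matrix.mul_apply, Matrix.conjTranspose_apply, Matrix.of_apply,
      Finset.univ_unique, Finset.sum_singleton]
  simp only [hmm]
  have hlim : Tendsto (fun m => u m * (s * star s) * star (u m) - star s * s) atTop (nhds 0) := by
    refine squeeze_zero_norm (fun m => (hu3 m).le) tendsto_one_div_add_atTop_nhds_zero_nat
  have hlim2 : Tendsto (fun m => 1 - p - e * (u m * (s * star s) * star (u m) - star s * s) * e)
      atTop (nhds (1 - p)) := by
    have := (tendsto_const_nhds (x := 1 - p)).sub ((hlim.const_mul e).mul_const e)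
    simpa using this
  exact tendsto_pi_nhds.2 fun i => tendsto_pi_nhds.2 fun j => hlim2

end abstractLemmas
section factorLemmas

variable {B : Type*} [CStarAlgebra B] [PartialOrder B] [StarOrderedRing B]

lemma aux_norm_bound (a Z : B) (ha : IsSelfAdjoint a) (hZ : 0 ≤ Z) (haZ : a * a ≤ Z)
    (g : ℝ → ℝ) (hg : Continuous g) (C : ℝ) (hC : 0 ≤ C) (h : ∀ t, 0 ≤ t → t * g t ^ 2 ≤ C) :
    ‖a * cfc g Z‖ ^ 2 ≤ C := by
  have hZs : IsSelfAdjoint Z := .of_nonneg hZ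
  have hG : star (cfc g Z) = cfc g Z := (cfc_predicate g Z : IsSelfAdjoint _).star_eq
  rw [sq, ← CStarRing.norm_star_mul_self, star_mul, hG, ha.star_eq]
  have h1 : cfc g Z * a * (a * cfc g Z) ≤ cfc g Z * Z * cfc g Z := by
    have := star_left_conjugate_le_conjugate haZ (cfc g Z)
    rw [hG] at this
    simpa [mul_assoc] using this
  have h0 : 0 ≤ cfc g Z * a * (a * cfc g Z) := by
    have := star_mul_self_nonneg (a * cfc g Z)
    rwa [star_mul, hG, ha.star_eq] at this
  refine (CStarAlgebra.norm_le_norm_of_nonneg_of_le h0 h1).trans ?_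
  have h2 : cfc g Z * Z * cfc g Z = cfc (fun t => t * g t ^ 2) Z := by
    conv_lhs => rw [← cfc_id' ℝ Z]
    rw [cfc_id' ℝ Z]
    nth_rewrite 2 [← cfc_id' ℝ Z]
    rw [← cfc_mul g (fun t => t) Z hg.continuousOn (by fun_prop),
      ← cfc_mul _ g Z (by fun_prop) hg.continuousOn]
    congr 1; ext t; ring
  rw [h2]
  refine norm_cfc_le hC fun t ht => ?_
  have ht0 : 0 ≤ t := spectrum_nonneg_of_nonneg hZ ht
  rw [Real.norm_of_nonneg (by positivity)]
  exact h t ht0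

lemma aux_factor (a Z v : B) (ha : IsSelfAdjoint a) (hZ : Z = v * star v) (haZ : a * a ≤ Z) :
    ∃ w : B, w * star w = a * a ∧ ∀ e, v * e = v → w * e = w := by
  have hZ0 : 0 ≤ Z := hZ ▸ mul_star_self_nonneg v
  have hZs : IsSelfAdjoint Z := .of_nonneg hZ0
  let q : ℝ → ℝ → ℝ := fun ε t => 1 / Real.sqrt (max t ε)
  have hq : ∀ ε, 0 < ε → Continuous (q ε) := by
    intro ε hε
    refine Continuous.div (by fun_prop) (by fun_prop) fun t => ?_
    have : 0 < max t ε := lt_max_of_lt_right hε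
    positivity
  have hqs : ∀ f : ℝ → ℝ, star (cfc f Z) = cfc f Z := fun f =>
    (cfc_predicate f Z : IsSelfAdjoint _).star_eq
  -- numerical facts
  have hq1 : ∀ ε, 0 < ε → ∀ t, 0 ≤ t → 0 ≤ 1 - q ε t * t * q ε t := by
    intro ε hε t ht
    have h0 : 0 < max t ε := lt_max_of_lt_right hε
    have : q ε t * t * q ε t = t / max t ε := by
      simp only [q]
      rw [show 1 / √(max t ε) * t * (1 / √(max t ε)) = t / (√(max t ε) * √(max t ε)) by ring,
        Real.mul_self_sqrt h0.le]
    rw [this, sub_nonneg, div_le_one h0]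
    exact le_max_left _ _
  have hq2 : ∀ ε, 0 < ε → ∀ t, 0 ≤ t → t * (1 - q ε t * t * q ε t) ≤ ε := by
    intro ε hε t ht
    rcases le_total t ε with h | h
    · have : 0 ≤ q ε t * t * q ε t := by
        have : 0 ≤ q ε t := by simp only [q]; positivity
        positivity
      nlinarith
    · have h0 : 0 < t := lt_of_lt_of_le hε h
      have : q ε t * t * q ε t = 1 := by
        simp only [q]
        rw [max_eq_left h, show 1 / √t * t * (1 / √t) = t / (√t * √t) by ring,
          Real.mul_self_sqrt h0.le, div_self h0.ne']
      rw [this]; simpa using hε.le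
  have hq3 : ∀ ε, 0 < ε → ∀ t, 0 ≤ t → |t * q ε t - Real.sqrt t| ≤ Real.sqrt ε := by
    intro ε hε t ht
    rcases le_total t ε with h | h
    · simp only [q]
      rw [max_eq_right h]
      have h1 : Real.sqrt t ≤ Real.sqrt ε := Real.sqrt_le_sqrt h
      have h2 : 0 < Real.sqrt ε := Real.sqrt_pos.2 hε
      have h3 : t * (1 / √ε) ≤ √t := by
        rw [mul_one_div, div_le_iff₀ h2]
        nlinarith [Real.mul_self_sqrt ht, Real.sqrt_nonneg t]
      have h4 : 0 ≤ t * (1 / √ε) := by positivity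
      rw [abs_le]
      constructor <;> linarith [Real.sqrt_nonneg t]
    · have h0 : 0 < t := lt_of_lt_of_le hε h
      simp only [q]
      rw [max_eq_left h, mul_one_div, Real.div_sqrt, sub_self, abs_zero]
      positivity
  let w : ℕ → B := fun m => a * cfc (q (1 / ((m : ℝ) + 1))) Z * v
  have hww : ∀ f g : ℝ → ℝ, Continuous f → Continuous g →
      (a * cfc f Z * v) * star (a * cfc g Z * v) = a * cfc (fun t => f t * t * g t) Z * a := by
    intro f g hf hg
    rw [cfc_mul (fun t => f t * t) g Z (by fun_prop) (by fun_prop),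
      cfc_mul f (fun t => t) Z (by fun_prop) (by fun_prop), cfc_id' ℝ Z, star_mul, star_mul, hqs,
      ha.star_eq, hZ]
    noncomm_ring
  -- Cauchy
  have hdiff : ∀ ε η, 0 < ε → 0 < η →
      ‖a * cfc (q ε) Z * v - a * cfc (q η) Z * v‖ ≤ Real.sqrt ε + Real.sqrt η := by
    intro ε η hε hη
    have hcε := hq ε hε
    have hcη := hq η hη
    have h1 : a * cfc (q ε) Z * v - a * cfc (q η) Z * v =
        a * cfc (fun t => q ε t - q η t) Z * v := by
      rw [cfc_sub (q ε) (q η) Z (by fun_prop) (by fun_prop)]; noncomm_ring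
    rw [h1]
    refine le_of_sq_le_sq ?_ (by positivity)
    rw [sq, ← CStarRing.norm_self_mul_star, hww _ _ (by fun_prop) (by fun_prop)]
    have h2 : a * cfc (fun t => (q ε t - q η t) * t * (q ε t - q η t)) Z * a =
        (a * cfc (fun t => Real.sqrt t * (q ε t - q η t)) Z) *
          star (a * cfc (fun t => Real.sqrt t * (q ε t - q η t)) Z) := by
      rw [star_mul, hqs, ha.star_eq]
      have : cfc (fun t => (q ε t - q η t) * t * (q ε t - q η t)) Z =
          cfc (fun t => Real.sqrt t * (q ε t - q η t)) Z *
          cfc (fun t => Real.sqrt t * (q ε t - q η t)) Z := by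
        rw [← cfc_mul _ _ Z (by fun_prop) (by fun_prop)]
        refine cfc_congr fun t ht => ?_
        have ht0 : 0 ≤ t := spectrum_nonneg_of_nonneg hZ0 ht
        have := Real.mul_self_sqrt ht0
        linear_combination (-(q ε t - q η t) ^ 2) * this
      rw [this]; noncomm_ring
    rw [h2, CStarRing.norm_self_mul_star, ← sq]
    refine aux_norm_bound a Z ha hZ0 haZ _ (by fun_prop) _ (by positivity) fun t ht => ?_
    have h3 : t * (√t * (q ε t - q η t)) ^ 2 = ((t * q ε t - √t) - (t * q η t - √t)) ^ 2 := by
      have := Real.mul_self_sqrt ht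
      linear_combination (t * (q ε t - q η t) ^ 2) * this
    rw [h3]
    refine sq_le_sq' ?_ ?_ <;>
    · have h4 := abs_le.1 (hq3 ε hε t ht)
      have h5 := abs_le.1 (hq3 η hη t ht)
      linarith [h4.1, h4.2, h5.1, h5.2]
  have hr : Tendsto (fun m : ℕ => 1 / ((m : ℝ) + 1)) atTop (nhds 0) :=
    tendsto_one_div_add_atTop_nhds_zero_nat
  have hpos : ∀ m : ℕ, 0 < 1 / ((m : ℝ) + 1) := fun m => by positivity
  have hcauchy : CauchySeq w := by
    refine cauchySeq_of_le_tendsto_0 (fun N => 2 * Real.sqrt (1 / ((N : ℝ) + 1))) ?_ ?_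
    · intro m l N hm hl
      rw [dist_eq_norm]
      refine (hdiff _ _ (hpos m) (hpos l)).trans ?_
      have h1 : Real.sqrt (1 / ((m : ℝ) + 1)) ≤ Real.sqrt (1 / ((N : ℝ) + 1)) := by
        apply Real.sqrt_le_sqrt; gcongr
      have h2 : Real.sqrt (1 / ((l : ℝ) + 1)) ≤ Real.sqrt (1 / ((N : ℝ) + 1)) := by
        apply Real.sqrt_le_sqrt; gcongr
      linarith
    · have := ((Real.continuous_sqrt.tendsto 0).comp hr).const_mul 2
      simpa using this
  obtain ⟨w₀, hw₀⟩ := cauchySeq_tendsto_of_complete hcauchy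
  refine ⟨w₀, ?_, ?_⟩
  · have h1 : Tendsto (fun m => w m * star (w m)) atTop (nhds (w₀ * star w₀)) :=
      hw₀.mul ((continuous_star.tendsto _).comp hw₀)
    refine tendsto_nhds_unique h1 ?_
    rw [tendsto_iff_norm_sub_tendsto_zero]
    refine squeeze_zero (fun _ => norm_nonneg _) (fun m => ?_) hr
    set ε := 1 / ((m : ℝ) + 1) with hεdef
    have hε : 0 < ε := hpos m
    have hcε := hq ε hε
    have h2 : w m * star (w m) - a * a =
        -((a * cfc (fun t => Real.sqrt (1 - q ε t * t * q ε t)) Z) *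
          star (a * cfc (fun t => Real.sqrt (1 - q ε t * t * q ε t)) Z)) := by
      have e1 : cfc (fun t => Real.sqrt (1 - q ε t * t * q ε t)) Z *
          cfc (fun t => Real.sqrt (1 - q ε t * t * q ε t)) Z =
          1 - cfc (fun t => q ε t * t * q ε t) Z := by
        rw [← cfc_mul _ _ Z (by fun_prop) (by fun_prop), ← cfc_const_one ℝ Z,
          ← cfc_sub _ _ Z (by fun_prop) (by fun_prop)]
        refine cfc_congr fun t ht => ?_
        have ht0 : 0 ≤ t := spectrum_nonneg_of_nonneg hZ0 ht
        exact Real.mul_self_sqrt (hq1 ε hε t ht0)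
      have e2 : w m * star (w m) = a * cfc (fun t => q ε t * t * q ε t) Z * a :=
        hww _ _ hcε hcε
      rw [e2, star_mul, hqs, ha.star_eq]
      calc _ = -(a * (1 - cfc (fun t => q ε t * t * q ε t) Z) * a) := by noncomm_ring
        _ = _ := by rw [← e1]; noncomm_ring
    rw [h2, norm_neg, CStarRing.norm_self_mul_star, ← sq]
    refine aux_norm_bound a Z ha hZ0 haZ _ (by fun_prop) _ hε.le fun t ht => ?_
    rw [Real.sq_sqrt (hq1 ε hε t ht)]
    exact hq2 ε hε t ht
  · intro e he
    have h1 : Tendsto (fun m => w m * e) atTop (nhds (w₀ * e)) := hw₀.mul_const e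
    refine tendsto_nhds_unique h1 ?_
    have : (fun m => w m * e) = w := by
      ext m
      simp only [w, mul_assoc, he]
    rw [this]
    exact hw₀

/-- The function that is `0` on `t ≤ δ` and `1` on `t ≥ 2δ`. -/
def auxPhi (δ t : ℝ) : ℝ := (max (t - δ) 0 / max (t - δ) δ) ^ 2

lemma auxPhi_cont {δ : ℝ} (hδ : 0 < δ) : Continuous (auxPhi δ) := by
  unfold auxPhi
  refine Continuous.pow (Continuous.div (by fun_prop) (by fun_prop) fun t => ?_) 2
  exact (lt_max_of_lt_right hδ).ne'

lemma aux_exact (D x : B) (hD : 0 ≤ D) {δ : ℝ} (hδ : 0 < δ) (h : ‖x * star x - D‖ ≤ δ) :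
    ∃ w : B, w * star w = cfc (auxPhi δ) D ∧ ∀ e, x * e = x → w * e = w := by
  have hDs : IsSelfAdjoint D := .of_nonneg hD
  have hsa : ∀ f : ℝ → ℝ, star (cfc f D) = cfc f D := fun f =>
    (cfc_predicate f D : IsSelfAdjoint _).star_eq
  set a := cfc (fun t : ℝ => max (t - δ) 0) D with ha
  set r := cfc (fun t : ℝ => Real.sqrt (max (t - δ) 0)) D with hr
  have hkey : a * a ≤ (r * x) * star (r * x) := by
    have h1 : 0 ≤ x * star x - D + algebraMap ℝ B δ := by
      have hs : IsSelfAdjoint (x * star x - D) := (IsSelfAdjoint.mul_star_self x).sub hDs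
      have h2 := hs.neg_algebraMap_norm_le_self
      have h3 : algebraMap ℝ B ‖x * star x - D‖ ≤ algebraMap ℝ B δ := algebraMap_mono B h
      have h4 := neg_le_neg h3 |>.trans h2
      simpa using add_le_add_left h4 (algebraMap ℝ B δ)
    have h5 := star_right_conjugate_nonneg h1 r
    have h6 : r * (D - algebraMap ℝ B δ) * r = a * a := by
      have e1 : D - algebraMap ℝ B δ = cfc (fun t : ℝ => t - δ) D := by
        rw [cfc_sub (fun t : ℝ => t) (fun _ => δ) D, cfc_id' ℝ D, cfc_const δ D]
      rw [e1, hr, ha, ← cfc_mul _ _ D (by fun_prop) (by fun_prop),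
        ← cfc_mul _ _ D (by fun_prop) (by fun_prop), ← cfc_mul _ _ D (by fun_prop) (by fun_prop)]
      congr 1; ext t
      have h7 := Real.mul_self_sqrt (le_max_right (t - δ) 0)
      have h8 : max (t - δ) 0 * (t - δ) = max (t - δ) 0 * max (t - δ) 0 := by
        rcases le_total (t - δ) 0 with h | h
        · rw [max_eq_right h]; ring
        · rw [max_eq_left h]
      linear_combination (t - δ) * h7 + h8
    rw [← sub_nonneg]
    convert h5 using 1
    rw [← h6, star_mul, hsa]
    noncomm_ring
  obtain ⟨w, hw1, hw2⟩ := aux_factor a _ (r * x) (hsa _) rfl hkey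
  have hc : Continuous (fun t : ℝ => 1 / max (t - δ) δ) :=
    Continuous.div (by fun_prop) (by fun_prop) fun t => (lt_max_of_lt_right hδ).ne'
  obtain ⟨g, hg⟩ : ∃ g : ℝ → ℝ, g = fun t : ℝ => 1 / max (t - δ) δ := ⟨_, rfl⟩
  rw [← hg] at hc
  refine ⟨cfc g D * w, ?_, ?_⟩
  · rw [star_mul, hsa]
    calc _ = cfc g D * (w * star w) *
          cfc g D := by noncomm_ring
      _ = _ := by
        rw [hw1, ha, ← cfc_mul _ _ D (by fun_prop) (by fun_prop),
          ← cfc_mul _ _ D (by fun_prop) (by fun_prop), ← cfc_mul _ _ D (by fun_prop) (by fun_prop)]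
        congr 1; ext t
        simp only [hg, auxPhi]
        ring
  · intro e he
    rw [mul_assoc, hw2 e (by rw [mul_assoc, he])]

end factorLemmas
section matrixLemmas

lemma aux_tr_mul [CStarAlgebra A] (X Y : Matrix (Fin 1) (Fin 1) A) :
    (X * Y) 0 0 = X 0 0 * Y 0 0 := by
  simp [Matrix.mul_apply]

lemma aux_tr_star [CStarAlgebra A] (X : Matrix (Fin 1) (Fin 1) A) :
    star (X 0 0) = X.conjTranspose 0 0 := rfl

lemma aux_assemble [CStarAlgebra A] [PartialOrder A] [StarOrderedRing A]
    (hA : StableRankOne A) (n : ℕ) (hn : 1 ≤ n) {k : ℕ}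
    (K P : Matrix (Fin k) (Fin k) A) (hK : K.conjTranspose = K) (hKP : K * P = K)
    (w : Fin n → Matrix (Fin k) (Fin 1) A)
    (hw : ∀ i j, w i * (w j).conjTranspose = if i = j then P else 0)
    (hc : ‖∑ i, ((w i).conjTranspose * w i) 0 0‖ ≤ 1)
    (r : Fin (n + 1) → Matrix (Fin 1) (Fin k) A)
    (hr : ‖1 - ∑ j, (r j * (K * K) * (r j).conjTranspose) 0 0‖ < 1) :
    ∃ ε : ℝ, 0 < ε ∧ ∃ b : Fin n → A,
      (∀ i, 0 ≤ b i) ∧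
      (∀ i j, i ≠ j → b i * b j = 0) ∧
      (∀ i, EquivPos (b i) (b ⟨0, hn⟩)) ∧
      (∑ i, b i) ≤ 1 ∧
      CuntzLE (m1 ((1 : A) - ∑ i, b i)) (m1 (cutPlus ε (b ⟨0, hn⟩))) := by
  set c : Fin n → A := fun i => ((w i).conjTranspose * w i) 0 0 with hcdef
  have hcs : ∀ i, star (c i) = c i := by
    intro i
    simp only [hcdef, aux_tr_star, Matrix.conjTranspose_mul, Matrix.conjTranspose_conjTranspose]
  have hc0 : ∀ i, 0 ≤ c i := by
    intro i
    simp only [hcdef, Matrix.mul_apply, Matrix.conjTranspose_apply]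
    exact Finset.sum_nonneg fun a _ => star_mul_self_nonneg _
  have hcc : ∀ i j, i ≠ j → c i * c j = 0 := by
    intro i j hij
    simp only [hcdef]
    rw [← aux_tr_mul]
    have : (w i).conjTranspose * w i * ((w j).conjTranspose * w j) =
        (w i).conjTranspose * (w i * (w j).conjTranspose) * w j := by
      simp only [Matrix.mul_assoc]
    rw [this, hw, if_neg hij]
    simp
  have hsum : (∑ i, c i * c i) = (∑ i, c i) * (∑ i, c i) := by
    rw [Finset.sum_mul_sum]
    refine Finset.sum_congr rfl fun i _ => ?_
    rw [Finset.sum_eq_single i (fun j _ hj => hcc i j hj.symm) (by simp)]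
  have hC0 : 0 ≤ ∑ i, c i := Finset.sum_nonneg fun i _ => hc0 i
  have hCs : star (∑ i, c i) = ∑ i, c i := (IsSelfAdjoint.of_nonneg hC0).star_eq
  -- the row vectors
  set Q : A := ∑ j, (r j * (K * K) * (r j).conjTranspose) 0 0 with hQ
  have hQ0 : 0 ≤ Q := by
    refine Finset.sum_nonneg fun j _ => ?_
    have : r j * (K * K) * (r j).conjTranspose = (r j * K) * (r j * K).conjTranspose := by
      rw [Matrix.conjTranspose_mul, hK]; simp only [Matrix.mul_assoc]
    rw [this, Matrix.mul_apply]
    exact Finset.sum_nonneg fun a _ => mul_star_self_nonneg _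
  have hQu : IsUnit Q := by
    have := isUnit_one_sub_of_norm_lt_one hr
    simpa using this
  have hQp : IsStrictlyPositive Q := hQu.isStrictlyPositive hQ0
  set R : A := Q ^ (-(1 / 2) : ℝ) with hR
  have hRR : R * Q * R = 1 := CFC.conjugate_rpow_neg_one_half _ hQp
  have hRs : star R = R := (IsSelfAdjoint.of_nonneg CFC.rpow_nonneg).star_eq
  let S : Fin (n + 1) → Fin n → A := fun j i => (r j * K * w i) 0 0
  have hS1 : ∀ j i i', S j i * c i' = if i = i' then S j i else 0 := by
    intro j i i'
    simp only [S, hcdef]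
    rw [← aux_tr_mul]
    have : r j * K * w i * ((w i').conjTranspose * w i') =
        r j * (K * (w i * (w i').conjTranspose)) * w i' := by
      simp only [Matrix.mul_assoc]
    rw [this, hw]
    split_ifs with h
    · subst h; rw [hKP]
    · simp
  have hS2 : ∀ j i j' i', S j i * star (S j' i') =
      if i = i' then (r j * (K * K) * (r j').conjTranspose) 0 0 else 0 := by
    intro j i j' i'
    simp only [S]
    rw [aux_tr_star, ← aux_tr_mul]
    have : r j * K * w i * (r j' * K * w i').conjTranspose =
        r j * (K * (w i * (w i').conjTranspose) * K) * (r j').conjTranspose := by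
      simp only [Matrix.conjTranspose_mul, hK, Matrix.mul_assoc]
    rw [this, hw]
    split_ifs with h
    · rw [hKP]
    · simp
  refine ⟨1 / 2, by norm_num, fun i => c i * c i, ?_, ?_, ?_, ?_, ?_⟩
  · intro i
    have := star_mul_self_nonneg (c i)
    rwa [hcs] at this
  · intro i j hij
    calc c i * c i * (c j * c j) = c i * (c i * c j) * c j := by noncomm_ring
      _ = 0 := by rw [hcc i j hij]; simp
  · intro i
    refine ⟨((w ⟨0, hn⟩).conjTranspose * w i) 0 0, ?_, ?_⟩
    · simp only [hcdef]
      rw [aux_tr_star, ← aux_tr_mul, ← aux_tr_mul]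
      have h1 : (w i).conjTranspose * w i * ((w i).conjTranspose * w i) =
        (w i).conjTranspose * (w i * (w i).conjTranspose) * w i := by
          simp only [Matrix.mul_assoc]
      have h2 : ((w ⟨0, hn⟩).conjTranspose * w i).conjTranspose *
          ((w ⟨0, hn⟩).conjTranspose * w i) =
        (w i).conjTranspose * (w ⟨0, hn⟩ * (w ⟨0, hn⟩).conjTranspose) * w i := by
          simp only [Matrix.conjTranspose_mul, Matrix.conjTranspose_conjTranspose, Matrix.mul_assoc]
      rw [h1, h2, hw, hw, if_pos rfl, if_pos rfl]
    · simp only [hcdef]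
      rw [aux_tr_star, ← aux_tr_mul, ← aux_tr_mul]
      have h1 : (w ⟨0, hn⟩).conjTranspose * w ⟨0, hn⟩ *
          ((w ⟨0, hn⟩).conjTranspose * w ⟨0, hn⟩) =
        (w ⟨0, hn⟩).conjTranspose * (w ⟨0, hn⟩ * (w ⟨0, hn⟩).conjTranspose) * w ⟨0, hn⟩ := by
          simp only [Matrix.mul_assoc]
      have h2 : ((w ⟨0, hn⟩).conjTranspose * w i) *
          ((w ⟨0, hn⟩).conjTranspose * w i).conjTranspose =
        (w ⟨0, hn⟩).conjTranspose * (w i * (w i).conjTranspose) * w ⟨0, hn⟩ := by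
          simp only [Matrix.conjTranspose_mul, Matrix.conjTranspose_conjTranspose, Matrix.mul_assoc]
      rw [h1, h2, hw, hw, if_pos rfl, if_pos rfl]
  · rw [hsum]
    have h1 : 0 ≤ (∑ i, c i) * (∑ i, c i) := by
      have := star_mul_self_nonneg (∑ i, c i)
      rwa [hCs] at this
    rw [← CStarAlgebra.norm_le_one_iff_of_nonneg _ h1]
    refine (norm_mul_le _ _).trans ?_
    exact mul_le_one₀ hc (norm_nonneg _) hc
  · have hp1 : (∑ i, c i * c i) ≤ 1 := by
      rw [hsum]
      have h1 : 0 ≤ (∑ i, c i) * (∑ i, c i) := by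
        have := star_mul_self_nonneg (∑ i, c i)
        rwa [hCs] at this
      rw [← CStarAlgebra.norm_le_one_iff_of_nonneg _ h1]
      refine (norm_mul_le _ _).trans ?_
      exact mul_le_one₀ hc (norm_nonneg _) hc
    refine aux_core hA _ (R * ∑ i : Fin n, S i.castSucc i) (R * S (Fin.last n) ⟨0, hn⟩) _ hp1
      ?_ ?_ ?_ ?_
    · rw [IsSelfAdjoint, star_mul, hcs]
    · rw [hsum]
      have : (∑ i : Fin n, S i.castSucc i) * (∑ i, c i) = ∑ i : Fin n, S i.castSucc i := by
        rw [Finset.sum_mul_sum]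
        refine Finset.sum_congr rfl fun i _ => ?_
        simp [hS1]
      rw [mul_assoc, ← mul_assoc (∑ i : Fin n, S i.castSucc i), this, this]
    · have := hS1 (Fin.last n) ⟨0, hn⟩ ⟨0, hn⟩
      rw [if_pos rfl] at this
      rw [mul_assoc, ← mul_assoc (S _ _), this, this]
    · have h1 : (∑ i : Fin n, S i.castSucc i) * star (∑ i : Fin n, S i.castSucc i) =
          ∑ i : Fin n, (r i.castSucc * (K * K) * (r i.castSucc).conjTranspose) 0 0 := by
        rw [star_sum, Finset.sum_mul_sum]
        refine Finset.sum_congr rfl fun i _ => ?_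
        simp [hS2]
      have h2 := hS2 (Fin.last n) ⟨0, hn⟩ (Fin.last n) ⟨0, hn⟩
      rw [if_pos rfl] at h2
      have h3 : Q = (∑ i : Fin n, S i.castSucc i) * star (∑ i : Fin n, S i.castSucc i) +
          S (Fin.last n) ⟨0, hn⟩ * star (S (Fin.last n) ⟨0, hn⟩) := by
        rw [h1, h2, hQ, Fin.sum_univ_castSucc]
      rw [star_mul, star_mul, hRs, ← hRR, h3]
      noncomm_ring

/-- The block diagonal embedding as a star homomorphism. -/
def auxBlock (A : Type*) [CStarAlgebra A] (k n : ℕ) :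
    CStarMatrix (Fin k) (Fin k) A →⋆ₐ[ℂ] CStarMatrix (Fin k × Fin n) (Fin k × Fin n) A where
  toFun d := CStarMatrix.ofMatrix (Matrix.blockDiagonal fun _ : Fin n => CStarMatrix.ofMatrix.symm d)
  map_one' := Matrix.blockDiagonal_one
  map_mul' a b := Matrix.blockDiagonal_mul (fun _ : Fin n => CStarMatrix.ofMatrix.symm a)
    (fun _ : Fin n => CStarMatrix.ofMatrix.symm b)
  map_zero' := Matrix.blockDiagonal_zero
  map_add' a b := Matrix.blockDiagonal_add (fun _ : Fin n => CStarMatrix.ofMatrix.symm a)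
    (fun _ : Fin n => CStarMatrix.ofMatrix.symm b)
  commutes' z := by
    rw [Algebra.algebraMap_eq_smul_one, Algebra.algebraMap_eq_smul_one]
    ext p q
    simp [Matrix.blockDiagonal_apply, CStarMatrix.one_apply, Prod.ext_iff]
    grind
  map_star' a := (Matrix.blockDiagonal_conjTranspose
    (fun _ : Fin n => CStarMatrix.ofMatrix.symm a)).symm

lemma auxBlock_continuous [CStarAlgebra A] [PartialOrder A] [StarOrderedRing A] (k n : ℕ) :
    Continuous (auxBlock A k n) := by
  refine continuous_pi fun p => continuous_pi fun q => ?_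
  change Continuous fun d : CStarMatrix (Fin k) (Fin k) A =>
    Matrix.blockDiagonal (fun _ : Fin n => CStarMatrix.ofMatrix.symm d) p q
  simp only [Matrix.blockDiagonal_apply]
  split_ifs
  · exact (continuous_apply q.1).comp (continuous_apply p.1)
  · exact continuous_const

end matrixLemmas
section finalLemmas

lemma auxPhi_nonneg (δ t : ℝ) : 0 ≤ auxPhi δ t := sq_nonneg _

lemma auxPhi_le_one {δ : ℝ} (hδ : 0 < δ) (t : ℝ) : auxPhi δ t ≤ 1 := by
  unfold auxPhi
  have h0 : 0 < max (t - δ) δ := lt_max_of_lt_right hδ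
  refine pow_le_one₀ (div_nonneg (le_max_right _ _) h0.le) ?_
  rw [div_le_one h0]
  exact max_le_max le_rfl hδ.le


/-- The element `auxPhi δ` applied to `b`. -/
def aphi {B : Type*} [CStarAlgebra B] (δ : ℝ) (b : B) : B := cfc (auxPhi δ) b

lemma aphi_map {M N : Type*} [CStarAlgebra M] [CStarAlgebra N] (Φ : M →⋆ₐ[ℂ] N)
    (hΦ : Continuous Φ) {δ : ℝ} (hδ : 0 < δ) (d : M) (hd : IsSelfAdjoint d) :
    Φ (aphi δ d) = aphi δ (Φ d) :=
  StarAlgHomClass.map_cfc (S := ℂ) Φ (auxPhi δ) d (auxPhi_cont hδ).continuousOn hΦ hd (hd.map Φ)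

lemma aphi_norm {B : Type*} [CStarAlgebra B] {δ : ℝ} (hδ : 0 < δ) (b : B) : ‖aphi δ b‖ ≤ 1 := by
  refine norm_cfc_le zero_le_one fun t _ => ?_
  rw [Real.norm_of_nonneg (auxPhi_nonneg _ _)]
  exact auxPhi_le_one hδ t

lemma aux_columns [CStarAlgebra A] [PartialOrder A] [StarOrderedRing A]
    (n : ℕ) (hn : 1 ≤ n) {k : ℕ} (hk : 1 ≤ k)
    (d : Matrix (Fin k) (Fin k) A) (hd : IsPos d)
    (h₁ : CuntzLE (dpow d n) (m1 (1 : A))) {δ : ℝ} (hδ : 0 < δ) :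
    ∃ w : Fin n → Matrix (Fin k) (Fin 1) A,
      (∀ i j, w i * (w j).conjTranspose = if i = j then
        CStarMatrix.ofMatrix.symm (aphi δ (CStarMatrix.ofMatrix d)) else 0) ∧
      ‖∑ i, ((w i).conjTranspose * w i) 0 0‖ ≤ 1 := by
  obtain ⟨z, hz⟩ := hd
  obtain ⟨x, hx⟩ := h₁
  let q₀ : Fin k × Fin n := (⟨0, hk⟩, ⟨0, hn⟩)
  let d' : CStarMatrix (Fin k) (Fin k) A := CStarMatrix.ofMatrix d
  have hd' : 0 ≤ d' := by
    have : d' = star (CStarMatrix.ofMatrix z : CStarMatrix (Fin k) (Fin k) A) * CStarMatrix.ofMatrix z := hz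
    rw [this]; exact star_mul_self_nonneg _
  have hds : IsSelfAdjoint d' := .of_nonneg hd'
  let D : CStarMatrix (Fin k × Fin n) (Fin k × Fin n) A := auxBlock A k n d'
  have hD : 0 ≤ D := by
    have : D = star (auxBlock A k n (CStarMatrix.ofMatrix z)) *
        auxBlock A k n (CStarMatrix.ofMatrix z) := by
      rw [← map_star, ← map_mul]; exact congrArg (auxBlock A k n) hz
    rw [this]; exact star_mul_self_nonneg _
  have hDs : IsSelfAdjoint D := .of_nonneg hD
  let X : ℕ → CStarMatrix (Fin k × Fin n) (Fin k × Fin n) A := fun m => CStarMatrix.ofMatrix fun p q => if q = q₀ then x m p 0 else 0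
  have hXa : ∀ m p q, X m p q = if q = q₀ then x m p 0 else 0 := fun _ _ _ => rfl
  have hX : ∀ m, X m * star (X m) =
      (CStarMatrix.ofMatrix (x m * m1 (1 : A) * (x m).conjTranspose) : CStarMatrix (Fin k × Fin n) (Fin k × Fin n) A) := by
    intro m
    ext p q
    rw [CStarMatrix.mul_apply, Finset.sum_eq_single q₀]
    · rw [CStarMatrix.star_apply, hXa, hXa, if_pos rfl, if_pos rfl]
      change _ = (x m * m1 (1 : A) * (x m).conjTranspose) p q
      simp [Matrix.mul_apply, m1]
    · intro j _ hj
      rw [hXa, if_neg hj, zero_mul]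
    · simp
  have hlim : Tendsto (fun m => X m * star (X m)) atTop (nhds D) := by
    simp only [hX]
    exact hx
  have hev : ∀ᶠ m in atTop, ‖X m * star (X m) - D‖ < δ := by
    have := (tendsto_iff_norm_sub_tendsto_zero.1 hlim)
    exact this.eventually_lt_const hδ
  obtain ⟨m, hm⟩ := hev.exists
  obtain ⟨W, hW1, hW2⟩ := aux_exact D (X m) hD hδ hm.le
  replace hW1 : W * star W = aphi δ D := hW1
  let e : CStarMatrix (Fin k × Fin n) (Fin k × Fin n) A := CStarMatrix.ofMatrix fun p q => if p = q₀ ∧ q = q₀ then 1 else 0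
  have hea : ∀ p q, e p q = if p = q₀ ∧ q = q₀ then 1 else 0 := fun _ _ => rfl
  have hWe : W * e = W := by
    refine hW2 e ?_
    ext p q
    by_cases hq : q = q₀ <;> simp [hXa, hea, CStarMatrix.mul_apply, hq]
  have hW0 : ∀ p q, q ≠ q₀ → W p q = 0 := by
    intro p q hq
    rw [← hWe]
    simp [hea, CStarMatrix.mul_apply, hq]
  have hphi : aphi δ D = auxBlock A k n (aphi δ d') :=
    (aphi_map (auxBlock A k n) (auxBlock_continuous k n) hδ d' hds).symm
  refine ⟨fun i => Matrix.of fun a _ => W (a, i) q₀, ?_, ?_⟩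
  · intro i j
    ext a b
    have h1 : (W * star W) (a, i) (b, j) = W (a, i) q₀ * star (W (b, j) q₀) := by
      rw [CStarMatrix.mul_apply, Finset.sum_eq_single q₀]
      · rw [CStarMatrix.star_apply]
      · intro q _ hq
        rw [hW0 _ q hq, zero_mul]
      · simp
    have h2 : (W * star W) (a, i) (b, j) =
        if i = j then (aphi δ d') a b else 0 := by
      rw [hW1, hphi]
      exact Matrix.blockDiagonal_apply (fun _ : Fin n => CStarMatrix.ofMatrix.symm (aphi δ d')) (a, i) (b, j)
    have h3 : ((Matrix.of fun a (_ : Fin 1) => W (a, i) q₀) *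
        (Matrix.of fun a (_ : Fin 1) => W (a, j) q₀).conjTranspose) a b =
        W (a, i) q₀ * star (W (b, j) q₀) := by
      simp [Matrix.mul_apply]
    rw [h3, ← h1, h2]
    split_ifs
    · rfl
    · rfl
  · have h1 : ∑ i, ((Matrix.of fun a (_ : Fin 1) => W (a, i) q₀).conjTranspose *
        (Matrix.of fun a (_ : Fin 1) => W (a, i) q₀)) 0 0 = (star W * W) q₀ q₀ := by
      rw [CStarMatrix.mul_apply, Fintype.sum_prod_type_right]
      refine Finset.sum_congr rfl fun i _ => ?_
      simp [Matrix.mul_apply, CStarMatrix.star_apply]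
    rw [h1]
    refine CStarMatrix.norm_entry_le_norm.trans ?_
    rw [CStarRing.norm_star_mul_self, ← CStarRing.norm_self_mul_star, hW1]
    exact aphi_norm hδ D

lemma aux_cut_approx {B : Type*} [CStarAlgebra B] [PartialOrder B] [StarOrderedRing B]
    (d : B) (hd : 0 ≤ d) {δ : ℝ} (hδ : 0 < δ) :
    ‖cfc (fun t : ℝ => max (t - 2 * δ) 0) d - d‖ ≤ 2 * δ := by
  have hds : IsSelfAdjoint d := .of_nonneg hd
  have h1 : cfc (fun t : ℝ => max (t - 2 * δ) 0) d - d =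
      cfc (fun t : ℝ => max (t - 2 * δ) 0 - t) d := by
    rw [cfc_sub (fun t : ℝ => max (t - 2 * δ) 0) (fun t => t) d (by fun_prop) (by fun_prop),
      cfc_id' ℝ d]
  rw [h1]
  refine norm_cfc_le (by positivity) fun t ht => ?_
  have ht0 : 0 ≤ t := spectrum_nonneg_of_nonneg hd ht
  rw [Real.norm_eq_abs, abs_le]
  constructor
  · linarith [le_max_left (t - 2 * δ) 0]
  · have : max (t - 2 * δ) 0 ≤ t := max_le (by linarith) ht0
    linarith


lemma aux_exists_K {B : Type*} [CStarAlgebra B] [PartialOrder B] [StarOrderedRing B]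
    (d : B) (hd : 0 ≤ d) {δ : ℝ} (hδ : 0 < δ) :
    ∃ K : B, star K = K ∧ K * aphi δ d = K ∧ ‖K * K - d‖ ≤ 2 * δ := by
  have hds : IsSelfAdjoint d := .of_nonneg hd
  have hphi := auxPhi_cont hδ
  refine ⟨cfc (fun t : ℝ => Real.sqrt (max (t - 2 * δ) 0)) d,
    (cfc_predicate (fun t : ℝ => Real.sqrt (max (t - 2 * δ) 0)) d : IsSelfAdjoint _).star_eq,
    ?_, ?_⟩
  · rw [aphi, ← cfc_mul _ _ d (by fun_prop) (by fun_prop)]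
    congr 1; ext t
    rcases le_total (t - 2 * δ) 0 with h | h
    · rw [max_eq_right h]; simp
    · have h1 : 0 < t - δ := by linarith
      have : auxPhi δ t = 1 := by
        unfold auxPhi
        rw [max_eq_left h1.le, max_eq_left (by linarith), div_self h1.ne', one_pow]
      rw [this, mul_one]
  · have hKK : cfc (fun t : ℝ => Real.sqrt (max (t - 2 * δ) 0)) d *
        cfc (fun t : ℝ => Real.sqrt (max (t - 2 * δ) 0)) d =
        cfc (fun t : ℝ => max (t - 2 * δ) 0) d := by
      rw [← cfc_mul _ _ d (by fun_prop) (by fun_prop)]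
      congr 1; ext t
      exact Real.mul_self_sqrt (le_max_right _ _)
    rw [hKK]
    exact aux_cut_approx d hd hδ

end finalLemmas

/-- Let `A` be unital of stable rank one.  If some positive matrix `d` over `A` satisfies
`d^{⊕n} ≾ 1` and `1 ≾ d^{⊕(n+1)}`, then there are `ε > 0` and pairwise orthogonal, mutually
equivalent positive elements `b 0, …, b (n-1)` of `A` with `∑ b i ≤ 1` and
`1 - ∑ b i ≾ (b 0 - ε)₊`. -/
theorem exists_almost_divisible_family [CStarAlgebra A] [PartialOrder A] [StarOrderedRing A]
    (hA : StableRankOne A) (n : ℕ) (hn : 1 ≤ n) {k : ℕ} (hk : 1 ≤ k)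
    (d : Matrix (Fin k) (Fin k) A) (hd : IsPos d)
    (h₁ : CuntzLE (dpow d n) (m1 (1 : A)))
    (h₂ : CuntzLE (m1 (1 : A)) (dpow d (n + 1))) :
    ∃ ε : ℝ, 0 < ε ∧ ∃ b : Fin n → A,
      (∀ i, 0 ≤ b i) ∧
      (∀ i j, i ≠ j → b i * b j = 0) ∧
      (∀ i, EquivPos (b i) (b ⟨0, hn⟩)) ∧
      (∑ i, b i) ≤ 1 ∧
      CuntzLE (m1 ((1 : A) - ∑ i, b i)) (m1 (cutPlus ε (b ⟨0, hn⟩))) := by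
  obtain ⟨x, hx⟩ := h₂
  have hd0 := hd
  obtain ⟨z, hz⟩ := hd0
  let d' : CStarMatrix (Fin k) (Fin k) A := CStarMatrix.ofMatrix d
  have hd' : 0 ≤ d' := by
    have : d' = star (CStarMatrix.ofMatrix z : CStarMatrix (Fin k) (Fin k) A) * CStarMatrix.ofMatrix z := hz
    rw [this]; exact star_mul_self_nonneg _
  have hds : IsSelfAdjoint d' := .of_nonneg hd'
  let r : ℕ → Fin (n + 1) → Matrix (Fin 1) (Fin k) A := fun m j => Matrix.of fun _ a => x m 0 (a, j)
  have hr : ∀ m, (x m * dpow d (n + 1) * (x m).conjTranspose) 0 0 =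
      ∑ j, (r m j * d * (r m j).conjTranspose) 0 0 := by
    intro m
    simp only [Matrix.mul_apply, dpow, Matrix.blockDiagonal_apply, r, Matrix.of_apply,
      Matrix.conjTranspose_apply, Fintype.sum_prod_type_right]
    refine Finset.sum_congr rfl fun j _ => Finset.sum_congr rfl fun a _ => ?_
    congr 1
    rw [Finset.sum_eq_single j]
    · simp
    · intro i _ hi
      simp [hi]
    · simp
  have hx0 : Tendsto (fun m => ∑ j, (r m j * d * (r m j).conjTranspose) 0 0) atTop
      (nhds (1 : A)) := by
    have := tendsto_pi_nhds.1 (tendsto_pi_nhds.1 hx 0) 0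
    simp only [hr] at this
    exact this
  have hev : ∀ᶠ m in atTop, ‖1 - ∑ j, (r m j * d * (r m j).conjTranspose) 0 0‖ < 1 := by
    have h := (tendsto_const_nhds (x := (1 : A))).sub hx0
    have h2 := h.norm
    rw [sub_self, norm_zero] at h2
    exact h2.eventually_lt_const one_pos
  obtain ⟨m, hm⟩ := hev.exists
  let F : CStarMatrix (Fin k) (Fin k) A → A := fun Y =>
    1 - ∑ j, (r m j * CStarMatrix.ofMatrix.symm Y * (r m j).conjTranspose) 0 0
  have hF : Continuous F := by
    have hent : ∀ a b, Continuous fun Y : CStarMatrix (Fin k) (Fin k) A => Y a b := fun a b =>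
      (continuous_apply b).comp (continuous_apply a)
    simp only [F, Matrix.mul_apply, CStarMatrix.ofMatrix_symm_apply]
    fun_prop
  choose K hK hKP hKK using fun l : ℕ =>
    aux_exists_K d' hd' (δ := 1 / ((l : ℝ) + 1)) (by positivity)
  have hlim : Tendsto (fun l : ℕ => K l * K l) atTop (nhds d') := by
    rw [tendsto_iff_norm_sub_tendsto_zero]
    refine squeeze_zero (fun _ => norm_nonneg _) hKK ?_
    simpa using (tendsto_one_div_add_atTop_nhds_zero_nat (𝕜 := ℝ)).const_mul 2
  have hev2 : ∀ᶠ l : ℕ in atTop, ‖F (K l * K l)‖ < 1 :=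
    (((hF.tendsto d').comp hlim).norm).eventually_lt_const hm
  obtain ⟨l, hl⟩ := hev2.exists
  obtain ⟨w, hw, hc⟩ := aux_columns n hn hk d hd h₁ (δ := 1 / ((l : ℝ) + 1)) (by positivity)
  exact aux_assemble hA n hn (CStarMatrix.ofMatrix.symm (K l))
    (CStarMatrix.ofMatrix.symm (aphi (1 / ((l : ℝ) + 1)) d')) (hK l) (hKP l) w hw hc (r m) hl
end
end

section
/- Let A be a unital C*-algebra and let n ≥ 1 be a natural number. Suppose there exist ε > 0 and positive elements b_1, …, b_n ∈ A of norm at most 1 which are pairwise orthogonal (b_i b_j = 0 for i ≠ j) and mutually equivalent (b_i ∼ b_1 for all i), such that 1_A − (b_1 + ⋯ + b_n) ≾ (b_1 − ε)₊. Then there exist elements v, s_1, …, s_n ∈ A satisfying: s_1* s_1 = s_i s_i* for all i; (s_i* s_i)(s_j* s_j) = 0 for all i ≠ j; v* v = 1_A − (s_1* s_1 + ⋯ + s_n* s_n); and v v* (s_1* s_1) = v v*. -/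
open Filter Topology

noncomputable section

variable {A : Type*}

/-- Intertwining for the continuous functional calculus. -/
theorem intertwine_cfc [CStarAlgebra A] (x a c : A) (ha : IsSelfAdjoint a) (hc : IsSelfAdjoint c)
    (hx : x * a = c * x) (f : ℝ → ℝ) (hf : Continuous f) :
    x * cfc f a = cfc f c * x := by
  have hpoly : ∀ p : Polynomial ℝ, x * Polynomial.aeval a p = Polynomial.aeval c p * x := by
    intro p
    induction p using Polynomial.induction_on' with
    | add p q hp hq => simp only [map_add, mul_add, add_mul, hp, hq]
    | monomial n r =>
      have hpow : ∀ n : ℕ, x * a ^ n = c ^ n * x := by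
        intro n
        induction n with
        | zero => simp
        | succ n ih => rw [pow_succ, ← mul_assoc, ih, mul_assoc, hx, ← mul_assoc, pow_succ]
      simp only [Polynomial.aeval_monomial, ← Algebra.smul_def, mul_smul_comm, smul_mul_assoc, hpow]
  have key : ∀ η : ℝ, 0 < η → ‖x * cfc f a - cfc f c * x‖ ≤ η * (2 * ‖x‖) := by
    intro η hη
    have hbd : Bornology.IsBounded (spectrum ℝ a ∪ spectrum ℝ c) :=
      (ContinuousFunctionalCalculus.isCompact_spectrum (R := ℝ) a).isBounded.union
        (ContinuousFunctionalCalculus.isCompact_spectrum (R := ℝ) c).isBounded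
    obtain ⟨M, hM⟩ := hbd.subset_closedBall 0
    rw [Real.closedBall_eq_Icc] at hM
    obtain ⟨p, hp⟩ := exists_polynomial_near_of_continuousOn _ _ f hf.continuousOn η hη
    have hest : ∀ d : A, IsSelfAdjoint d → spectrum ℝ d ⊆ spectrum ℝ a ∪ spectrum ℝ c →
        ‖Polynomial.aeval d p - cfc f d‖ ≤ η := by
      intro d hd hsub
      rw [← cfc_polynomial p d hd, ← cfc_sub _ _ d (by fun_prop) hf.continuousOn]
      refine norm_cfc_le hη.le fun t ht => ?_
      rw [Real.norm_eq_abs]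
      exact (hp t (hM (hsub ht))).le
    have e1 := hest a ha Set.subset_union_left
    have e2 := hest c hc Set.subset_union_right
    have : x * cfc f a - cfc f c * x
        = (Polynomial.aeval c p - cfc f c) * x - x * (Polynomial.aeval a p - cfc f a) := by
      rw [sub_mul, mul_sub, hpoly]; abel
    rw [this]
    calc _ ≤ ‖(Polynomial.aeval c p - cfc f c) * x‖ + ‖x * (Polynomial.aeval a p - cfc f a)‖ :=
          norm_sub_le _ _
      _ ≤ η * ‖x‖ + ‖x‖ * η := by
          gcongr
          · exact (norm_mul_le _ _).trans (by gcongr)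
          · exact (norm_mul_le _ _).trans (by gcongr)
      _ = _ := by ring
  rw [← sub_eq_zero, ← norm_le_zero_iff]
  refine le_of_forall_pos_le_add fun η hη => ?_
  have h1 := key (η / (2 * ‖x‖ + 1)) (by positivity)
  refine h1.trans ?_
  rw [zero_add, div_mul_eq_mul_div, div_le_iff₀ (by positivity)]
  nlinarith

/-- If `k * k ≤ x* x` with `k` self-adjoint, then `k * k = v* v` with `v` in the closure
of `x A`. -/
theorem exists_factor [CStarAlgebra A] [PartialOrder A] [StarOrderedRing A]
    (x k : A) (hk : IsSelfAdjoint k) (hle : k * k ≤ star x * x) :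
    ∃ v : A, star v * v = k * k ∧ ∀ p : A, p * x = x → p * v = v := by
  set z := star x * x with hz
  have hz0 : 0 ≤ z := star_mul_self_nonneg x
  have hzs : IsSelfAdjoint z := .of_nonneg hz0
  have hspec : ∀ t ∈ spectrum ℝ z, 0 ≤ t := fun t ht => spectrum_nonneg_of_nonneg hz0 ht
  let φ : ℕ → ℝ → ℝ := fun n t => 1 / max (√t) ((1 / 2) ^ n)
  have hmaxpos : ∀ n t, 0 < max (√t) ((1 / 2 : ℝ) ^ n) := fun n t =>
    lt_max_of_lt_right (by positivity)
  have hφc : ∀ n, Continuous (φ n) := by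
    intro n
    exact continuous_const.div (by fun_prop) fun t => (hmaxpos n t).ne'
  have hsc : Continuous (fun t : ℝ => √t) := by fun_prop
  set r := cfc (fun t : ℝ => √t) z with hr
  have hrs : IsSelfAdjoint r := cfc_predicate _ _
  have hrr : r * r = z := by
    rw [hr, ← cfc_mul _ _ z hsc.continuousOn hsc.continuousOn]
    conv_rhs => rw [← cfc_id ℝ z]
    exact cfc_congr fun t ht => Real.mul_self_sqrt (hspec t ht)
  let F : ℕ → A := fun n => cfc (φ n) z
  have hFs : ∀ n, IsSelfAdjoint (F n) := fun n => cfc_predicate _ _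
  have hest : ∀ n, ‖r * F n * k - k‖ ≤ (1 / 2) ^ n := by
    intro n
    let G : A := cfc (fun t => √t * φ n t - 1) z
    have hGc : Continuous (fun t => √t * φ n t - 1) := (hsc.mul (hφc n)).sub continuous_const
    have hG : r * F n - 1 = G := by
      simp only [G, F, hr]
      rw [cfc_sub (fun t => √t * φ n t) (fun _ => 1) z (hsc.mul (hφc n)).continuousOn
          continuousOn_const,
        cfc_mul _ _ z hsc.continuousOn (hφc n).continuousOn, cfc_const_one ℝ z]
    have hGs : IsSelfAdjoint G := cfc_predicate _ _
    have h1 : r * F n * k - k = G * k := by rw [← hG, sub_mul, one_mul]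
    have h2 : ‖G * k‖ * ‖G * k‖ = ‖G * (k * k) * G‖ := by
      rw [← CStarRing.norm_self_mul_star, star_mul, hGs.star_eq, hk.star_eq]
      simp only [mul_assoc]
    have h3 : ‖G * r‖ * ‖G * r‖ = ‖G * z * G‖ := by
      rw [← CStarRing.norm_self_mul_star, star_mul, hGs.star_eq, hrs.star_eq, ← hrr]
      simp only [mul_assoc]
    have h4 : ‖G * (k * k) * G‖ ≤ ‖G * z * G‖ := by
      apply CStarAlgebra.norm_le_norm_of_nonneg_of_le
      · have := star_mul_self_nonneg (k * G)
        rw [star_mul, hGs.star_eq, hk.star_eq] at this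
        simpa only [mul_assoc] using this
      · exact hGs.conjugate_le_conjugate hle
    have h5 : ‖G * r‖ ≤ (1 / 2) ^ n := by
      simp only [G, hr]
      rw [← cfc_mul _ _ z hGc.continuousOn hsc.continuousOn]
      refine norm_cfc_le (by positivity) fun t ht => ?_
      rw [Real.norm_eq_abs]
      simp only [φ]
      have hp : (0 : ℝ) < (1 / 2) ^ n := by positivity
      have hq := Real.sqrt_nonneg t
      rcases le_total (√t) ((1 / 2) ^ n) with hc | hc
      · rw [max_eq_right hc]
        have a1 : √t * (1 / (1 / 2) ^ n) ≤ 1 := by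
          rw [mul_one_div]; exact (div_le_one hp).2 hc
        have a2 : 0 ≤ √t * (1 / (1 / 2) ^ n) := by positivity
        rw [abs_le]
        constructor <;> nlinarith
      · rw [max_eq_left hc, mul_one_div, div_self (hp.trans_le hc).ne']
        simp
    rw [h1]
    refine le_trans ?_ h5
    rw [← h2, ← h3] at h4
    exact (mul_self_le_mul_self_iff (norm_nonneg _) (norm_nonneg _)).2 h4
  have hlim : Tendsto (fun n => r * F n * k) atTop (𝓝 k) := by
    rw [tendsto_iff_norm_sub_tendsto_zero]
    exact squeeze_zero (fun n => norm_nonneg _) hest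
      (tendsto_pow_atTop_nhds_zero_of_lt_one (by norm_num) (by norm_num))
  have hnorm : ∀ u : A, ‖x * u‖ = ‖r * u‖ := by
    intro u
    rw [← mul_self_inj_of_nonneg (norm_nonneg _) (norm_nonneg _),
      ← CStarRing.norm_star_mul_self, ← CStarRing.norm_star_mul_self, star_mul, star_mul,
      hrs.star_eq, mul_assoc, ← mul_assoc (star x), ← hz, ← hrr]
    simp only [mul_assoc]
  have hcau : CauchySeq (fun n => x * F n * k) := by
    have := hlim.cauchySeq
    rw [Metric.cauchySeq_iff] at this ⊢
    intro η hη
    obtain ⟨N, hN⟩ := this η hη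
    refine ⟨N, fun m hm n hn => ?_⟩
    have := hN m hm n hn
    rw [dist_eq_norm] at this ⊢
    simp only [mul_assoc] at this ⊢
    rwa [← mul_sub, hnorm, mul_sub]
  obtain ⟨v, hv⟩ := cauchySeq_tendsto_of_complete hcau
  refine ⟨v, ?_, ?_⟩
  · have l1 : Tendsto (fun n => star (x * F n * k) * (x * F n * k)) atTop (𝓝 (star v * v)) :=
      hv.star.mul hv
    have l2 : Tendsto (fun n => star (r * F n * k) * (r * F n * k)) atTop (𝓝 (star k * k)) :=
      hlim.star.mul hlim
    rw [hk.star_eq] at l2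
    refine tendsto_nhds_unique l1 (l2.congr fun n => ?_)
    simp only [star_mul, hrs.star_eq]
    have : r * (r * F n * k) = star x * (x * F n * k) := by
      simp only [← mul_assoc]; rw [hrr]
    rw [← mul_assoc] 
    simp only [mul_assoc] at this ⊢
    rw [this]
  · intro p hp
    refine tendsto_nhds_unique (hv.const_mul p) (hv.congr fun n => ?_)
    rw [← mul_assoc, ← mul_assoc, hp]

/-- Given `ε > 0` and pairwise orthogonal, mutually equivalent positive contractions
`b 0, …, b (n-1)` in a unital C*-algebra with `1 - ∑ b i ≾ (b 0 - ε)₊`, there are elements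
`v, s 0, …, s (n-1)` satisfying the dimension-drop relations. -/
theorem exists_dimension_drop_relations [CStarAlgebra A] [PartialOrder A] [StarOrderedRing A]
    (n : ℕ) (hn : 1 ≤ n) (ε : ℝ) (hε : 0 < ε) (b : Fin n → A)
    (hpos : ∀ i, 0 ≤ b i) (hnorm : ∀ i, ‖b i‖ ≤ 1)
    (horth : ∀ i j, i ≠ j → b i * b j = 0)
    (hequiv : ∀ i, EquivPos (b i) (b ⟨0, hn⟩))
    (h : CuntzLE (m1 ((1 : A) - ∑ i, b i)) (m1 (cutPlus ε (b ⟨0, hn⟩)))) :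
    ∃ (v : A) (s : Fin n → A),
      (∀ i, star (s ⟨0, hn⟩) * s ⟨0, hn⟩ = s i * star (s i)) ∧
      (∀ i j, i ≠ j → (star (s i) * s i) * (star (s j) * s j) = 0) ∧
      star v * v = 1 - ∑ i, star (s i) * s i ∧
      v * star v * (star (s ⟨0, hn⟩) * s ⟨0, hn⟩) = v * star v := by
  classical
  set i0 : Fin n := ⟨0, hn⟩ with hi0
  set B : A := ∑ i, b i with hB
  have hB0 : 0 ≤ B := Finset.sum_nonneg fun i _ => hpos i
  have hBs : IsSelfAdjoint B := .of_nonneg hB0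
  have hbs : ∀ i, IsSelfAdjoint (b i) := fun i => .of_nonneg (hpos i)
  obtain ⟨δ, hδ0, hδε, hδ2⟩ : ∃ δ : ℝ, 0 < δ ∧ δ ≤ ε ∧ δ ≤ 1 / 2 :=
    ⟨min ε (1 / 2), by positivity, min_le_left _ _, min_le_right _ _⟩
  have hmpos : ∀ t : ℝ, 0 < max t δ := fun t => lt_max_of_lt_right hδ0
  let q : ℝ → ℝ := fun t => 1 / max t δ
  have hqc : Continuous q := continuous_const.div (by fun_prop) fun t => (hmpos t).ne'
  have hq0 : ∀ t, 0 ≤ q t := fun t => (one_div_pos.2 (hmpos t)).le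
  let w : ℝ → ℝ := fun t => √(q t)
  have hwc : Continuous w := by fun_prop
  have hww : ∀ a : A, cfc w a * cfc w a = cfc q a := by
    intro a
    rw [← cfc_mul _ _ a hwc.continuousOn hwc.continuousOn]
    exact cfc_congr fun t _ => Real.mul_self_sqrt (hq0 t)
  choose x hx1 hx2 using hequiv
  -- the elements `s i`
  let s : Fin n → A := fun i => x i * cfc w (b i)
  have hcomm : ∀ (a : A), IsSelfAdjoint a → ∀ f : ℝ → ℝ, Continuous f → a * cfc f a = cfc f a * a :=
    fun a ha f hf => intertwine_cfc a a a ha ha rfl f hf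
  have hs1 : ∀ i, star (s i) * s i = b i * cfc q (b i) := by
    intro i
    have hw : IsSelfAdjoint (cfc w (b i)) := cfc_predicate _ _
    simp only [s]
    rw [star_mul, hw.star_eq, mul_assoc, ← mul_assoc (star (x i)), ← hx1 i, ← mul_assoc,
      ← hcomm _ (hbs i) w hwc, mul_assoc, hww]
  have hs2 : ∀ i, s i * star (s i) = b i0 * cfc q (b i0) := by
    intro i
    have hw : IsSelfAdjoint (cfc w (b i)) := cfc_predicate _ _
    have hint : x i * cfc q (b i) = cfc q (b i0) * x i :=
      intertwine_cfc _ _ _ (hbs i) (hbs i0) (by rw [hx1 i, hx2 i, mul_assoc]) q hqc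
    simp only [s]
    rw [star_mul, hw.star_eq, mul_assoc, ← mul_assoc (cfc w (b i)), hww, ← mul_assoc, hint,
      mul_assoc, ← hx2 i, hcomm _ (hbs i0) q hqc]
  have hsum : ∑ i, star (s i) * s i = B * cfc q B := by
    rw [hB, Finset.sum_mul, ← hB]
    refine Finset.sum_congr rfl fun i _ => ?_
    rw [hs1, hcomm _ (hbs i) q hqc]
    refine (intertwine_cfc _ _ _ hBs (hbs i) ?_ q hqc).symm
    rw [hB, Finset.mul_sum]
    exact Finset.sum_eq_single i (fun j _ hj => horth i j hj.symm) (by simp)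
  -- the complement
  let g : ℝ → ℝ := fun t => 1 - t * q t
  have hgc : Continuous g := continuous_const.sub (continuous_id.mul hqc)
  have hg0 : ∀ t, 0 ≤ g t := by
    intro t
    simp only [g, q, mul_one_div, sub_nonneg]
    exact (div_le_one (hmpos t)).2 (le_max_left _ _)
  have hg1 : ∀ t, δ ≤ t → g t = 0 := by
    intro t ht
    simp only [g, q, mul_one_div]
    rw [max_eq_left ht, div_self (hδ0.trans_le ht).ne', sub_self]
  have hcfcg : ∀ a : A, IsSelfAdjoint a → cfc g a = 1 - a * cfc q a := by
    intro a ha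
    have : cfc g a = cfc (fun _ : ℝ => (1 : ℝ)) a - cfc (fun t => t * q t) a :=
      cfc_sub _ _ a continuousOn_const (continuous_id.mul hqc).continuousOn
    rw [this, cfc_const_one ℝ a, cfc_mul (fun t => t) q a continuousOn_id hqc.continuousOn, cfc_id' ℝ a]
  let κ : ℝ → ℝ := fun t => √(g t)
  have hκc : Continuous κ := by fun_prop
  set k : A := cfc κ B with hk
  have hks : IsSelfAdjoint k := cfc_predicate _ _
  have hkk : k * k = 1 - B * cfc q B := by
    rw [← hcfcg B hBs, hk, ← cfc_mul _ _ B hκc.continuousOn hκc.continuousOn]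
    exact cfc_congr fun t _ => Real.mul_self_sqrt (hg0 t)
  -- `e` is the square root of the cut-down
  have hrc : Continuous (fun t : ℝ => (t - ε) ⊔ 0) := by fun_prop
  have hec : Continuous (fun t : ℝ => √((t - ε) ⊔ 0)) := by fun_prop
  set e : A := cfc (fun t : ℝ => √((t - ε) ⊔ 0)) (b i0) with he
  have hes : IsSelfAdjoint e := cfc_predicate _ _
  have hee : e * e = cutPlus ε (b i0) := by
    rw [he, ← cfc_mul _ _ _ hec.continuousOn hec.continuousOn, cutPlus]
    exact cfc_congr fun t _ => Real.mul_self_sqrt le_sup_right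
  have hfe : (b i0 * cfc q (b i0)) * e = e := by
    have h0 : cfc g (b i0) * e = 0 := by
      rw [he, ← cfc_mul _ _ _ hgc.continuousOn hec.continuousOn]
      rw [← cfc_const_zero ℝ (b i0)]
      refine cfc_congr fun t _ => ?_
      rcases le_total t ε with ht | ht
      · simp [max_eq_right (sub_nonpos.2 ht)]
      · simp [hg1 t (hδε.trans ht)]
    rw [hcfcg _ (hbs i0), sub_mul, one_mul, sub_eq_zero] at h0
    exact h0.symm
  -- Cuntz subequivalence
  obtain ⟨y, hy⟩ : ∃ y : A, ‖y * (e * e) * star y - (1 - B)‖ < 1 / 4 := by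
    obtain ⟨X, hX⟩ := h
    have hX' : Tendsto (fun m => (X m * m1 (cutPlus ε (b i0)) * (X m).conjTranspose) 0 0) atTop
        (𝓝 ((1 : A) - B)) := (tendsto_pi_nhds.1 ((tendsto_pi_nhds.1 hX) 0)) 0
    obtain ⟨m, hm⟩ := (Metric.tendsto_atTop.1 hX' (1 / 4) (by norm_num))
    have := hm m le_rfl
    rw [dist_eq_norm] at this
    refine ⟨X m 0 0, ?_⟩
    rw [hee]
    simpa [Matrix.mul_apply, m1] using this
  set Y : A := y * (e * e) * star y with hY
  have hYs : IsSelfAdjoint Y := by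
    rw [IsSelfAdjoint, hY]; simp [star_mul, hes.star_eq, mul_assoc]
  have hYB : algebraMap ℝ A (3 / 4) - B ≤ Y := by
    have h1 : IsSelfAdjoint (Y - (1 - B)) := hYs.sub ((IsSelfAdjoint.one A).sub hBs)
    have h2 := h1.neg_algebraMap_norm_le_self
    have h3 : algebraMap ℝ A ‖Y - (1 - B)‖ ≤ algebraMap ℝ A (1 / 4) :=
      algebraMap_mono A hy.le
    have h4 : algebraMap ℝ A (3 / 4) = 1 - algebraMap ℝ A (1 / 4) := by
      rw [← map_one (algebraMap ℝ A), ← map_sub]; norm_num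
    have h5 := (neg_le_neg h3).trans h2
    rw [h4]
    have h6 := add_le_add_left h5 (1 - B)
    calc _ = -algebraMap ℝ A (1 / 4) + (1 - B) := by abel
      _ ≤ _ := by simpa using h6
  let x0 : A := e * star y * ((2 : ℝ) • k)
  have hx0 : star x0 * x0 = (4 : ℝ) • (k * Y * k) := by
    simp only [x0, hY, star_mul, star_smul, star_star, hes.star_eq, hks.star_eq, star_trivial,
      smul_mul_assoc, mul_smul_comm, smul_smul, mul_assoc]
    norm_num
  have hle : k * k ≤ star x0 * x0 := by
    rw [hx0]
    have h1 : k * (algebraMap ℝ A (3 / 4) - B) * k ≤ k * Y * k :=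
      hks.conjugate_le_conjugate hYB
    have h2 : (4 : ℝ) • (k * (algebraMap ℝ A (3 / 4) - B) * k) ≤ (4 : ℝ) • (k * Y * k) :=
      smul_le_smul_of_nonneg_left h1 (by norm_num)
    refine le_trans ?_ h2
    have hl : Continuous (fun t : ℝ => 3 / 4 - t) := by fun_prop
    have e1 : algebraMap ℝ A (3 / 4) - B = cfc (fun t : ℝ => 3 / 4 - t) B := by
      rw [cfc_sub _ _ B (by fun_prop) (by fun_prop), cfc_const _ B, cfc_id' ℝ B]
    rw [e1, hk, ← cfc_mul _ _ B hκc.continuousOn hl.continuousOn,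
      ← cfc_mul (fun t => κ t * (3 / 4 - t)) κ B (hκc.mul hl).continuousOn hκc.continuousOn,
      ← cfc_mul _ _ B hκc.continuousOn hκc.continuousOn,
      ← cfc_smul (4 : ℝ) (fun t => κ t * (3 / 4 - t) * κ t) B ((hκc.mul hl).mul hκc).continuousOn]
    refine cfc_mono (fun t _ => ?_) (hκc.mul hκc).continuousOn
      (((hκc.mul hl).mul hκc).const_smul (4 : ℝ)).continuousOn
    have hsq : κ t * κ t = g t := Real.mul_self_sqrt (hg0 t)
    rcases le_total t (1 / 2) with ht | ht
    · simp only [smul_eq_mul]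
      nlinarith [hg0 t, mul_nonneg (hg0 t) (sub_nonneg.2 ht)]
    · have : κ t = 0 := by simp [κ, hg1 t (hδ2.trans ht)]
      simp [this]
  obtain ⟨v, hv1, hv2⟩ := exists_factor x0 k hks hle
  refine ⟨v, s, ?_, ?_, ?_, ?_⟩
  · intro i
    rw [hs1, hs2]
  · intro i j hij
    rw [hs1, hs1, hcomm _ (hbs i) q hqc, mul_assoc, ← mul_assoc (b i), horth i j hij]
    simp
  · rw [hv1, hkk, hsum]
  · have hfv : (b i0 * cfc q (b i0)) * v = v := hv2 _ (by
      simp only [x0]; rw [← mul_assoc, ← mul_assoc, hfe])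
    rw [← hs1 i0] at hfv
    have h1 : star (star (s i0) * s i0) = star (s i0) * s i0 := by simp
    have h2 := congrArg star hfv
    rw [star_mul, h1] at h2
    rw [mul_assoc, h2]
end
end
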